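/- Let n ≥ 1, let Ω ⊂ ℍⁿ be a non-empty bounded open set, let L : Ω × ℝ × ℝ²ⁿ → S^{2n×2n} be locally Lipschitz continuous and satisfy conditions (3.3), (3.4) and (3.7) (listed in the context) for some m > 1, let F[ψ] = ∇²_{H,s}ψ + L(·, ψ, ∇_H ψ), and let Σ be a non-empty open subset of S^{2n×2n} satisfying: (i) A ∈ Σ, B ∈ S^{2n×2n}, B positive definite imply A + B ∈ Σ; (ii) A ∈ Σ and c ∈ (1,∞) imply cA ∈ Σ. If w ∈ LSC(Ω̄) and v ∈ USC(Ω̄) are respectively a viscosity supersolution and a viscosity subsolution of F[ψ] ∈ ∂Σ in Ω, and if w ≥ v in Ω and w > v on ∂Ω, then w > v in Ω. -/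

import Mathlib

open Filter Topology Matrix Asymptotics

noncomputable section

/-- Points of the Heisenberg group `ℍⁿ`: `(x, y, t) ∈ ℝⁿ × ℝⁿ × ℝ`. -/
abbrev Heis (n : ℕ) : Type := (Fin n → ℝ) × (Fin n → ℝ) × ℝ

/-- Index type for the `2n` horizontal directions. -/
abbrev HIdx (n : ℕ) : Type := Fin n ⊕ Fin n

/-- `2n × 2n` real matrices. -/
abbrev HMat (n : ℕ) : Type := Matrix (HIdx n) (HIdx n) ℝ

namespace Heis

variable {n : ℕ}

/-- The Heisenberg group law. -/
def hmul (ξ η : Heis n) : Heis n :=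
  (ξ.1 + η.1, ξ.2.1 + η.2.1,
    ξ.2.2 + η.2.2 + 2 * ∑ i, (ξ.2.1 i * η.1 i - ξ.1 i * η.2.1 i))

/-- The group inverse `ξ⁻¹ = -ξ`. -/
def hinv (ξ : Heis n) : Heis n := (-ξ.1, -ξ.2.1, -ξ.2.2)

/-- `|z|²` for `ξ = (z, t)`. -/
def zsq (ξ : Heis n) : ℝ := ∑ i, (ξ.1 i ^ 2 + ξ.2.1 i ^ 2)

/-- The homogeneous norm `|ξ|_H = (|z|⁴ + t²)^{1/4}`. -/
def hnorm (ξ : Heis n) : ℝ := (zsq ξ ^ 2 + ξ.2.2 ^ 2) ^ ((1 : ℝ) / 4)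

/-- The left-invariant horizontal vector fields `X_j` (for `Sum.inl j`)
and `Y_j` (for `Sum.inr j`), as tangent vectors at `ξ`. -/
def vecField (j : HIdx n) (ξ : Heis n) : Heis n :=
  match j with
  | Sum.inl j => (Pi.single j 1, 0, 2 * ξ.2.1 j)
  | Sum.inr j => (0, Pi.single j 1, -(2 * ξ.1 j))

/-- Horizontal (Heisenberg) gradient `∇_H ψ (ξ) ∈ ℝ^{2n}`. -/
def hGrad (ψ : Heis n → ℝ) (ξ : Heis n) : HIdx n → ℝ :=
  fun j => fderiv ℝ ψ ξ (vecField j ξ)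

/-- Heisenberg Hessian: entry `(i, j)` is `(field j)((field i) ψ)(ξ)`. -/
def hHess (ψ : Heis n → ℝ) (ξ : Heis n) : HMat n :=
  Matrix.of fun i j =>
    fderiv ℝ (fun η => fderiv ℝ ψ η (vecField i η)) ξ (vecField j ξ)

/-- Symmetrized Heisenberg Hessian `∇²_{H,s} ψ`. -/
def hHessSym (ψ : Heis n → ℝ) (ξ : Heis n) : HMat n :=
  ((1 : ℝ) / 2) • (hHess ψ ξ + (hHess ψ ξ)ᵀ)

/-- The standard symplectic matrix `J = [[0, Iₙ], [-Iₙ, 0]]`. -/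
def Jmat (n : ℕ) : HMat n :=
  Matrix.of fun i j =>
    match i, j with
    | Sum.inl a, Sum.inr b => if a = b then (1 : ℝ) else 0
    | Sum.inr a, Sum.inl b => if a = b then (-1 : ℝ) else 0
    | _, _ => 0

/-- Euclidean norm of `p ∈ ℝ^{2n}`. -/
def pnorm (p : HIdx n → ℝ) : ℝ := Real.sqrt (∑ j, p j ^ 2)

/-- The Loewner (positive semidefinite) order on matrices. -/
def matLE (A B : HMat n) : Prop := (B - A).PosSemidef

/-- The operator `F[ψ] = ∇²_{H,s} ψ + L(·, ψ, ∇_H ψ)`. -/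
def Fop (L : Heis n → ℝ → (HIdx n → ℝ) → HMat n) (ψ : Heis n → ℝ) (ξ : Heis n) : HMat n :=
  hHessSym ψ ξ + L ξ (ψ ξ) (hGrad ψ ξ)

/-- Viscosity subsolution of `F[ψ] ∈ ∂Σ` in `Ω`: `F[ψ] ∈ closure Σ`
in the viscosity sense. -/
def IsSubsolution (Ω : Set (Heis n)) (L : Heis n → ℝ → (HIdx n → ℝ) → HMat n)
    (S : Set (HMat n)) (v : Heis n → EReal) : Prop :=
  ∀ ξ₀ ∈ Ω, ∀ φ : Heis n → ℝ, ContDiffOn ℝ 2 φ Ω → v ξ₀ = ((φ ξ₀ : ℝ) : EReal) →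
    (∀ᶠ η in nhds ξ₀, η ∈ Ω → v η ≤ ((φ η : ℝ) : EReal)) →
    Fop L φ ξ₀ ∈ closure S

/-- Viscosity supersolution of `F[ψ] ∈ ∂Σ` in `Ω`: `F[ψ] ∈ S^{2n×2n} ∖ Σ`
in the viscosity sense. -/
def IsSupersolution (Ω : Set (Heis n)) (L : Heis n → ℝ → (HIdx n → ℝ) → HMat n)
    (S : Set (HMat n)) (w : Heis n → EReal) : Prop :=
  ∀ ξ₀ ∈ Ω, ∀ φ : Heis n → ℝ, ContDiffOn ℝ 2 φ Ω → w ξ₀ = ((φ ξ₀ : ℝ) : EReal) →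
    (∀ᶠ η in nhds ξ₀, η ∈ Ω → ((φ η : ℝ) : EReal) ≤ w η) →
    Fop L φ ξ₀ ∉ S

/-- The class `USC(s)`: upper semicontinuous, valued in `ℝ ∪ {-∞}`, not identically `-∞`. -/
def USCFun (s : Set (Heis n)) (v : Heis n → EReal) : Prop :=
  UpperSemicontinuousOn v s ∧ (∀ ξ ∈ s, v ξ ≠ ⊤) ∧ (∃ ξ ∈ s, v ξ ≠ ⊥)

/-- The class `LSC(s)`: lower semicontinuous, valued in `ℝ ∪ {+∞}`, not identically `+∞`. -/
def LSCFun (s : Set (Heis n)) (w : Heis n → EReal) : Prop :=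
  LowerSemicontinuousOn w s ∧ (∀ ξ ∈ s, w ξ ≠ ⊥) ∧ (∃ ξ ∈ s, w ξ ≠ ⊤)

/-- `Σ` is (relatively) open as a subset of the space of symmetric matrices. -/
def RelOpen (S : Set (HMat n)) : Prop :=
  IsOpen {A : {M : HMat n // M.IsSymm} | A.1 ∈ S}

/-- The quadratic lower-order term
`L(ξ,s,p) = α(ξ,s) p⊗p - γ(ξ,s) Jp⊗Jp - β(ξ,s)|p|² I₂ₙ`. -/
def Lquad (α β γ : Heis n → ℝ → ℝ) : Heis n → ℝ → (HIdx n → ℝ) → HMat n :=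
  fun ξ s p =>
    α ξ s • vecMulVec p p - γ ξ s • vecMulVec (Jmat n *ᵥ p) (Jmat n *ᵥ p)
      - (β ξ s * ∑ j, p j ^ 2) • (1 : HMat n)

/-- The quadratic lower-order term with constant coefficients
`L(s,p) = a p⊗p - c Jp⊗Jp - b|p|² I₂ₙ`. -/
def LquadC (a b c : ℝ) : Heis n → ℝ → (HIdx n → ℝ) → HMat n :=
  fun _ _ p =>
    a • vecMulVec p p - c • vecMulVec (Jmat n *ᵥ p) (Jmat n *ᵥ p)
      - (b * ∑ j, p j ^ 2) • (1 : HMat n)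

/-- Locally Lipschitz on a set. -/
def LocallyLipschitzOnSet {X : Type*} [PseudoMetricSpace X] (s : Set X) (f : X → ℝ) : Prop :=
  ∀ x ∈ s, ∃ K : NNReal, ∃ t ∈ nhdsWithin x s, LipschitzOnWith K f t

/-- All entries of `L(ξ,s,·)` are differentiable at `p`. -/
def DiffInP (L : Heis n → ℝ → (HIdx n → ℝ) → HMat n) (ξ : Heis n) (s : ℝ)
    (p : HIdx n → ℝ) : Prop :=
  ∀ i j, DifferentiableAt ℝ (fun q => L ξ s q i j) p

/-- All entries of `L(·,s,p)` are differentiable at `ξ`. -/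
def DiffInXi (L : Heis n → ℝ → (HIdx n → ℝ) → HMat n) (ξ : Heis n) (s : ℝ)
    (p : HIdx n → ℝ) : Prop :=
  ∀ i j, DifferentiableAt ℝ (fun η => L η s p i j) ξ

/-- A norm of `∇_p L(ξ,s,p)`. -/
def pGradNorm (L : Heis n → ℝ → (HIdx n → ℝ) → HMat n) (ξ : Heis n) (s : ℝ)
    (p : HIdx n → ℝ) : ℝ :=
  Real.sqrt (∑ i, ∑ j, ∑ k, (fderiv ℝ (fun q => L ξ s q i j) p (Pi.single k 1)) ^ 2)

/-- A norm of `∇_ξ L(ξ,s,p)`. -/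
def xiGradNorm (L : Heis n → ℝ → (HIdx n → ℝ) → HMat n) (ξ : Heis n) (s : ℝ)
    (p : HIdx n → ℝ) : ℝ :=
  Real.sqrt (∑ i : HIdx n, ∑ j : HIdx n, ‖fderiv ℝ (fun η => L η s p i j) ξ‖ ^ 2)

/-- The matrix `p · ∇_p L(ξ,s,p)`. -/
def pDotGradL (L : Heis n → ℝ → (HIdx n → ℝ) → HMat n) (ξ : Heis n) (s : ℝ)
    (p : HIdx n → ℝ) : HMat n :=
  Matrix.of fun i j => fderiv ℝ (fun q => L ξ s q i j) p p

/-- Structural condition (3.3): `|∇_ξ L(ξ,s,p)| ≤ C|p|^m` and `|∇_p L(ξ,s,p)| ≤ C|p|`. -/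
def Cond33 (Ω : Set (Heis n)) (L : Heis n → ℝ → (HIdx n → ℝ) → HMat n) (m : ℝ) : Prop :=
  ∀ R : ℝ, 0 < R → ∃ C : ℝ, 0 < C ∧ ∀ ξ ∈ Ω, ∀ s : ℝ, |s| ≤ R → ∀ p : HIdx n → ℝ,
    (DiffInXi L ξ s p → xiGradNorm L ξ s p ≤ C * pnorm p ^ m) ∧
    (DiffInP L ξ s p → pGradNorm L ξ s p ≤ C * pnorm p)

/-- Structural condition (3.4): `0 ≤ L(ξ,s',p) - L(ξ,s,p) ≤ C(s'-s)|p|^m I₂ₙ`. -/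
def Cond34 (Ω : Set (Heis n)) (L : Heis n → ℝ → (HIdx n → ℝ) → HMat n) (m : ℝ) : Prop :=
  ∀ R : ℝ, 0 < R → ∃ C : ℝ, 0 < C ∧ ∀ ξ ∈ Ω, ∀ s s' : ℝ, -R ≤ s → s ≤ s' → s' ≤ R →
    ∀ p : HIdx n → ℝ,
      matLE 0 (L ξ s' p - L ξ s p) ∧
      matLE (L ξ s' p - L ξ s p) ((C * (s' - s) * pnorm p ^ m) • (1 : HMat n))

/-- The second inequality of condition (3.4): `L(ξ,s',p) - L(ξ,s,p) ≤ C(s'-s)|p|^m I₂ₙ`. -/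
def Cond34Upper (Ω : Set (Heis n)) (L : Heis n → ℝ → (HIdx n → ℝ) → HMat n) (m : ℝ) : Prop :=
  ∀ R : ℝ, 0 < R → ∃ C : ℝ, 0 < C ∧ ∀ ξ ∈ Ω, ∀ s s' : ℝ, -R ≤ s → s ≤ s' → s' ≤ R →
    ∀ p : HIdx n → ℝ,
      matLE (L ξ s' p - L ξ s p) ((C * (s' - s) * pnorm p ^ m) • (1 : HMat n))

/-- Structural condition (3.5). -/
def Cond35 (Ω : Set (Heis n)) (L : Heis n → ℝ → (HIdx n → ℝ) → HMat n) (m : ℝ) : Prop :=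
  ∀ R : ℝ, 0 < R → ∀ Λ : ℝ, 0 < Λ → ∃ θb : ℝ, 0 < θb ∧ ∃ C : ℝ, 0 < C ∧
    ∀ θ : ℝ, 0 ≤ θ → θ ≤ θb → ∀ ξ ∈ Ω, ∀ s : ℝ, |s| ≤ R → ∀ p : HIdx n → ℝ,
      DiffInP L ξ s p →
      matLE (pDotGradL L ξ s p - L ξ s p + (θ * Λ * pGradNorm L ξ s p) • (1 : HMat n)
              - θ • (1 : HMat n))
            (C • vecMulVec p p - ((1 / C) * pnorm p ^ m) • (1 : HMat n))

/-- Structural condition (3.7). -/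
def Cond37 (Ω : Set (Heis n)) (L : Heis n → ℝ → (HIdx n → ℝ) → HMat n) (m : ℝ) : Prop :=
  ∀ R : ℝ, 0 < R → ∀ Λ : ℝ, 0 < Λ → ∃ θb : ℝ, 0 < θb ∧ ∃ C : ℝ, 0 < C ∧
    ∀ θ : ℝ, 0 < θ → θ ≤ θb → ∀ ξ ∈ Ω, ∀ s : ℝ, |s| ≤ R → ∀ p : HIdx n → ℝ,
      DiffInP L ξ s p →
      matLE ((-C) • vecMulVec p p + ((1 / C) * pnorm p ^ m) • (1 : HMat n))
            (pDotGradL L ξ s p - L ξ s p - (θ * Λ * pGradNorm L ξ s p) • (1 : HMat n)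
              + θ • (1 : HMat n))

/-- `P` is a second-order Taylor witness for `u` at `ξ`: `u` is punctually second order
differentiable at `ξ` with expansion given by the `C²` function `P`. -/
def PunctualWitness (u P : Heis n → ℝ) (ξ : Heis n) : Prop :=
  ContDiff ℝ 2 P ∧ P ξ = u ξ ∧
    (fun η => u η - P η) =o[nhds ξ] (fun η => ‖η - ξ‖ ^ 2)

/-- The `ε`-lower envelope `w_ε`. -/
def lowerEnv (Ω : Set (Heis n)) (w : Heis n → EReal) (ε : ℝ) (ξ : Heis n) : EReal :=
  ⨅ η ∈ closure Ω, (w η + (((1 / ε) * hnorm (hmul (hinv η) ξ) ^ 4 : ℝ) : EReal))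

/-- The `ε`-upper envelope `v^ε`. -/
def upperEnv (Ω : Set (Heis n)) (v : Heis n → EReal) (ε : ℝ) (ξ : Heis n) : EReal :=
  ⨆ η ∈ closure Ω, (v η - (((1 / ε) * hnorm (hmul (hinv η) ξ) ^ 4 : ℝ) : EReal))

/-- The `ε`-lower envelope, as a real valued function. -/
def lowerEnvR (Ω : Set (Heis n)) (w : Heis n → EReal) (ε : ℝ) (ξ : Heis n) : ℝ :=
  (lowerEnv Ω w ε ξ).toReal

/-- The `ε`-upper envelope, as a real valued function. -/
def upperEnvR (Ω : Set (Heis n)) (v : Heis n → EReal) (ε : ℝ) (ξ : Heis n) : ℝ :=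
  (upperEnv Ω v ε ξ).toReal

/-- The lower semicontinuous envelope `g_*` relative to `O`. -/
def lscEnv (O : Set (Heis n)) (g : Heis n → EReal) (ξ : Heis n) : EReal :=
  ⨆ (r : ℝ) (_ : 0 < r), ⨅ η ∈ O ∩ Metric.ball ξ r, g η

/-- The upper semicontinuous envelope `g^*` relative to `O`. -/
def uscEnv (O : Set (Heis n)) (g : Heis n → EReal) (ξ : Heis n) : EReal :=
  ⨅ (r : ℝ) (_ : 0 < r), ⨆ η ∈ O ∩ Metric.ball ξ r, g η

end Heis

open Heis

section AlexandrovJensen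

open MeasureTheory

/-- One dimensional partition argument. -/
lemma aux_partition (k : ℝ → ℝ) (ε K : ℝ) 
    (h : ∀ s t : ℝ, 0 ≤ s → s ≤ t → t ≤ 1 → |k t - k s| ≤ ε * (t - s) + K * (t - s) ^ 2) :
    |k 1 - k 0| ≤ ε := by
  have key : ∀ N : ℕ, 0 < N → |k 1 - k 0| ≤ ε + K / N := by
    intro N hN
    have hNr : (0 : ℝ) < N := by exact_mod_cast hN
    have hind : ∀ j : ℕ, j ≤ N → |k (j / N) - k 0| ≤ j * (ε / N + K / N ^ 2) := by
      intro j
      induction j with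
      | zero => intro _; simp
      | succ j ih =>
        intro hj
        have h1 := ih (by omega)
        have hj' : ((j : ℝ) + 1) ≤ N := by exact_mod_cast hj
        have h2 := h (j / N) ((j + 1 : ℕ) / N) (by positivity)
          (by push_cast; gcongr; linarith) (by push_cast; rw [div_le_one hNr]; exact hj')
        have h3 : ((j + 1 : ℕ) : ℝ) / N - j / N = 1 / N := by push_cast; field_simp; ring
        rw [h3] at h2
        have h4 : |k ((j + 1 : ℕ) / N) - k 0| ≤
            |k ((j + 1 : ℕ) / N) - k (j / N)| + |k (j / N) - k 0| := by
          have := abs_add_le (k ((j + 1 : ℕ) / N) - k (j / N)) (k (j / N) - k 0)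
          simpa using this
        have h5 : ((j + 1 : ℕ) : ℝ) * (ε / N + K / N ^ 2) =
            (ε * (1 / N) + K * (1 / N) ^ 2) + j * (ε / N + K / N ^ 2) := by
          push_cast; field_simp; ring
        rw [h5]; linarith
    have := hind N le_rfl
    rw [div_self hNr.ne'] at this
    have h6 : (N : ℝ) * (ε / N + K / N ^ 2) = ε + K / N := by field_simp
    linarith
  have hlim : Tendsto (fun N : ℕ => ε + K / (N : ℝ)) atTop (𝓝 (ε + 0)) :=
    tendsto_const_nhds.add (tendsto_const_div_atTop_nhds_zero_nat K)
  rw [add_zero] at hlim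
  exact ge_of_tendsto hlim (eventually_atTop.2 ⟨1, fun N hN => key N hN⟩)

lemma aux_partition' (g m : ℝ → ℝ) (a b ε K : ℝ)
    (h1 : ∀ s t : ℝ, g s - g t ≥ m t * (s - t) - K * (s - t) ^ 2)
    (h2 : ∀ t : ℝ, 0 ≤ t → t ≤ 1 → |m t - a - b * t| ≤ ε) :
    |g 1 - g 0 - a - b / 2| ≤ ε := by
  have := aux_partition (fun t => g t - a * t - b / 2 * t ^ 2) ε (K + |b|) (by
    intro s t hs hst ht
    have e1 := h1 s t
    have e2 := h1 t s
    have f1 := abs_le.1 (h2 t (hs.trans hst) ht)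
    have f2 := abs_le.1 (h2 s hs (hst.trans ht))
    have g1 : 0 ≤ t - s := by linarith
    have g2 : b * (t - s) ^ 2 ≤ |b| * (t - s) ^ 2 := by gcongr; exact le_abs_self b
    have g3 : -b * (t - s) ^ 2 ≤ |b| * (t - s) ^ 2 := by gcongr; exact neg_le_abs b
    have g4 : 0 ≤ |b| * (t - s) ^ 2 := by positivity
    rw [abs_le]
    constructor <;> nlinarith)
  convert this using 2
  ring

variable {V : Type*} [NormedAddCommGroup V] [NormedSpace ℝ V]

lemma para_lip {U : V → ℝ} {G : V → V →L[ℝ] ℝ} {K : ℝ} (hK : 0 ≤ K)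
    (h1 : ∀ x y, U x + G x (y - x) - K * ‖y - x‖ ^ 2 ≤ U y) {e : V}
    (h2 : ∀ y, U y ≤ U e + G e (y - e) + K * ‖y - e‖ ^ 2) (y : V) :
    ‖G y - G e‖ ≤ 6 * K * ‖y - e‖ := by
  rcases eq_or_ne y e with rfl | hye
  · simp
  have hs : 0 < ‖y - e‖ := norm_pos_iff.2 (sub_ne_zero.2 hye)
  set s := ‖y - e‖ with hsdef
  have key : ∀ h : V, ‖h‖ = s → (G y - G e) h ≤ 6 * K * s ^ 2 := by
    intro h hh
    have a1 := h1 y (y + h)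
    have a2 := h2 (y + h)
    have a3 := h1 e y
    have e1 : y + h - e = (y - e) + h := by abel
    have hn : ‖y + h - e‖ ≤ 2 * s := by
      rw [e1]; calc _ ≤ ‖y - e‖ + ‖h‖ := norm_add_le _ _
        _ = 2 * s := by rw [hh]; ring
    have hn2 : ‖y + h - e‖ ^ 2 ≤ (2 * s) ^ 2 := by gcongr
    have hn3 : K * ‖y + h - e‖ ^ 2 ≤ K * (2 * s) ^ 2 := by gcongr
    rw [add_sub_cancel_left, hh] at a1
    rw [e1, map_add, ← e1] at a2
    simp only [_root_.sub_apply]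
    rw [← hsdef] at a3
    nlinarith
  refine ContinuousLinearMap.opNorm_le_bound _ (by positivity) ?_
  have key2 : ∀ h : V, (G y - G e) h ≤ 6 * K * s * ‖h‖ := by
    intro h
    rcases eq_or_ne h 0 with rfl | hh
    · simp
    have hh' : 0 < ‖h‖ := norm_pos_iff.2 hh
    have := key ((s / ‖h‖) • h) (by
      rw [norm_smul, Real.norm_of_nonneg (by positivity)]; field_simp)
    rw [map_smul, smul_eq_mul] at this
    have h3 : (G y - G e) h = (‖h‖ / s) * (s / ‖h‖ * (G y - G e) h) := by field_simp
    rw [h3]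
    calc _ ≤ (‖h‖ / s) * (6 * K * s ^ 2) := by gcongr
      _ = _ := by field_simp
  intro h
  rw [Real.norm_eq_abs, abs_le]
  constructor
  · have := key2 (-h); rw [map_neg, norm_neg] at this; linarith
  · exact key2 h

variable [FiniteDimensional ℝ V] [MeasurableSpace V] [BorelSpace V]

lemma density_pts (μ : Measure V) [μ.IsAddHaarMeasure] (E : Set V) :
    ∀ᵐ x ∂μ, x ∈ E → ∀ ε > 0, ∀ᶠ y in 𝓝 x, ∃ e ∈ E, ‖e - y‖ ≤ ε * ‖y - x‖ := by
  have hall : ∀ k : ℕ, ∀ᵐ x ∂μ, x ∈ E → ∀ᶠ y in 𝓝[≠] x, ∃ e ∈ E,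
      ‖e - y‖ ≤ (1 / ((k : ℝ) + 1)) * ‖y - x‖ := by
    intro k
    have h := IsUnifLocDoublingMeasure.ae_tendsto_measure_inter_div μ E ((k : ℝ) + 1)
    have h := ae_imp_of_ae_restrict h
    filter_upwards [h] with x hx hxE
    have hk : (0 : ℝ) < (k : ℝ) + 1 := by positivity
    have := hx hxE (l := 𝓝[≠] x) (fun y => y) (fun y => (1 / ((k : ℝ) + 1)) * ‖y - x‖) (by
      rw [tendsto_nhdsWithin_iff]
      constructor
      · have : Tendsto (fun y => (1 / ((k : ℝ) + 1)) * ‖y - x‖) (𝓝 x)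
            (𝓝 ((1 / ((k : ℝ) + 1)) * ‖x - x‖)) := by
          apply Continuous.tendsto; fun_prop
        simp only [sub_self, norm_zero, mul_zero] at this
        exact this.mono_left nhdsWithin_le_nhds
      · filter_upwards [self_mem_nhdsWithin] with y hy
        have : 0 < ‖y - x‖ := norm_pos_iff.2 (sub_ne_zero.2 hy)
        simp only [Set.mem_Ioi]; positivity) (by
      refine Eventually.of_forall fun y => ?_
      rw [Metric.mem_closedBall, dist_comm, dist_eq_norm]
      field_simp; exact le_rfl)
    have h2 : ∀ᶠ y in 𝓝[≠] x, (0 : ENNReal) <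
      μ (E ∩ Metric.closedBall y ((1 / ((k : ℝ) + 1)) * ‖y - x‖)) /
        μ (Metric.closedBall y ((1 / ((k : ℝ) + 1)) * ‖y - x‖)) :=
      this.eventually (lt_mem_nhds zero_lt_one)
    filter_upwards [h2] with y hy
    have hne : μ (E ∩ Metric.closedBall y ((1 / ((k : ℝ) + 1)) * ‖y - x‖)) ≠ 0 := by
      intro h0
      rw [h0] at hy; simp at hy
    obtain ⟨e, he⟩ := nonempty_of_measure_ne_zero hne
    refine ⟨e, he.1, ?_⟩
    have := he.2
    rwa [Metric.mem_closedBall, dist_eq_norm] at this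
  filter_upwards [ae_all_iff.2 hall] with x hx hxE ε hε
  obtain ⟨k, hk⟩ := exists_nat_one_div_lt hε
  have := hx k hxE
  rw [eventually_nhdsWithin_iff] at this
  filter_upwards [this] with y hy
  rcases eq_or_ne y x with rfl | hyx
  · exact ⟨y, hxE, by simp⟩
  · obtain ⟨e, he, hle⟩ := hy hyx
    refine ⟨e, he, hle.trans ?_⟩
    gcongr

/-- Punctual second order expansion almost everywhere on a set of points where the function is
touched from above and from below by paraboloids. -/
lemma alexandrov_on (μ : Measure V) [μ.IsAddHaarMeasure] {E : Set V}
    {U : V → ℝ} {G : V → V →L[ℝ] ℝ} {K : ℝ} (hK : 0 ≤ K)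
    (h1 : ∀ x y, U x + G x (y - x) - K * ‖y - x‖ ^ 2 ≤ U y)
    (h2 : ∀ e ∈ E, ∀ y, U y ≤ U e + G e (y - e) + K * ‖y - e‖ ^ 2) :
    ∀ᵐ x ∂μ, x ∈ E → ∃ A : V →L[ℝ] V →L[ℝ] ℝ, ∀ ε > 0, ∀ᶠ y in 𝓝 x,
      |U y - U x - G x (y - x) - A (y - x) (y - x) / 2| ≤ ε * ‖y - x‖ ^ 2 := by
  have hlip : ∀ e ∈ E, ∀ y, ‖G y - G e‖ ≤ 6 * K * ‖y - e‖ := fun e he y =>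
    para_lip hK h1 (h2 e he) y
  have hL : LipschitzOnWith (Real.toNNReal (6 * K)) G E := by
    apply LipschitzOnWith.of_dist_le_mul
    intro x hx y hy
    rw [dist_eq_norm, dist_eq_norm, Real.coe_toNNReal _ (by positivity)]
    exact hlip y hy x
  have hd := hL.ae_differentiableWithinAt_of_mem (μ := μ)
  filter_upwards [hd, density_pts μ E] with x hx1 hx2 hxE
  obtain ⟨A, hA⟩ := hx1 hxE
  refine ⟨A, fun ε hε => ?_⟩
  have hA' := hA.isLittleO
  set c : ℝ := 6 * K + 3 + ‖A‖ with hc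
  have hcpos : 0 < c := by positivity
  set ε₁ : ℝ := min 1 (ε / c) with hε₁
  have hε₁pos : 0 < ε₁ := by positivity
  have hε₁1 : ε₁ ≤ 1 := min_le_left _ _
  have hε₁c : ε₁ * c ≤ ε := by
    calc ε₁ * c ≤ ε / c * c := by gcongr; exact min_le_right _ _
      _ = ε := by field_simp
  have hA2 := hA'.def hε₁pos
  rw [eventually_nhdsWithin_iff, Metric.eventually_nhds_iff] at hA2
  obtain ⟨δ₁, hδ₁, hA2⟩ := hA2
  have hden := hx2 hxE ε₁ hε₁pos
  rw [Metric.eventually_nhds_iff] at hden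
  obtain ⟨δ₂, hδ₂, hden⟩ := hden
  have claim : ∀ y, ‖y - x‖ < min (δ₁ / 2) δ₂ →
      ‖G y - G x - A (y - x)‖ ≤ ε * ‖y - x‖ := by
    intro y hy
    obtain ⟨e, he, hey⟩ := hden (y := y) (by
      rw [dist_eq_norm]; exact hy.trans_le (min_le_right _ _))
    have hyd : ‖y - x‖ < δ₁ / 2 := hy.trans_le (min_le_left _ _)
    have hey1 : ‖e - y‖ ≤ ‖y - x‖ := hey.trans (by
      calc _ ≤ 1 * ‖y - x‖ := by gcongr
        _ = _ := one_mul _)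
    have hex : ‖e - x‖ ≤ 2 * ‖y - x‖ := by
      calc ‖e - x‖ = ‖(e - y) + (y - x)‖ := by congr 1; abel
        _ ≤ ‖e - y‖ + ‖y - x‖ := norm_add_le _ _
        _ ≤ _ := by linarith
    have h3 := hA2 (y := e) (by rw [dist_eq_norm]; linarith) he
    have h4 := hlip e he y
    have h5 : ‖A (e - y)‖ ≤ ‖A‖ * ‖e - y‖ := A.le_opNorm _
    have h6 : G y - G x - A (y - x) =
        (G y - G e) + (G e - G x - A (e - x)) + A (e - y) := by
      have : A (e - y) = A (e - x) - A (y - x) := by rw [← map_sub]; congr 1; abel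
      rw [this]; abel
    rw [h6]
    have hyx0 : 0 ≤ ‖y - x‖ := norm_nonneg _
    rw [norm_sub_rev] at h4
    have h4' : ‖G y - G e‖ ≤ 6 * K * (ε₁ * ‖y - x‖) := by
      rw [norm_sub_rev]
      refine h4.trans ?_
      rw [norm_sub_rev y e]
      gcongr
    calc _ ≤ ‖G y - G e‖ + ‖G e - G x - A (e - x)‖ + ‖A (e - y)‖ := norm_add₃_le
      _ ≤ 6 * K * (ε₁ * ‖y - x‖) + ε₁ * (2 * ‖y - x‖) + ‖A‖ * (ε₁ * ‖y - x‖) := by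
          gcongr
          · exact h3.trans (by gcongr)
          · exact h5.trans (by gcongr)
      _ ≤ (ε₁ * c) * ‖y - x‖ := by
          rw [hc]
          have : 0 ≤ ε₁ * ‖y - x‖ := by positivity
          nlinarith
      _ ≤ _ := by gcongr
  rw [Metric.eventually_nhds_iff]
  refine ⟨min (δ₁ / 2) δ₂, by positivity, fun y hy => ?_⟩
  rw [dist_eq_norm] at hy
  set h := y - x with hh
  have := aux_partition' (fun t => U (x + t • h)) (fun t => G (x + t • h) h) (G x h) (A h h)
    (ε * ‖h‖ ^ 2) (K * ‖h‖ ^ 2) (by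
      intro s t
      have a1 := h1 (x + t • h) (x + s • h)
      have : x + s • h - (x + t • h) = (s - t) • h := by rw [sub_smul]; abel
      rw [this, map_smul, norm_smul, smul_eq_mul, mul_pow, Real.norm_eq_abs, sq_abs] at a1
      nlinarith) (by
      intro t ht0 ht1
      have hn : ‖x + t • h - x‖ = t * ‖h‖ := by
        rw [add_sub_cancel_left, norm_smul, Real.norm_of_nonneg ht0]
      have hle : t * ‖h‖ ≤ ‖h‖ := by
        calc _ ≤ 1 * ‖h‖ := by gcongr
          _ = _ := one_mul _
      have c1 := claim (x + t • h) (by rw [hn]; linarith)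
      have c2 := (G (x + t • h) - G x - A (x + t • h - x)).le_opNorm h
      rw [add_sub_cancel_left, map_smul] at c1 c2
      simp only [_root_.sub_apply, _root_.smul_apply, smul_eq_mul,
        Real.norm_eq_abs] at c2
      have hn2 : ‖t • h‖ = t * ‖h‖ := by rw [norm_smul, Real.norm_of_nonneg ht0]
      rw [hn2] at c1
      rw [mul_comm (A h h) t]
      refine c2.trans ?_
      calc _ ≤ ε * (t * ‖h‖) * ‖h‖ := by gcongr
        _ ≤ ε * ‖h‖ * ‖h‖ := by gcongr
        _ = _ := by ring)
  simp only [one_smul, zero_smul, add_zero] at this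
  have hxy : x + h = y := by rw [hh]; abel
  rwa [hxy] at this

end AlexandrovJensen

section JensenPart

open MeasureTheory

/-- If `a t + b t² ≤ ε t²` for all small `t > 0` and every `ε`, together with the reflected
inequality, then `b ≤ 0`. -/
lemma aux_quad (a b : ℝ) (h : ∀ ε > 0, ∃ δ > 0, ∀ t : ℝ, |t| < δ → a * t + b * t ^ 2 ≤ ε * t ^ 2) :
    b ≤ 0 := by
  by_contra hb
  push Not at hb
  obtain ⟨δ, hδ, hh⟩ := h (b / 2) (by positivity)
  have h1 := hh (δ / 2) (by rw [abs_of_pos (by positivity)]; linarith)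
  have h2 := hh (-(δ / 2)) (by rw [abs_neg, abs_of_pos (by positivity)]; linarith)
  have : 0 < b * (δ / 2) ^ 2 := by positivity
  nlinarith

lemma aux_lin (a c δ : ℝ) (hδ : 0 < δ) (h : ∀ t : ℝ, 0 < t → t < δ → a * t ≤ c * t ^ 2) :
    a ≤ 0 := by
  by_contra ha
  push Not at ha
  set t := min (δ / 2) (a / (2 * (|c| + 1))) with ht
  have htpos : 0 < t := by positivity
  have h1 := h t htpos ((min_le_left _ _).trans_lt (by linarith))
  have h2 : t ≤ a / (2 * (|c| + 1)) := min_le_right _ _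
  rw [le_div_iff₀ (by positivity)] at h2
  have h3 : c * t ≤ |c| * t := by gcongr; exact le_abs_self c
  have h4 : a * t ≤ (c * t) * t := by nlinarith
  have h5 : a ≤ c * t := le_of_mul_le_mul_right h4 htpos
  nlinarith

variable {V : Type*} [NormedAddCommGroup V] [NormedSpace ℝ V]

lemma para_grad_bound {U : V → ℝ} {G : V →L[ℝ] ℝ} {K C₀ : ℝ} (hK : 0 ≤ K) (hC₀ : 0 ≤ C₀) {e : V}
    (h1 : ∀ y, U e + G (y - e) - K * ‖y - e‖ ^ 2 ≤ U y)
    (hB : ∀ y, U y - U e ≤ C₀ * (1 + ‖y - e‖ ^ 2)) : ‖G‖ ≤ 2 * C₀ + K := by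
  have key : ∀ h : V, ‖h‖ = 1 → G h ≤ 2 * C₀ + K := by
    intro h hh
    have a1 := h1 (e + h)
    have a2 := hB (e + h)
    rw [add_sub_cancel_left, hh] at a1 a2
    linarith
  have key2 : ∀ h : V, G h ≤ (2 * C₀ + K) * ‖h‖ := by
    intro h
    rcases eq_or_ne h 0 with rfl | hh
    · simp
    have hh' : 0 < ‖h‖ := norm_pos_iff.2 hh
    have := key (‖h‖⁻¹ • h) (by rw [norm_smul, norm_inv, norm_norm]; field_simp)
    rw [map_smul, smul_eq_mul, inv_mul_le_iff₀ hh'] at this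
    linarith
  refine ContinuousLinearMap.opNorm_le_bound _ (by positivity) fun h => ?_
  rw [Real.norm_eq_abs, abs_le]
  constructor
  · have := key2 (-h); rw [map_neg, norm_neg] at this; linarith
  · exact key2 h

lemma para_global {U : V → ℝ} {G : V →L[ℝ] ℝ} {K C₀ d : ℝ} (hK : 0 ≤ K) (hC₀ : 0 ≤ C₀) (hd : 0 < d)
    {e : V}
    (h1 : ∀ y, U e + G (y - e) - K * ‖y - e‖ ^ 2 ≤ U y)
    (hB : ∀ y, U y - U e ≤ C₀ * (1 + ‖y - e‖ ^ 2))
    (hloc : ∀ y, ‖y - e‖ < d → U y ≤ U e + G (y - e) + K * ‖y - e‖ ^ 2) (y : V) :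
    U y ≤ U e + G (y - e) +
      (K + (C₀ * (1 / d ^ 2 + 1) + (2 * C₀ + K) / d)) * ‖y - e‖ ^ 2 := by
  rcases lt_or_ge ‖y - e‖ d with hy | hy
  · have h := hloc y hy
    have : 0 ≤ (C₀ * (1 / d ^ 2 + 1) + (2 * C₀ + K) / d) * ‖y - e‖ ^ 2 := by positivity
    nlinarith
  · have hG := para_grad_bound hK hC₀ h1 hB
    have h2 := hB y
    have h3 : |G (y - e)| ≤ (2 * C₀ + K) * ‖y - e‖ := by
      have := G.le_opNorm (y - e)
      rw [Real.norm_eq_abs] at this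
      exact this.trans (by gcongr)
    have h4 := (abs_le.1 h3).1
    set s := ‖y - e‖
    have h5 : 1 ≤ 1 / d ^ 2 * s ^ 2 := by
      rw [one_div, ← div_eq_inv_mul, one_le_div (by positivity)]; gcongr
    have h6 : s ≤ 1 / d * s ^ 2 := by
      rw [one_div, ← div_eq_inv_mul, le_div_iff₀ hd]; nlinarith
    have h7 : C₀ * 1 ≤ C₀ * (1 / d ^ 2 * s ^ 2) := by gcongr
    have h8 : (2 * C₀ + K) * s ≤ (2 * C₀ + K) * (1 / d * s ^ 2) := by gcongr
    have h9 : 0 ≤ K * s ^ 2 := by positivity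
    have h10 : (K + (C₀ * (1 / d ^ 2 + 1) + (2 * C₀ + K) / d)) * s ^ 2 =
      K * s ^ 2 + C₀ * (1 / d ^ 2 * s ^ 2) + C₀ * s ^ 2 + (2 * C₀ + K) * (1 / d * s ^ 2) := by
      ring
    rw [h10]; nlinarith

variable [FiniteDimensional ℝ V]

theorem jensen_alexandrov 
    {U₁ U₂ : V → ℝ} {G₁ G₂ : V → V →L[ℝ] ℝ} {K C₀ d r : ℝ} (hK : 0 ≤ K) (hC₀ : 0 ≤ C₀)
    (hd : 0 < d) (hr : 0 < r) {C : Set V}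
    (h1 : ∀ x y, U₁ x + G₁ x (y - x) - K * ‖y - x‖ ^ 2 ≤ U₁ y)
    (h2 : ∀ x y, U₂ x + G₂ x (y - x) - K * ‖y - x‖ ^ 2 ≤ U₂ y)
    (hB1 : ∀ e ∈ C, ∀ y, U₁ y - U₁ e ≤ C₀ * (1 + ‖y - e‖ ^ 2))
    (hB2 : ∀ e ∈ C, ∀ y, U₂ y - U₂ e ≤ C₀ * (1 + ‖y - e‖ ^ 2))
    (hmax : ∀ p : V →L[ℝ] ℝ, ‖p‖ < r → ∃ x ∈ C, Metric.ball x d ⊆ C ∧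
      ∀ y ∈ C, U₁ y + U₂ y - p y ≤ U₁ x + U₂ x - p x) :
    ∃ p : V →L[ℝ] ℝ, ‖p‖ < r ∧ ∃ x ∈ C, 
      (∀ y ∈ C, U₁ y + U₂ y - p y ≤ U₁ x + U₂ x - p x) ∧
      G₁ x + G₂ x = p ∧
      ∃ A₁ A₂ : V →L[ℝ] V →L[ℝ] ℝ,
        (∀ ε > 0, ∀ᶠ y in 𝓝 x,
          |U₁ y - U₁ x - G₁ x (y - x) - A₁ (y - x) (y - x) / 2| ≤ ε * ‖y - x‖ ^ 2) ∧
        (∀ ε > 0, ∀ᶠ y in 𝓝 x,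
          |U₂ y - U₂ x - G₂ x (y - x) - A₂ (y - x) (y - x) / 2| ≤ ε * ‖y - x‖ ^ 2) ∧
        ∀ h, A₁ h h + A₂ h h ≤ 0 := by
  borelize V
  borelize (V →L[ℝ] ℝ)
  choose! X hXC hXball hXmax using hmax
  have hgrad : ∀ p : V →L[ℝ] ℝ, ‖p‖ < r → G₁ (X p) + G₂ (X p) = p := by
    intro p hp
    have key : ∀ h : V, (G₁ (X p) + G₂ (X p) - p) h ≤ 0 := by
      intro h
      apply aux_lin _ (2 * K * ‖h‖ ^ 2) (d / (‖h‖ + 1)) (by positivity)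
      intro t ht htd
      have hn : ‖t • h‖ = t * ‖h‖ := by rw [norm_smul, Real.norm_of_nonneg ht.le]
      have hmem : X p + t • h ∈ C := by
        apply hXball p hp
        rw [Metric.mem_ball, dist_eq_norm, add_sub_cancel_left, hn]
        rw [lt_div_iff₀ (by positivity)] at htd
        nlinarith [norm_nonneg h]
      have a0 := hXmax p hp _ hmem
      have a1 := h1 (X p) (X p + t • h)
      have a2 := h2 (X p) (X p + t • h)
      rw [add_sub_cancel_left, hn, map_smul, smul_eq_mul] at a1 a2
      rw [map_add, map_smul, smul_eq_mul] at a0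
      simp only [_root_.sub_apply, _root_.add_apply]
      nlinarith
    ext h
    have k1 := key h
    have k2 := key (-h)
    rw [map_neg] at k2
    simp only [_root_.sub_apply, _root_.add_apply] at k1 k2 ⊢
    linarith
  set E : Set V := X '' Metric.ball 0 r with hE
  set K' := K + (C₀ * (1 / d ^ 2 + 1) + (2 * C₀ + K) / d) with hK'
  have hKK' : K ≤ K' := by
    have : 0 ≤ C₀ * (1 / d ^ 2 + 1) + (2 * C₀ + K) / d := by positivity
    rw [hK']; linarith
  have hK'0 : 0 ≤ K' := hK.trans hKK'
  have hup1 : ∀ e ∈ E, ∀ y, U₁ y ≤ U₁ e + G₁ e (y - e) + K' * ‖y - e‖ ^ 2 := by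
    rintro _ ⟨p, hp, rfl⟩ y
    have hp : ‖p‖ < r := by simpa using hp
    refine para_global hK hC₀ hd (h1 _) (hB1 _ (hXC p hp)) (fun y hy => ?_) y
    have a0 := hXmax p hp y (hXball p hp (by rwa [Metric.mem_ball, dist_eq_norm]))
    have a2 := h2 (X p) y
    have a3 := congrArg (fun f : V →L[ℝ] ℝ => f (y - X p)) (hgrad p hp)
    simp only [_root_.add_apply, map_sub p] at a3
    linarith
  have hup2 : ∀ e ∈ E, ∀ y, U₂ y ≤ U₂ e + G₂ e (y - e) + K' * ‖y - e‖ ^ 2 := by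
    rintro _ ⟨p, hp, rfl⟩ y
    have hp : ‖p‖ < r := by simpa using hp
    refine para_global hK hC₀ hd (h2 _) (hB2 _ (hXC p hp)) (fun y hy => ?_) y
    have a0 := hXmax p hp y (hXball p hp (by rwa [Metric.mem_ball, dist_eq_norm]))
    have a2 := h1 (X p) y
    have a3 := congrArg (fun f : V →L[ℝ] ℝ => f (y - X p)) (hgrad p hp)
    simp only [_root_.add_apply, map_sub p] at a3
    linarith
  have h1' : ∀ x y, U₁ x + G₁ x (y - x) - K' * ‖y - x‖ ^ 2 ≤ U₁ y := fun x y => by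
    have := h1 x y
    have h3 : K * ‖y - x‖ ^ 2 ≤ K' * ‖y - x‖ ^ 2 := by gcongr
    linarith
  have h2' : ∀ x y, U₂ x + G₂ x (y - x) - K' * ‖y - x‖ ^ 2 ≤ U₂ y := fun x y => by
    have := h2 x y
    have h3 : K * ‖y - x‖ ^ 2 ≤ K' * ‖y - x‖ ^ 2 := by gcongr
    linarith
  set D : ℕ := Module.finrank ℝ V with hD
  have hD2 : Module.finrank ℝ (V →L[ℝ] ℝ) = D := by
    rw [← (LinearMap.toContinuousLinearMap (𝕜 := ℝ) (E := V) (F' := ℝ)).finrank_eq]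
    rw [Module.finrank_linearMap]; simp [hD]
  let μ : Measure V := Measure.hausdorffMeasure (D : ℝ)
  have : μ.IsAddHaarMeasure := isAddHaarMeasure_hausdorffMeasure
  let ν : Measure (V →L[ℝ] ℝ) := Measure.hausdorffMeasure (D : ℝ)
  have : ν.IsAddHaarMeasure := by
    have := isAddHaarMeasure_hausdorffMeasure (E := V →L[ℝ] ℝ)
    rw [hD2] at this; exact this
  have hlip : LipschitzOnWith (Real.toNNReal (12 * K')) (fun x => G₁ x + G₂ x) E := by
    apply LipschitzOnWith.of_dist_le_mul
    intro x hx y hy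
    rw [dist_eq_norm, dist_eq_norm, Real.coe_toNNReal _ (by positivity)]
    have l1 := para_lip hK'0 h1' (hup1 y hy) x
    have l2 := para_lip hK'0 h2' (hup2 y hy) x
    calc _ = ‖(G₁ x - G₁ y) + (G₂ x - G₂ y)‖ := by congr 1; abel
      _ ≤ _ := norm_add_le _ _
      _ ≤ _ := by linarith
  have himg : (fun x => G₁ x + G₂ x) '' E = Metric.ball 0 r := by
    rw [hE, Set.image_image]
    ext q
    constructor
    · rintro ⟨p, hp, rfl⟩
      have hp' : ‖p‖ < r := by simpa using hp
      simp only [hgrad p hp']; exact hp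
    · intro hq
      have hp' : ‖q‖ < r := by simpa using hq
      exact ⟨q, hq, hgrad q hp'⟩
  have hμE : μ E ≠ 0 := by
    intro h0
    have h3 := hlip.hausdorffMeasure_image_le (d := (D : ℝ)) (by positivity)
    have h4 : ν (Metric.ball 0 r) ≤ _ := himg ▸ h3
    have h5 : Measure.hausdorffMeasure (D : ℝ) E = 0 := h0
    rw [h5, mul_zero] at h4
    have h6 : 0 < ν (Metric.ball 0 r) := Metric.measure_ball_pos ν 0 hr
    exact absurd h4 (not_le.2 h6)
  have hA1 := alexandrov_on μ hK'0 h1' hup1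
  have hA2 := alexandrov_on μ hK'0 h2' hup2
  have hex : ∃ x ∈ E, (∃ A : V →L[ℝ] V →L[ℝ] ℝ, ∀ ε > 0, ∀ᶠ y in 𝓝 x,
      |U₁ y - U₁ x - G₁ x (y - x) - A (y - x) (y - x) / 2| ≤ ε * ‖y - x‖ ^ 2) ∧
      (∃ A : V →L[ℝ] V →L[ℝ] ℝ, ∀ ε > 0, ∀ᶠ y in 𝓝 x,
      |U₂ y - U₂ x - G₂ x (y - x) - A (y - x) (y - x) / 2| ≤ ε * ‖y - x‖ ^ 2) := by
    by_contra hcon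
    push Not at hcon
    apply hμE
    have : ∀ᵐ x ∂μ, x ∉ E := by
      filter_upwards [hA1, hA2] with x hx1 hx2 hxE
      obtain ⟨A₁, hA₁⟩ := hx1 hxE
      obtain ⟨A₂, hA₂⟩ := hx2 hxE
      obtain ⟨ε, hε, hh⟩ := hcon x hxE ⟨A₁, hA₁⟩ A₂
      have := hA₂ ε hε
      obtain ⟨y, hy1, hy2⟩ := (hh.and_eventually this).exists
      linarith
    simpa [ae_iff] using this
  obtain ⟨x, ⟨p, hp, rfl⟩, ⟨A₁, hA₁⟩, ⟨A₂, hA₂⟩⟩ := hex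
  have hp : ‖p‖ < r := by simpa using hp
  refine ⟨p, hp, X p, hXC p hp, hXmax p hp, hgrad p hp, A₁, A₂, hA₁, hA₂, fun h => ?_⟩
  have hq : A₁ h h / 2 + A₂ h h / 2 ≤ 0 := by
    apply aux_quad 0
    intro ε hε
    set ε' := ε / (2 * (‖h‖ ^ 2 + 1)) with hε'
    have hε'pos : 0 < ε' := by positivity
    obtain ⟨δ₁, hδ₁, b1⟩ := Metric.eventually_nhds_iff.1 (hA₁ ε' hε'pos)
    obtain ⟨δ₂, hδ₂, b2⟩ := Metric.eventually_nhds_iff.1 (hA₂ ε' hε'pos)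
    refine ⟨min d (min δ₁ δ₂) / (‖h‖ + 1), by positivity, fun t ht => ?_⟩
    rw [lt_div_iff₀ (by positivity)] at ht
    have hn : ‖t • h‖ = |t| * ‖h‖ := by rw [norm_smul, Real.norm_eq_abs]
    have hlt : |t| * ‖h‖ < min d (min δ₁ δ₂) := by nlinarith [abs_nonneg t]
    have hdist : dist (X p + t • h) (X p) < min d (min δ₁ δ₂) := by
      rw [dist_eq_norm, add_sub_cancel_left, hn]; exact hlt
    have c0 := hXmax p hp _ (hXball p hp (Metric.mem_ball.2
      (hdist.trans_le (min_le_left _ _))))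
    have c1 := b1 (hdist.trans_le ((min_le_right _ _).trans (min_le_left _ _)))
    have c2 := b2 (hdist.trans_le ((min_le_right _ _).trans (min_le_right _ _)))
    rw [add_sub_cancel_left, hn, mul_pow, sq_abs] at c1 c2
    simp only [map_smul, _root_.smul_apply, smul_eq_mul] at c1 c2
    have c1' := (abs_le.1 c1).1
    have c2' := (abs_le.1 c2).1
    rw [map_add, map_smul, smul_eq_mul] at c0
    have a3 := congrArg (fun f : V →L[ℝ] ℝ => t * f h) (hgrad p hp)
    simp only [_root_.add_apply] at a3
    have e1 : 2 * (ε' * (t ^ 2 * ‖h‖ ^ 2)) ≤ ε * t ^ 2 := by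
      have : ε' * (2 * (‖h‖ ^ 2 + 1)) = ε := by rw [hε']; field_simp
      have h0 : 0 ≤ ε' * t ^ 2 := by positivity
      calc _ ≤ (ε' * (2 * (‖h‖ ^ 2 + 1))) * t ^ 2 := by nlinarith
        _ = _ := by rw [this]
    nlinarith
  linarith

end JensenPart

open MeasureTheory in
theorem ae_diff_of_locLip {E : Type*} [NormedAddCommGroup E] [NormedSpace ℝ E]
    [FiniteDimensional ℝ E] [MeasurableSpace E] [BorelSpace E] (μ : Measure E)
    [μ.IsAddHaarMeasure] {O : Set E} (hO : IsOpen O) {f : E → ℝ}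
    (hf : LocallyLipschitzOn O f) : ∀ᵐ x ∂μ, x ∈ O → DifferentiableAt ℝ f x := by
  have : μ {x | x ∈ O ∧ ¬ DifferentiableAt ℝ f x} = 0 := by
    refine measure_null_of_locally_null _ fun x hx => ?_
    obtain ⟨K, t, ht, hfl⟩ := hf hx.1
    rw [hO.nhdsWithin_eq hx.1] at ht
    obtain ⟨u, hut, huo, hxu⟩ := mem_nhds_iff.1 ht
    refine ⟨_, inter_mem_nhdsWithin _ (huo.mem_nhds hxu), ?_⟩
    have h2 := (hfl.mono hut).ae_differentiableWithinAt_of_mem (μ := μ)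
    rw [ae_iff] at h2
    refine measure_mono_null ?_ h2
    rintro y ⟨hy1, hy2⟩
    simp only [Set.mem_ofPred_eq, Classical.not_imp]
    exact ⟨hy2, fun h => hy1.2 (h.differentiableAt (huo.mem_nhds hy2))⟩
  rw [ae_iff]
  convert this using 3
  ext x; simp

open MeasureTheory in
theorem ac_mono {g : ℝ → ℝ} {a b : ℝ} (hab : a ≤ b) (hg : AbsolutelyContinuousOnInterval g a b)
    (hd : ∀ᵐ s : ℝ, s ∈ Set.Ioo a b → ∃ d, 0 ≤ d ∧ HasDerivAt g d s) : g a ≤ g b := by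
  have h := hg.integral_deriv_eq_sub
  have : 0 ≤ ∫ x in a..b, deriv g x := by
    refine intervalIntegral.integral_nonneg_of_ae_restrict hab ?_
    rw [← Measure.restrict_congr_set Ioo_ae_eq_Icc]
    rw [Filter.EventuallyLE, ae_restrict_iff' measurableSet_Ioo]
    filter_upwards [hd] with s hs hs'
    obtain ⟨d, hd0, hd1⟩ := hs hs'
    rw [hd1.deriv]; exact hd0
  linarith

open MeasureTheory in
theorem ae_curve {E : Type*} [NormedAddCommGroup E] [NormedSpace ℝ E]
    [FiniteDimensional ℝ E] [MeasurableSpace E] [BorelSpace E] (μ : Measure E)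
    [μ.IsAddHaarMeasure] {N : Set E} (hN : μ N = 0) {c : ℝ → ℝ} {b : ℝ → E}
    (hc : Continuous c) (hb : Continuous b) {I : Set ℝ} (hI : MeasurableSet I)
    (hcI : ∀ s ∈ I, c s ≠ 0) :
    ∀ᵐ h ∂μ, ∀ᵐ s : ℝ, s ∈ I → c s • h + b s ∉ N := by
  set N' := toMeasurable μ N
  have hN' : MeasurableSet N' := measurableSet_toMeasurable _ _
  have hN0 : μ N' = 0 := by rw [measure_toMeasurable, hN]
  have key : ∀ᵐ h ∂μ, ∀ᵐ s : ℝ, s ∈ I → c s • h + b s ∉ N' := by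
    rw [Measure.ae_ae_comm]
    · refine Filter.Eventually.of_forall fun s => ?_
      by_cases hs : s ∈ I
      · have h1 : μ ((fun h => c s • h + b s) ⁻¹' N') = 0 := by
          have : (fun h => c s • h + b s) ⁻¹' N' = (fun h => c s • h) ⁻¹' ((fun h => h + b s) ⁻¹' N') := rfl
          rw [this, Measure.addHaar_preimage_smul μ (hcI s hs), measure_preimage_add_right, hN0]
          simp
        rw [ae_iff]
        refine measure_mono_null ?_ h1
        intro h hh
        simp only [Set.mem_ofPred_eq, Classical.not_imp, not_not] at hh
        exact hh.2
      · exact Filter.Eventually.of_forall fun h hs' => absurd hs' hs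
    · have h1 : MeasurableSet {x : E × ℝ | x.2 ∈ I} := measurable_snd hI
      have h2 : MeasurableSet {x : E × ℝ | c x.2 • x.1 + b x.2 ∈ N'} := by
        have : Measurable fun x : E × ℝ => c x.2 • x.1 + b x.2 := by
          apply Continuous.measurable; fun_prop
        exact this hN'
      have : {x : E × ℝ | x.2 ∈ I → c x.2 • x.1 + b x.2 ∉ N'} = 
        {x : E × ℝ | x.2 ∈ I}ᶜ ∪ {x : E × ℝ | c x.2 • x.1 + b x.2 ∈ N'}ᶜ := by
        ext x; simp [imp_iff_not_or]
      rw [this]; exact h1.compl.union h2.compl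
  filter_upwards [key] with h hh
  filter_upwards [hh] with s hs hsI hn
  exact hs hsI (subset_toMeasurable _ _ hn)

theorem ac_comp {E : Type*} [NormedAddCommGroup E] [NormedSpace ℝ E]
    {O : Set E} {f : E → ℝ} (hf : LocallyLipschitzOn O f) (a d : E) {x y : ℝ}
    (hO : ∀ s ∈ Set.uIcc x y, a + s • d ∈ O) :
    AbsolutelyContinuousOnInterval (fun s : ℝ => f (a + s • d)) x y := by
  have hcomp : IsCompact ((fun s : ℝ => a + s • d) '' Set.uIcc x y) :=
    isCompact_uIcc.image (by fun_prop)
  have h1 : LocallyLipschitzOn ((fun s : ℝ => a + s • d) '' Set.uIcc x y) f := by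
    refine hf.mono ?_
    rintro _ ⟨s, hs, rfl⟩; exact hO s hs
  obtain ⟨K, hK⟩ := h1.exists_lipschitzOnWith_of_compact hcomp
  have h2 : LipschitzWith ‖d‖₊ (fun s : ℝ => a + s • d) := by
    refine LipschitzWith.of_dist_le_mul fun s t => ?_
    rw [dist_add_left, dist_eq_norm, ← sub_smul, norm_smul, mul_comm, dist_eq_norm]; rfl
  have h3 := hK.comp (h2.lipschitzOnWith (s := Set.uIcc x y)) (Set.mapsTo_image _ _)
  exact h3.absolutelyContinuousOnInterval

open MeasureTheory in
theorem lip_of_ae_grad {E : Type*} [NormedAddCommGroup E] [NormedSpace ℝ E]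
    [FiniteDimensional ℝ E] [MeasurableSpace E] [BorelSpace E] (μ : Measure E)
    [μ.IsAddHaarMeasure] {O : Set E} (hO : IsOpen O) (hcv : Convex ℝ O) {f : E → ℝ}
    (hf : LocallyLipschitzOn O f) {M : ℝ}
    (hM : ∀ᵐ z ∂μ, z ∈ O → DifferentiableAt ℝ f z ∧ ‖fderiv ℝ f z‖ ≤ M) {x y : E}
    (hx : x ∈ O) (hy : y ∈ O) : f y - f x ≤ M * ‖y - x‖ := by
  have hN := ae_iff.1 hM
  have h1 := ae_curve μ hN (c := fun _ => 1) (b := fun s => x + s • (y - x)) continuous_const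
    (by fun_prop) (I := Set.univ) MeasurableSet.univ (by simp)
  have hdense := Measure.dense_of_ae h1
  have hcts := hf.continuousOn
  have hev : ∀ᶠ h in 𝓝 (0:E), x + h ∈ O ∧ y + h ∈ O := by
    refine Filter.Eventually.and ?_ ?_
    · exact (by fun_prop : Continuous fun h : E => x + h).continuousAt.eventually_mem (by simpa using hO.mem_nhds hx)
    · exact (by fun_prop : Continuous fun h : E => y + h).continuousAt.eventually_mem (by simpa using hO.mem_nhds hy)
  by_contra hcon
  push Not at hcon
  have hct : ContinuousAt (fun h : E => f (y + h) - f (x + h)) 0 := by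
    have h1 : ContinuousAt f (y + 0) := by simpa using hcts.continuousAt (hO.mem_nhds hy)
    have h2 : ContinuousAt f (x + 0) := by simpa using hcts.continuousAt (hO.mem_nhds hx)
    exact (h1.comp (f := fun h : E => y + h) (by fun_prop)).sub (h2.comp (f := fun h : E => x + h) (by fun_prop))
  have hlt : ∀ᶠ h in 𝓝 (0:E), M * ‖y - x‖ < f (y + h) - f (x + h) :=
    hct.eventually (lt_mem_nhds (by simpa using hcon))
  obtain ⟨h, hh, hh1, hh2⟩ : ∃ h, (∀ᵐ s : ℝ, s ∈ Set.univ → (1:ℝ) • h + (x + s • (y - x)) ∉ {a | ¬(a ∈ O → DifferentiableAt ℝ f a ∧ ‖fderiv ℝ f a‖ ≤ M)}) ∧ (x + h ∈ O ∧ y + h ∈ O) ∧ M * ‖y - x‖ < f (y + h) - f (x + h) := by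
    obtain ⟨h, h1, h2⟩ := (mem_closure_iff_nhds.1 (hdense 0)) _ (hev.and hlt)
    exact ⟨h, h2, h1.1, h1.2⟩
  have hseg : ∀ s ∈ Set.Icc (0:ℝ) 1, (x + h) + s • (y - x) ∈ O := by
    intro s hs
    have := hcv hh1.1 hh1.2 (sub_nonneg.2 hs.2) hs.1 (by ring)
    convert this using 1
    module
  have hac : AbsolutelyContinuousOnInterval (fun s : ℝ => f ((x + h) + s • (y - x))) 0 1 :=
    ac_comp hf _ _ (by rw [Set.uIcc_of_le zero_le_one]; exact hseg)
  have hac2 : AbsolutelyContinuousOnInterval (fun s : ℝ => (M * ‖y - x‖) * s - f ((x + h) + s • (y - x))) 0 1 := by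
    refine AbsolutelyContinuousOnInterval.fun_sub ?_ hac
    exact (ContDiff.contDiffOn (by fun_prop)).absolutelyContinuousOnInterval
  have := ac_mono zero_le_one hac2 (by
    filter_upwards [hh] with s hs hs'
    have hs := hs (Set.mem_univ _)
    simp only [not_not] at hs
    have e : (1:ℝ) • h + (x + s • (y - x)) = (x + h) + s • (y - x) := by module
    rw [e] at hs
    obtain ⟨hd1, hd2⟩ := hs (hseg s ⟨hs'.1.le, hs'.2.le⟩)
    refine ⟨M * ‖y - x‖ - fderiv ℝ f ((x + h) + s • (y - x)) (y - x), ?_, ?_⟩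
    · have := (fderiv ℝ f ((x + h) + s • (y - x))).le_opNorm (y - x)
      have h3 : ‖fderiv ℝ f ((x + h) + s • (y - x))‖ * ‖y - x‖ ≤ M * ‖y - x‖ := by gcongr
      have h4 := le_trans (le_abs_self _) (le_trans this h3)
      linarith
    · have e1 : HasDerivAt (fun s : ℝ => (x + h) + s • (y - x)) (y - x) s := by
        simpa using ((hasDerivAt_id s).smul_const (y - x)).const_add (x + h)
      have e2 := hd1.hasFDerivAt.comp_hasDerivAt s e1
      have e3 : HasDerivAt (fun s : ℝ => (M * ‖y - x‖) * s) (M * ‖y - x‖) s := by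
        simpa using (hasDerivAt_id s).const_mul (M * ‖y - x‖)
      exact e3.sub e2)
  simp only [mul_zero, zero_smul, add_zero, mul_one, one_smul] at this
  have e : x + h + (y - x) = y + h := by abel
  rw [e] at this
  linarith

/-- quadratic form of a matrix -/
def qf {n : ℕ} (M : HMat n) (x : HIdx n → ℝ) : ℝ := ∑ i, ∑ j, M i j * (x i * x j)

/-- squared Euclidean norm -/
def nsq {n : ℕ} (x : HIdx n → ℝ) : ℝ := ∑ i, x i ^ 2

section qfl
variable {n : ℕ}

theorem qf_add (A B : HMat n) (x) : qf (A + B) x = qf A x + qf B x := by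
  simp [qf, add_mul, Finset.sum_add_distrib]

theorem qf_sub (A B : HMat n) (x) : qf (A - B) x = qf A x - qf B x := by
  simp [qf, sub_mul, Finset.sum_sub_distrib]

theorem qf_smul (c : ℝ) (B : HMat n) (x) : qf (c • B) x = c * qf B x := by
  simp only [qf, Finset.mul_sum, Matrix.smul_apply, smul_eq_mul, mul_assoc]

theorem qf_one (x : HIdx n → ℝ) : qf (1 : HMat n) x = nsq x := by
  simp [qf, nsq, Matrix.one_apply, sq]

theorem qf_vec (p x : HIdx n → ℝ) : qf (vecMulVec p p) x = (∑ i, p i * x i) ^ 2 := by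
  rw [sq, Finset.sum_mul_sum]
  simp only [qf, vecMulVec_apply]
  exact Finset.sum_congr rfl fun i _ => Finset.sum_congr rfl fun j _ => by ring

theorem qf_dot (M : HMat n) (x) : qf M x = x ⬝ᵥ (M *ᵥ x) := by
  simp only [qf, dotProduct, mulVec, Finset.mul_sum]
  exact Finset.sum_congr rfl fun i _ => Finset.sum_congr rfl fun j _ => by ring

theorem qf_nonneg {M : HMat n} (h : M.PosSemidef) (x) : 0 ≤ qf M x := by
  rw [qf_dot]; simpa using h.dotProduct_mulVec_nonneg x

theorem qf_mono {A B : HMat n} (h : matLE A B) (x) : qf A x ≤ qf B x := by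
  have := qf_nonneg h x; rw [qf_sub] at this; linarith

theorem posDef_of_qf {M : HMat n} (hs : M.IsSymm) (h : ∀ x, x ≠ 0 → 0 < qf M x) : M.PosDef := by
  refine Matrix.PosDef.of_dotProduct_mulVec_pos ?_ fun x hx => ?_
  · rw [Matrix.IsHermitian, conjTranspose_eq_transpose_of_trivial]; exact hs
  · have := h x hx; rw [qf_dot] at this; simpa using this

theorem nsq_nonneg (x : HIdx n → ℝ) : 0 ≤ nsq x := Finset.sum_nonneg fun _ _ => sq_nonneg _

theorem nsq_pos {x : HIdx n → ℝ} (h : x ≠ 0) : 0 < nsq x := by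
  obtain ⟨i, hi⟩ := Function.ne_iff.1 h
  exact Finset.sum_pos' (fun _ _ => sq_nonneg _) ⟨i, Finset.mem_univ _, by have : x i ≠ 0 := hi; positivity⟩

theorem pnorm_sq (x : HIdx n → ℝ) : pnorm x ^ 2 = nsq x := Real.sq_sqrt (nsq_nonneg x)

theorem pnorm_nonneg (x : HIdx n → ℝ) : 0 ≤ pnorm x := Real.sqrt_nonneg _

theorem pnorm_eq (x : HIdx n → ℝ) : pnorm x = ‖(WithLp.toLp 2 x : EuclideanSpace ℝ (HIdx n))‖ := by
  rw [EuclideanSpace.norm_eq]; simp [pnorm]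

theorem pnorm_add (x y : HIdx n → ℝ) : pnorm (x + y) ≤ pnorm x + pnorm y := by
  simp only [pnorm_eq, WithLp.toLp_add]; exact norm_add_le _ _

theorem pnorm_smul (c : ℝ) (x : HIdx n → ℝ) : pnorm (c • x) = |c| * pnorm x := by
  simp only [pnorm_eq, WithLp.toLp_smul, norm_smul, Real.norm_eq_abs]

theorem pnorm_cont : Continuous (pnorm : (HIdx n → ℝ) → ℝ) := by
  unfold pnorm; fun_prop

theorem dot_sq_le (p x : HIdx n → ℝ) : (∑ i, p i * x i) ^ 2 ≤ nsq p * nsq x :=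
  Finset.sum_mul_sq_le_sq_mul_sq _ _ _

theorem triple_cs (x r : HIdx n → ℝ) (D : HIdx n → HIdx n → HIdx n → ℝ) :
    |∑ i, ∑ j, (∑ k, r k * D i j k) * (x i * x j)| ≤
      pnorm r * Real.sqrt (∑ i, ∑ j, ∑ k, D i j k ^ 2) * nsq x := by
  have h1 := Finset.sum_mul_sq_le_sq_mul_sq (Finset.univ : Finset (HIdx n × HIdx n × HIdx n))
    (fun a => x a.1 * x a.2.1 * r a.2.2) (fun a => D a.1 a.2.1 a.2.2)
  simp only [Fintype.sum_prod_type] at h1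
  have e1 : ∑ i, ∑ j, (∑ k, r k * D i j k) * (x i * x j) = ∑ i, ∑ j, ∑ k, x i * x j * r k * D i j k := by
    refine Finset.sum_congr rfl fun i _ => Finset.sum_congr rfl fun j _ => ?_
    rw [Finset.sum_mul]; exact Finset.sum_congr rfl fun k _ => by ring
  have e2 : ∑ i, ∑ j, ∑ k, (x i * x j * r k) ^ 2 = nsq x * nsq x * nsq r := by
    simp only [nsq, mul_pow]
    rw [Finset.sum_mul_sum, Finset.sum_mul]
    refine Finset.sum_congr rfl fun i _ => ?_
    rw [Finset.sum_mul]
    refine Finset.sum_congr rfl fun j _ => ?_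
    rw [Finset.mul_sum]
  rw [e2] at h1
  rw [e1]
  refine abs_le_of_sq_le_sq ?_ (mul_nonneg (mul_nonneg (pnorm_nonneg _) (Real.sqrt_nonneg _)) (nsq_nonneg x))
  refine h1.trans (le_of_eq ?_)
  rw [mul_pow, mul_pow, pnorm_sq, Real.sq_sqrt (Finset.sum_nonneg fun _ _ => Finset.sum_nonneg fun _ _ => Finset.sum_nonneg fun _ _ => sq_nonneg _)]
  ring

theorem ac_sum {ι : Type*} (s : Finset ι) (f : ι → ℝ → ℝ) {a b : ℝ}
    (h : ∀ i ∈ s, AbsolutelyContinuousOnInterval (f i) a b) :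
    AbsolutelyContinuousOnInterval (fun t => ∑ i ∈ s, f i t) a b := by
  classical
  induction s using Finset.induction_on with
  | empty =>
    simp only [Finset.sum_empty]
    exact (ContDiff.contDiffOn (by fun_prop)).absolutelyContinuousOnInterval
  | insert i s hi ih =>
    simp only [Finset.sum_insert hi]
    exact (h i (by simp)).fun_add (ih fun j hj => h j (by simp [hj]))

theorem fderiv_coord (f : (HIdx n → ℝ) → ℝ) (p r : HIdx n → ℝ) :
    fderiv ℝ f p r = ∑ k, r k * fderiv ℝ f p (Pi.single k 1) := by
  conv_lhs => rw [pi_eq_sum_univ' r]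
  rw [map_sum]
  refine Finset.sum_congr rfl fun k _ => ?_
  rw [map_smul, smul_eq_mul]

/-- lower bound constant -/
def cP (n : ℕ) (C θ Λ κ m : ℝ) (p r x : HIdx n → ℝ) : ℝ :=
  -(8 * C * (∑ i, p i * x i) ^ 2) - 2 * C * (κ * θ * Λ) ^ 2 * nsq x
    + (1 / C) * (max 0 (pnorm ((1 + κ) • p + (κ * θ) • r) - κ * (pnorm p + θ * Λ))) ^ m * nsq x
    - θ * nsq x

theorem lemmaP_gen (L : Heis n → ℝ → (HIdx n → ℝ) → HMat n) (ξ : Heis n) (s : ℝ)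
    (hlip : ∀ i j, LocallyLipschitzOn Set.univ (fun q => L ξ s q i j))
    {m C θ Λ κ : ℝ} (hm : 1 < m) (hC : 0 < C) (hθ : 0 < θ) (hκ0 : 0 < κ) (hκ : κ ≤ 1 / 4)
    (hΛ : 0 < Λ)
    (h37 : ∀ p, DiffInP L ξ s p →
      matLE ((-C) • vecMulVec p p + ((1 / C) * pnorm p ^ m) • (1 : HMat n))
            (pDotGradL L ξ s p - L ξ s p - (θ * Λ * pGradNorm L ξ s p) • (1 : HMat n)
              + θ • (1 : HMat n)))
    (p r x : HIdx n → ℝ) (hr : pnorm r ≤ Λ)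
    (hp : ∀ᵐ t : ℝ, t ∈ Set.Ioo 0 κ → DiffInP L ξ s (p + t • (p + θ • r))) :
    κ * cP n C θ Λ κ m p r x ≤
      qf (L ξ s ((1 + κ) • p + (κ * θ) • r)) x - (1 + κ) * qf (L ξ s p) x := by
  set c0 := cP n C θ Λ κ m p r x with hc0
  set d := p + θ • r with hd
  have hac1 : AbsolutelyContinuousOnInterval (fun t : ℝ => qf (L ξ s (p + t • d)) x) 0 κ := by
    unfold qf
    refine ac_sum _ _ fun i _ => ac_sum _ _ fun j _ => ?_
    have := ac_comp (hlip i j) p d (x := 0) (y := κ) (by simp)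
    exact this.fun_mul (ContDiff.contDiffOn (by fun_prop)).absolutelyContinuousOnInterval
  have hac2 : AbsolutelyContinuousOnInterval (fun t : ℝ => (1 + t)⁻¹) 0 κ := by
    refine ContDiffOn.absolutelyContinuousOnInterval ?_
    refine ContDiffOn.inv (by fun_prop) fun t ht => ?_
    rw [Set.uIcc_of_le hκ0.le] at ht
    have := ht.1; positivity
  have hac : AbsolutelyContinuousOnInterval
      (fun t : ℝ => (qf (L ξ s (p + t • d)) x + c0) * (1 + t)⁻¹) 0 κ :=
    (hac1.fun_add (ContDiff.contDiffOn (by fun_prop)).absolutelyContinuousOnInterval).fun_mul hac2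
  have hmono := ac_mono hκ0.le hac (by
    filter_upwards [hp] with t ht ht'
    have hdiff := ht ht'
    set P := p + t • d with hP
    have ht0 := ht'.1
    have ht1 := ht'.2
    have h1t : (0:ℝ) < 1 + t := by linarith
    have hline : HasDerivAt (fun t : ℝ => p + t • d) d t := by
      simpa using ((hasDerivAt_id t).smul_const d).const_add p
    set D := ∑ i, ∑ j, fderiv ℝ (fun q => L ξ s q i j) P d * (x i * x j) with hD
    have hder : HasDerivAt (fun t : ℝ => qf (L ξ s (p + t • d)) x) D t := by
      unfold qf
      refine HasDerivAt.fun_sum fun i _ => HasDerivAt.fun_sum fun j _ => ?_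
      exact ((hdiff i j).hasFDerivAt.comp_hasDerivAt t hline).mul_const _
    have hinv : HasDerivAt (fun t : ℝ => (1 + t)⁻¹) (-1 / (1 + t) ^ 2) t := by
      exact ((hasDerivAt_id t).const_add 1).inv h1t.ne'
    refine ⟨_, ?_, (hder.add_const c0).mul hinv⟩
    have key : qf (L ξ s P) x + c0 ≤ (1 + t) * D := by
      have h1 := qf_mono (h37 P hdiff) x
      simp only [qf_add, qf_sub, qf_smul, qf_one, qf_vec] at h1
      have h2 : (1 + t) * D = qf (pDotGradL L ξ s P) x +
          θ * ∑ i, ∑ j, (∑ k, r k * fderiv ℝ (fun q => L ξ s q i j) P (Pi.single k 1)) * (x i * x j) := by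
        simp only [hD, qf, pDotGradL, Matrix.of_apply, Finset.mul_sum, ← Finset.sum_add_distrib]
        refine Finset.sum_congr rfl fun i _ => Finset.sum_congr rfl fun j _ => ?_
        have e : (1 + t) • d = P + θ • r := by rw [hP, hd]; module
        have e2 : (1 + t) * fderiv ℝ (fun q => L ξ s q i j) P d = fderiv ℝ (fun q => L ξ s q i j) P P
          + θ * fderiv ℝ (fun q => L ξ s q i j) P r := by
          rw [← smul_eq_mul, ← map_smul, e, map_add, map_smul, smul_eq_mul]
        rw [fderiv_coord _ P r] at e2
        rw [← mul_assoc, e2]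
        ring
      have h3 := triple_cs x r fun i j k => fderiv ℝ (fun q => L ξ s q i j) P (Pi.single k 1)
      have h4 : pnorm r * pGradNorm L ξ s P * nsq x ≤ Λ * pGradNorm L ξ s P * nsq x := by
        have : 0 ≤ pGradNorm L ξ s P := Real.sqrt_nonneg _
        have := nsq_nonneg x
        gcongr
      have h5 := neg_le_of_abs_le (h3.trans h4)
      have h6 := mul_le_mul_of_nonneg_left h5 hθ.le
      have h7 : (∑ i, P i * x i) ^ 2 ≤ 8 * (∑ i, p i * x i) ^ 2 + 2 * (κ * θ * Λ) ^ 2 * nsq x := by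
        have e : ∑ i, P i * x i = (1 + t) * (∑ i, p i * x i) + t * θ * ∑ i, r i * x i := by
          simp only [hP, hd, Finset.mul_sum, ← Finset.sum_add_distrib]
          refine Finset.sum_congr rfl fun i _ => ?_
          simp; ring
        have h8 := dot_sq_le r x
        have h9 : nsq r ≤ Λ ^ 2 := by rw [← pnorm_sq]; have := pnorm_nonneg r; gcongr
        have h10 : (t * θ * ∑ i, r i * x i) ^ 2 ≤ (κ * θ * Λ) ^ 2 * nsq x := by
          have a1 : (∑ i, r i * x i) ^ 2 ≤ Λ ^ 2 * nsq x := h8.trans (by have := nsq_nonneg x; gcongr)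
          calc (t * θ * ∑ i, r i * x i) ^ 2 = (t * θ) ^ 2 * (∑ i, r i * x i) ^ 2 := by ring
            _ ≤ (κ * θ) ^ 2 * (Λ ^ 2 * nsq x) := by gcongr
            _ = _ := by ring
        have h11 : ((1 + t) * (∑ i, p i * x i)) ^ 2 ≤ 4 * (∑ i, p i * x i) ^ 2 := by
          rw [mul_pow]
          have : (1 + t) ^ 2 ≤ 4 := by nlinarith
          gcongr
        rw [e]
        nlinarith [sq_nonneg ((1 + t) * (∑ i, p i * x i) - t * θ * ∑ i, r i * x i)]
      have h12 : (max 0 (pnorm ((1 + κ) • p + (κ * θ) • r) - κ * (pnorm p + θ * Λ))) ^ m ≤ pnorm P ^ m := by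
        refine Real.rpow_le_rpow (le_max_left _ _) (max_le (pnorm_nonneg _) ?_) (by linarith)
        have e : (1 + κ) • p + (κ * θ) • r = P + (κ - t) • d := by rw [hP, hd]; module
        have a1 := pnorm_add P ((κ - t) • d)
        have a2 := pnorm_add p (θ • r)
        rw [pnorm_smul, abs_of_pos (by linarith)] at a1
        rw [pnorm_smul, abs_of_pos hθ] at a2
        have a3 : pnorm d ≤ pnorm p + θ * Λ := a2.trans (by gcongr)
        have a4 : (κ - t) * pnorm d ≤ κ * (pnorm p + θ * Λ) := by
          have := pnorm_nonneg d
          exact mul_le_mul (by linarith) a3 this hκ0.le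
        rw [e]; linarith
      have h13 : (1 / C) * (max 0 (pnorm ((1 + κ) • p + (κ * θ) • r) - κ * (pnorm p + θ * Λ))) ^ m * nsq x
        ≤ 1 / C * pnorm P ^ m * nsq x := by
        have := nsq_nonneg x; gcongr
      have h14 := mul_le_mul_of_nonneg_left h7 hC.le
      rw [hc0, cP, h2]
      unfold pGradNorm at h1 h6
      linarith
    have : D * (1 + t)⁻¹ + (qf (L ξ s P) x + c0) * (-1 / (1 + t) ^ 2) =
      ((1 + t) * D - (qf (L ξ s P) x + c0)) / (1 + t) ^ 2 := by field_simp; ring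
    rw [this]
    exact div_nonneg (by linarith) (by positivity))
  simp only [zero_smul, add_zero, inv_one, mul_one] at hmono
  have e : p + κ • d = (1 + κ) • p + (κ * θ) • r := by rw [hd]; module
  rw [e, ← div_eq_mul_inv, le_div_iff₀ (by linarith)] at hmono
  linarith

theorem lemmaP (L : Heis n → ℝ → (HIdx n → ℝ) → HMat n) (ξ : Heis n) (s : ℝ)
    (hlip : ∀ i j, LocallyLipschitzOn Set.univ (fun q => L ξ s q i j))
    {m C θ Λ κ : ℝ} (hm : 1 < m) (hC : 0 < C) (hθ : 0 < θ) (hκ0 : 0 < κ) (hκ : κ ≤ 1 / 4)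
    (hΛ : 0 < Λ)
    (h37 : ∀ p, DiffInP L ξ s p →
      matLE ((-C) • vecMulVec p p + ((1 / C) * pnorm p ^ m) • (1 : HMat n))
            (pDotGradL L ξ s p - L ξ s p - (θ * Λ * pGradNorm L ξ s p) • (1 : HMat n)
              + θ • (1 : HMat n)))
    (p r x : HIdx n → ℝ) (hr : pnorm r ≤ Λ) :
    κ * cP n C θ Λ κ m p r x ≤
      qf (L ξ s ((1 + κ) • p + (κ * θ) • r)) x - (1 + κ) * qf (L ξ s p) x := by
  have hN : MeasureTheory.volume {q | ¬ DiffInP L ξ s q} = 0 := by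
    have : ∀ᵐ q : HIdx n → ℝ, DiffInP L ξ s q := by
      unfold DiffInP
      rw [Filter.eventually_all]; intro i
      rw [Filter.eventually_all]; intro j
      filter_upwards [ae_diff_of_locLip MeasureTheory.volume isOpen_univ (hlip i j)] with q hq
      exact hq (Set.mem_univ _)
    exact MeasureTheory.ae_iff.1 this
  have h1 := ae_curve MeasureTheory.volume hN (c := fun t => 1 + t) (b := fun t => t • θ • r)
    (by fun_prop) (by fun_prop) (I := Set.Ioo 0 κ) measurableSet_Ioo
    (fun t ht => by have := ht.1; positivity)
  have hdense := MeasureTheory.Measure.dense_of_ae h1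
  have hLc : ∀ i j, Continuous fun q => L ξ s q i j := fun i j =>
    continuousOn_univ.1 (hlip i j).continuousOn
  have hqc : Continuous fun q => qf (L ξ s q) x := by
    unfold qf
    refine continuous_finsetSum _ fun i _ => continuous_finsetSum _ fun j _ => ?_
    exact (hLc i j).mul continuous_const
  have hclosed : IsClosed {p | κ * cP n C θ Λ κ m p r x ≤
      qf (L ξ s ((1 + κ) • p + (κ * θ) • r)) x - (1 + κ) * qf (L ξ s p) x} := by
    refine isClosed_le ?_ ?_
    · unfold cP
      have := pnorm_cont (n := n)
      have h2 : Continuous fun p : HIdx n → ℝ => (max 0 (pnorm ((1 + κ) • p + (κ * θ) • r) - κ * (pnorm p + θ * Λ))) ^ m := by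
        refine Continuous.rpow_const (by fun_prop) fun _ => Or.inr (by linarith)
      fun_prop
    · exact (hqc.comp (by fun_prop)).sub (hqc.const_mul _)
  have : closure {p : HIdx n → ℝ | ∀ᵐ t : ℝ, t ∈ Set.Ioo 0 κ → (1 + t) • p + t • θ • r ∉ {q | ¬ DiffInP L ξ s q}} ⊆ {p | κ * cP n C θ Λ κ m p r x ≤
      qf (L ξ s ((1 + κ) • p + (κ * θ) • r)) x - (1 + κ) * qf (L ξ s p) x} := by
    refine closure_minimal ?_ hclosed
    intro p hp
    refine lemmaP_gen L ξ s hlip hm hC hθ hκ0 hκ hΛ h37 p r x hr ?_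
    filter_upwards [hp] with t ht ht'
    have := ht ht'
    simp only [not_not] at this
    convert this using 1
    module
  exact this (hdense p)


theorem slice_p {Ω : Set (Heis n)} {L : Heis n → ℝ → (HIdx n → ℝ) → HMat n}
    (hLlip : ∀ i j : HIdx n, LocallyLipschitzOnSet
      (Ω ×ˢ (Set.univ : Set (ℝ × (HIdx n → ℝ))))
      (fun q : Heis n × ℝ × (HIdx n → ℝ) => L q.1 q.2.1 q.2.2 i j)) {ξ : Heis n} (hξ : ξ ∈ Ω)
    (s : ℝ) (i j) : LocallyLipschitzOn Set.univ (fun q => L ξ s q i j) := by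
  intro q _
  obtain ⟨K, t, ht, hK⟩ := hLlip i j (ξ, s, q) ⟨hξ, Set.mem_univ _⟩
  have hc : Continuous (fun q : HIdx n → ℝ => (ξ, s, q)) := by fun_prop
  refine ⟨K, (fun q : HIdx n → ℝ => (ξ, s, q)) ⁻¹' t, ?_, ?_⟩
  · have h1 : Tendsto (fun q : HIdx n → ℝ => (ξ, s, q)) (𝓝[Set.univ] q) (𝓝[Ω ×ˢ Set.univ] (ξ, s, q)) := by
      refine tendsto_nhdsWithin_iff.2 ⟨hc.continuousAt.tendsto.mono_left nhdsWithin_le_nhds, ?_⟩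
      exact Eventually.of_forall fun q => ⟨hξ, Set.mem_univ _⟩
    exact h1 ht
  · intro a ha b hb
    refine (hK ha hb).trans (le_of_eq ?_)
    simp [Prod.edist_eq]

theorem slice_xi {Ω : Set (Heis n)} {L : Heis n → ℝ → (HIdx n → ℝ) → HMat n}
    (hLlip : ∀ i j : HIdx n, LocallyLipschitzOnSet
      (Ω ×ˢ (Set.univ : Set (ℝ × (HIdx n → ℝ))))
      (fun q : Heis n × ℝ × (HIdx n → ℝ) => L q.1 q.2.1 q.2.2 i j)) 
    (s : ℝ) (q) (i j) : LocallyLipschitzOn Ω (fun ξ => L ξ s q i j) := by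
  intro ξ hξ
  obtain ⟨K, t, ht, hK⟩ := hLlip i j (ξ, s, q) ⟨hξ, Set.mem_univ _⟩
  have hc : Continuous (fun ξ : Heis n => (ξ, s, q)) := by fun_prop
  refine ⟨K, (fun ξ : Heis n => (ξ, s, q)) ⁻¹' t, ?_, ?_⟩
  · have h1 : Tendsto (fun ξ : Heis n => (ξ, s, q)) (𝓝[Ω] ξ) (𝓝[Ω ×ˢ Set.univ] (ξ, s, q)) := by
      refine tendsto_nhdsWithin_iff.2 ⟨hc.continuousAt.tendsto.mono_left nhdsWithin_le_nhds, ?_⟩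
      filter_upwards [self_mem_nhdsWithin] with ξ hξ
      exact ⟨hξ, Set.mem_univ _⟩
    exact h1 ht
  · intro a ha b hb
    refine (hK ha hb).trans (le_of_eq ?_)
    simp [Prod.edist_eq]

theorem xi_lip {Ω : Set (Heis n)} {L : Heis n → ℝ → (HIdx n → ℝ) → HMat n}
    (hLlip : ∀ i j : HIdx n, LocallyLipschitzOnSet
      (Ω ×ˢ (Set.univ : Set (ℝ × (HIdx n → ℝ))))
      (fun q : Heis n × ℝ × (HIdx n → ℝ) => L q.1 q.2.1 q.2.2 i j)) 
    (s : ℝ) (q : HIdx n → ℝ) {M : ℝ} (hM : ∀ ξ ∈ Ω, DiffInXi L ξ s q → xiGradNorm L ξ s q ≤ M)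
    {η₀ η₁ : Heis n} {d : ℝ} (hd : Metric.ball η₀ d ⊆ Ω) (h1 : dist η₁ η₀ < d) (i j : HIdx n) :
    |L η₁ s q i j - L η₀ s q i j| ≤ M * ‖η₁ - η₀‖ := by
  have hM' : ∀ᵐ z : Heis n ∂(MeasureTheory.Measure.addHaar), z ∈ Metric.ball η₀ d → DifferentiableAt ℝ (fun ξ => L ξ s q i j) z ∧
      ‖fderiv ℝ (fun ξ => L ξ s q i j) z‖ ≤ M := by
    have : ∀ᵐ z : Heis n ∂(MeasureTheory.Measure.addHaar), ∀ i j, z ∈ Metric.ball η₀ d → DifferentiableAt ℝ (fun ξ => L ξ s q i j) z := by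
      rw [Filter.eventually_all]; intro i
      rw [Filter.eventually_all]; intro j
      exact ae_diff_of_locLip MeasureTheory.Measure.addHaar Metric.isOpen_ball ((slice_xi hLlip s q i j).mono hd)
    filter_upwards [this] with z hz hzb
    refine ⟨hz i j hzb, le_trans ?_ (hM z (hd hzb) fun i j => hz i j hzb)⟩
    refine Real.le_sqrt_of_sq_le ?_
    refine le_trans ?_ (Finset.single_le_sum (f := fun i => ∑ j : HIdx n, ‖fderiv ℝ (fun η => L η s q i j) z‖ ^ 2) (fun _ _ => Finset.sum_nonneg fun _ _ => sq_nonneg _) (Finset.mem_univ i))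
    exact Finset.single_le_sum (f := fun j => ‖fderiv ℝ (fun η => L η s q i j) z‖ ^ 2) (fun _ _ => sq_nonneg _) (Finset.mem_univ j)
  have hd0 : 0 < d := lt_of_le_of_lt dist_nonneg h1
  have hll := (slice_xi hLlip s q i j).mono hd
  have a1 := lip_of_ae_grad MeasureTheory.Measure.addHaar Metric.isOpen_ball (convex_ball η₀ d) hll hM'
    (x := η₀) (y := η₁) (by simpa using hd0) h1
  have a2 := lip_of_ae_grad MeasureTheory.Measure.addHaar Metric.isOpen_ball (convex_ball η₀ d) hll hM'
    (x := η₁) (y := η₀) h1 (by simpa using hd0)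
  rw [norm_sub_rev] at a2
  rw [abs_le]; constructor <;> linarith

theorem qf_abs_le {A : HMat n} {M : ℝ} (hM : ∀ i j, |A i j| ≤ M) (hM0 : 0 ≤ M) (x) :
    |qf A x| ≤ M * (Fintype.card (HIdx n)) * nsq x := by
  have h1 : |qf A x| ≤ ∑ i, ∑ j, M * (|x i| * |x j|) := by
    refine (Finset.abs_sum_le_sum_abs _ _).trans (Finset.sum_le_sum fun i _ => ?_)
    refine (Finset.abs_sum_le_sum_abs _ _).trans (Finset.sum_le_sum fun j _ => ?_)
    rw [abs_mul, abs_mul]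
    exact mul_le_mul_of_nonneg_right (hM i j) (by positivity)
  have h2 : ∑ i, ∑ j, M * (|x i| * |x j|) = M * (∑ i, |x i|) ^ 2 := by
    rw [sq, Finset.sum_mul_sum]; simp only [Finset.mul_sum]
  have h3 := sq_sum_le_card_mul_sum_sq (s := Finset.univ) (f := fun i => |x i|)
  simp only [sq_abs] at h3
  rw [h2] at h1
  refine h1.trans ?_
  rw [mul_assoc]
  exact mul_le_mul_of_nonneg_left h3 hM0

end qfl

section calc5
variable {n : ℕ}

/-- coordinate functionals -/
def cX (i : Fin n) : Heis n →L[ℝ] ℝ := (ContinuousLinearMap.proj i).comp (ContinuousLinearMap.fst ℝ _ _)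
/-- coordinate functionals -/
def cY (i : Fin n) : Heis n →L[ℝ] ℝ :=
  (ContinuousLinearMap.proj i).comp ((ContinuousLinearMap.fst ℝ _ _).comp (ContinuousLinearMap.snd ℝ _ _))
/-- coordinate functionals -/
def cT : Heis n →L[ℝ] ℝ := (ContinuousLinearMap.snd ℝ _ _).comp (ContinuousLinearMap.snd ℝ _ _)

@[simp] theorem cX_apply (i : Fin n) (h : Heis n) : cX i h = h.1 i := rfl
@[simp] theorem cY_apply (i : Fin n) (h : Heis n) : cY i h = h.2.1 i := rfl
@[simp] theorem cT_apply (h : Heis n) : cT h = h.2.2 := rfl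

/-- bilinear form of `zsq` -/
def Zb (n : ℕ) : Heis n →L[ℝ] Heis n →L[ℝ] ℝ :=
  ∑ i, ((cX i).smulRight (cX i) + (cY i).smulRight (cY i))

/-- full Euclidean bilinear form -/
def Qb (n : ℕ) : Heis n →L[ℝ] Heis n →L[ℝ] ℝ := Zb n + cT.smulRight cT

theorem Zb_apply (h k : Heis n) : Zb n h k = ∑ i, (h.1 i * k.1 i + h.2.1 i * k.2.1 i) := by
  simp [Zb]

theorem Qb_apply (h k : Heis n) : Qb n h k = ∑ i, (h.1 i * k.1 i + h.2.1 i * k.2.1 i) + h.2.2 * k.2.2 := by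
  simp [Qb, Zb_apply]

theorem Zb_self (h : Heis n) : Zb n h h = zsq h := by
  simp [Zb_apply, zsq, sq]

theorem Zb_symm (h k : Heis n) : Zb n h k = Zb n k h := by
  simp [Zb_apply, mul_comm]

theorem Qb_symm (h k : Heis n) : Qb n h k = Qb n k h := by
  simp [Qb_apply, mul_comm]

theorem Qb_ge (h : Heis n) : ‖h‖ ^ 2 ≤ Qb n h h := by
  have h0 : 0 ≤ Qb n h h := by
    rw [Qb_apply]
    have := Finset.sum_nonneg (s := Finset.univ) (f := fun i => h.1 i * h.1 i + h.2.1 i * h.2.1 i) fun i _ => add_nonneg (mul_self_nonneg _) (mul_self_nonneg _)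
    exact add_nonneg this (mul_self_nonneg _)
  have hle : ∀ i, h.1 i * h.1 i + h.2.1 i * h.2.1 i ≤ ∑ i, (h.1 i * h.1 i + h.2.1 i * h.2.1 i) := fun i =>
    Finset.single_le_sum (f := fun i => h.1 i * h.1 i + h.2.1 i * h.2.1 i) (fun i _ => add_nonneg (mul_self_nonneg _) (mul_self_nonneg _)) (Finset.mem_univ i)
  have hs0 := Finset.sum_nonneg (s := Finset.univ) (f := fun i => h.1 i * h.1 i + h.2.1 i * h.2.1 i) fun i _ => add_nonneg (mul_self_nonneg _) (mul_self_nonneg _)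
  have : ‖h‖ ≤ Real.sqrt (Qb n h h) := by
    rw [Prod.norm_def, Prod.norm_def]
    refine max_le ((pi_norm_le_iff_of_nonneg (Real.sqrt_nonneg _)).2 fun i => ?_) (max_le ((pi_norm_le_iff_of_nonneg (Real.sqrt_nonneg _)).2 fun i => ?_) ?_)
    all_goals
      refine Real.abs_le_sqrt ?_
      rw [Qb_apply]
    · nlinarith [hle i, mul_self_nonneg (h.2.1 i), mul_self_nonneg h.2.2]
    · nlinarith [hle i, mul_self_nonneg (h.1 i), mul_self_nonneg h.2.2]
    · nlinarith
  calc ‖h‖ ^ 2 ≤ Real.sqrt (Qb n h h) ^ 2 := by gcongr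
    _ = _ := Real.sq_sqrt h0

theorem Qb_nonneg (h : Heis n) : 0 ≤ Qb n h h := (sq_nonneg _).trans (Qb_ge h)

/-- linear part of left translation -/
def Ml (ζ : Heis n) : Heis n →L[ℝ] Heis n :=
  ContinuousLinearMap.prod (ContinuousLinearMap.fst ℝ _ _)
    (ContinuousLinearMap.prod ((ContinuousLinearMap.fst ℝ _ _).comp (ContinuousLinearMap.snd ℝ _ _))
      (cT + ∑ i, ((2 * ζ.2.1 i) • cX i - (2 * ζ.1 i) • cY i)))

theorem Ml_apply (ζ h : Heis n) : Ml ζ h =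
    (h.1, h.2.1, h.2.2 + 2 * ∑ i, (ζ.2.1 i * h.1 i - ζ.1 i * h.2.1 i)) := by
  simp [Ml, Finset.mul_sum, mul_sub, mul_assoc]

theorem hmul_add (ζ η h : Heis n) : hmul ζ (η + h) = hmul ζ η + Ml ζ h := by
  rw [Ml_apply]
  refine Prod.ext ?_ (Prod.ext ?_ ?_)
  · simp [hmul, add_assoc]
  · simp [hmul, add_assoc]
  · simp only [hmul, Prod.snd_add, Prod.fst_add, Pi.add_apply, Finset.mul_sum]
    rw [add_add_add_comm, ← add_assoc ζ.2.2, ← Finset.sum_add_distrib]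
    congr 1
    exact Finset.sum_congr rfl fun i _ => by ring

theorem hmul_eq_add (ζ ξ : Heis n) : hmul ζ ξ = ξ + Ml (hinv ξ) ζ := by
  rw [Ml_apply]
  refine Prod.ext ?_ (Prod.ext ?_ ?_)
  · simp [hmul, add_comm]
  · simp [hmul, add_comm]
  · simp only [hmul, hinv, Prod.snd_add, Pi.neg_apply]
    rw [add_comm ζ.2.2, add_assoc]
    congr 3
    exact Finset.sum_congr rfl fun i _ => by ring

theorem hinv_add (ξ h : Heis n) : hinv (ξ + h) = hinv ξ + (-h) := by
  refine Prod.ext ?_ (Prod.ext ?_ ?_) <;> simp [hinv, add_comm]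

theorem hmul_hinv_add (η ξ h : Heis n) : hmul η (hinv (ξ + h)) = hmul η (hinv ξ) - Ml η h := by
  rw [hinv_add, hmul_add, map_neg, sub_eq_add_neg]

theorem hmul_cancel (η ξ : Heis n) : hmul (hmul η (hinv ξ)) ξ = η := by
  refine Prod.ext ?_ (Prod.ext ?_ ?_)
  · simp [hmul, hinv]
  · simp [hmul, hinv]
  · simp only [hmul, hinv, Pi.add_apply, Pi.neg_apply, Finset.mul_sum]
    have : ∑ i, 2 * (η.2.1 i * -ξ.1 i - η.1 i * -ξ.2.1 i) +
        ∑ i, 2 * ((η.2.1 i + -ξ.2.1 i) * ξ.1 i - (η.1 i + -ξ.1 i) * ξ.2.1 i) = 0 := by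
      rw [← Finset.sum_add_distrib, Finset.sum_eq_zero fun i _ => by ring]
    linarith

theorem hmul_cancel2 (ζ η : Heis n) : hmul η (hinv (hmul (hinv ζ) η)) = ζ := by
  refine Prod.ext ?_ (Prod.ext ?_ ?_)
  · simp [hmul, hinv]
  · simp [hmul, hinv]
  · simp only [hmul, hinv, Pi.add_apply, Pi.neg_apply, Finset.mul_sum, neg_add, ← Finset.sum_neg_distrib]
    rw [add_assoc, add_assoc, ← Finset.sum_add_distrib, Finset.sum_eq_zero fun i _ => by ring]
    ring

theorem hmul_cancel3 (ζ ξ : Heis n) : hmul (hinv ζ) (hmul ζ ξ) = ξ := by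
  refine Prod.ext ?_ (Prod.ext ?_ ?_)
  · simp [hmul, hinv]
  · simp [hmul, hinv]
  · simp only [hmul, hinv, Pi.add_apply, Pi.neg_apply, Finset.mul_sum]
    rw [add_assoc, add_assoc, ← sub_eq_zero]
    have : ∀ a b c d : ℝ, c + d = 0 → -a + (a + b + c + d) - b = 0 := by intros; linarith
    rw [← add_assoc]
    have e := this ζ.2.2 ξ.2.2 (∑ i, 2 * (ζ.2.1 i * ξ.1 i - ζ.1 i * ξ.2.1 i)) (∑ i, 2 * (-ζ.2.1 i * (ζ.1 i + ξ.1 i) - -ζ.1 i * (ζ.2.1 i + ξ.2.1 i))) (by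
      rw [← Finset.sum_add_distrib, Finset.sum_eq_zero fun i _ => by ring])
    linarith

theorem Ml_vecField (ζ η : Heis n) (j : HIdx n) : Ml ζ (vecField j η) = vecField j (hmul ζ η) := by
  rw [Ml_apply]
  rcases j with j | j
  · simp [vecField, hmul, Pi.single_apply]; ring
  · simp [vecField, hmul, Pi.single_apply]; ring

/-- derivative of the vector fields -/
def Nl (j : HIdx n) : Heis n →L[ℝ] Heis n :=
  match j with
  | Sum.inl j => ((2:ℝ) • cY j).smulRight (0, 0, 1)
  | Sum.inr j => (-(2:ℝ) • cX j).smulRight (0, 0, 1)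

theorem vecField_add (j : HIdx n) (η h : Heis n) : vecField j (η + h) = vecField j η + Nl j h := by
  rcases j with j | j
  · refine Prod.ext ?_ (Prod.ext ?_ ?_) <;> simp [vecField, Nl, mul_add]
  · refine Prod.ext ?_ (Prod.ext ?_ ?_) <;> simp [vecField, Nl, mul_add, add_comm]

theorem Nl_anti (i j : HIdx n) (η : Heis n) :
    Nl i (vecField j η) + Nl j (vecField i η) = 0 := by
  rcases i with i | i <;> rcases j with j | j <;>
    refine Prod.ext ?_ (Prod.ext ?_ ?_) <;> simp [vecField, Nl, Pi.single_apply]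
  all_goals
    by_cases h : i = j
    · simp [h]
    · simp [h, Ne.symm h]

/-- quadratic test function -/
def qtest (c : ℝ) (ℓ : Heis n →L[ℝ] ℝ) (B : Heis n →L[ℝ] Heis n →L[ℝ] ℝ) (η : Heis n) : Heis n → ℝ :=
  fun y => c + ℓ (y - η) + B (y - η) (y - η) / 2

theorem qtest_contDiff (c : ℝ) (ℓ : Heis n →L[ℝ] ℝ) (B : Heis n →L[ℝ] Heis n →L[ℝ] ℝ) (η : Heis n) :
    ContDiff ℝ 2 (qtest c ℓ B η) := by
  unfold qtest
  have h1 : ContDiff ℝ 2 fun y : Heis n => B (y - η) (y - η) :=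
    (B.contDiff.comp (by fun_prop)).clm_apply (by fun_prop)
  fun_prop

theorem qtest_fderiv (c : ℝ) (ℓ : Heis n →L[ℝ] ℝ) (B : Heis n →L[ℝ] Heis n →L[ℝ] ℝ) (η y : Heis n) :
    HasFDerivAt (qtest c ℓ B η) (ℓ + (1/2:ℝ) • (B (y - η) + B.flip (y - η))) y := by
  unfold qtest
  have h0 : HasFDerivAt (fun y : Heis n => y - η) (ContinuousLinearMap.id ℝ _) y := (hasFDerivAt_id y).sub_const η
  have h1 := B.hasFDerivAt_of_bilinear h0 h0
  have h2 : HasFDerivAt (fun y : Heis n => ℓ (y - η)) ℓ y := by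
    exact ℓ.hasFDerivAt.comp y h0
  have h3 := (h2.const_add c).add (h1.const_mul (1/2:ℝ))
  refine (h3.congr_fderiv ?_).congr_of_eventuallyEq ?_
  · ext k <;> simp
  · filter_upwards with z
    simp; ring

theorem qtest_hGrad (c : ℝ) (ℓ : Heis n →L[ℝ] ℝ) (B : Heis n →L[ℝ] Heis n →L[ℝ] ℝ) (η : Heis n) :
    hGrad (qtest c ℓ B η) η = fun j => ℓ (vecField j η) := by
  ext j
  rw [hGrad, (qtest_fderiv c ℓ B η η).fderiv]
  simp

theorem qtest_hHess (c : ℝ) (ℓ : Heis n →L[ℝ] ℝ) (B : Heis n →L[ℝ] Heis n →L[ℝ] ℝ) (η : Heis n) (i j) :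
    hHess (qtest c ℓ B η) η i j = (B (vecField j η) (vecField i η) + B (vecField i η) (vecField j η)) / 2
      + ℓ (Nl i (vecField j η)) := by
  rw [hHess, Matrix.of_apply]
  have e : (fun y => fderiv ℝ (qtest c ℓ B η) y (vecField i y)) =
    fun y => (ℓ + (1/2:ℝ) • (B (y - η) + B.flip (y - η))) (vecField i η + Nl i (y - η)) := by
    ext y
    rw [(qtest_fderiv c ℓ B η y).fderiv, ← vecField_add]; simp
  rw [e]
  have h0 : HasFDerivAt (fun y : Heis n => y - η) (ContinuousLinearMap.id ℝ _) η := (hasFDerivAt_id η).sub_const η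
  have h1 : HasFDerivAt (fun y : Heis n => ℓ + (1/2:ℝ) • (B (y - η) + B.flip (y - η)))
      ((1/2:ℝ) • (B + B.flip)) η := by
    have a1 : HasFDerivAt (fun y : Heis n => B (y - η)) B η := by exact B.hasFDerivAt.comp η h0
    have a2 : HasFDerivAt (fun y : Heis n => B.flip (y - η)) B.flip η := by
      exact B.flip.hasFDerivAt.comp η h0
    exact ((a1.add a2).const_smul (1/2:ℝ)).const_add ℓ
  have h2 : HasFDerivAt (fun y : Heis n => vecField i η + Nl i (y - η)) (Nl i) η := by
    have a1 : HasFDerivAt (fun y : Heis n => Nl i (y - η)) (Nl i) η := by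
      exact (Nl i).hasFDerivAt.comp η h0
    exact a1.const_add _
  rw [(h1.clm_apply h2).fderiv]
  simp
  ring

/-- horizontal vector -/
def hvec (η : Heis n) (x : HIdx n → ℝ) : Heis n := ∑ j, x j • vecField j η

theorem qf_hess (c : ℝ) (ℓ : Heis n →L[ℝ] ℝ) (B : Heis n →L[ℝ] Heis n →L[ℝ] ℝ) (η : Heis n) (x) :
    qf (hHessSym (qtest c ℓ B η) η) x = B (hvec η x) (hvec η x) := by
  have e : ∀ i j, hHessSym (qtest c ℓ B η) η i j =
      (B (vecField j η) (vecField i η) + B (vecField i η) (vecField j η)) / 2 := by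
    intro i j
    simp only [hHessSym, Matrix.smul_apply, Matrix.add_apply, Matrix.transpose_apply, qtest_hHess]
    have := congrArg ℓ (Nl_anti i j η)
    rw [map_add, map_zero] at this
    rw [smul_eq_mul]; linarith
  have e1 : B (hvec η x) (hvec η x) = ∑ i, ∑ j, B (vecField i η) (vecField j η) * (x i * x j) := by
    simp only [hvec, map_sum, _root_.sum_apply, map_smul, _root_.smul_apply, smul_eq_mul, Finset.mul_sum]
    rw [Finset.sum_comm]
    exact Finset.sum_congr rfl fun i _ => Finset.sum_congr rfl fun j _ => by ring
  have e2 : B (hvec η x) (hvec η x) = ∑ i, ∑ j, B (vecField j η) (vecField i η) * (x i * x j) := by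
    rw [e1, Finset.sum_comm]
    exact Finset.sum_congr rfl fun i _ => Finset.sum_congr rfl fun j _ => by ring
  have : B (hvec η x) (hvec η x) = (B (hvec η x) (hvec η x) + B (hvec η x) (hvec η x)) / 2 := by ring
  rw [this]
  nth_rewrite 1 [e2]
  rw [e1, ← Finset.sum_add_distrib, Finset.sum_div]
  unfold qf
  refine Finset.sum_congr rfl fun i _ => ?_
  rw [← Finset.sum_add_distrib, Finset.sum_div]
  refine Finset.sum_congr rfl fun j _ => ?_
  rw [e]; ring

theorem hess_symm (ψ : Heis n → ℝ) (η) : (hHessSym ψ η).IsSymm := by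
  unfold hHessSym Matrix.IsSymm
  rw [transpose_smul, transpose_add, transpose_transpose, add_comm]

theorem hvec_fst (η : Heis n) (x) (i) : (hvec η x).1 i = x (Sum.inl i) := by
  have : (hvec η x).1 i = cX i (hvec η x) := rfl
  rw [this, hvec, map_sum]
  simp [vecField, Pi.single_apply]

theorem hvec_snd (η : Heis n) (x) (i) : (hvec η x).2.1 i = x (Sum.inr i) := by
  have : (hvec η x).2.1 i = cY i (hvec η x) := rfl
  rw [this, hvec, map_sum]
  simp [vecField, Pi.single_apply]

theorem zsq_hvec (η : Heis n) (x) : zsq (hvec η x) = nsq x := by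
  simp [zsq, nsq, hvec_fst, hvec_snd, Finset.sum_add_distrib]

theorem Ml_hvec (ζ η : Heis n) (x) : Ml ζ (hvec η x) = hvec (hmul ζ η) x := by
  simp [hvec, Ml_vecField]

theorem apply_hvec (ℓ : Heis n →L[ℝ] ℝ) (η : Heis n) (x : HIdx n → ℝ) :
    ℓ (hvec η x) = ∑ j, ℓ (vecField j η) * x j := by
  simp only [hvec, map_sum, map_smul, smul_eq_mul, mul_comm]

/-- the horizontal part of a covector -/
def hg (ℓ : Heis n →L[ℝ] ℝ) (η : Heis n) : HIdx n → ℝ := fun j => ℓ (vecField j η)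

theorem pnorm_hg_Zb (ξ : Heis n) : pnorm (hg (Zb n ξ) ξ) = Real.sqrt (zsq ξ) := by
  unfold pnorm hg
  congr 1
  simp [Zb_apply, vecField, zsq, Pi.single_apply, Finset.sum_add_distrib]

end calc5

section env6
variable {n : ℕ}

theorem Ml_norm_le (ζ h : Heis n) : ‖Ml ζ h‖ ≤ (1 + 4 * n * ‖ζ‖) * ‖h‖ := by
  have hx : ∀ (k : Heis n) i, |k.1 i| ≤ ‖k‖ := fun k i => (norm_le_pi_norm k.1 i).trans (norm_fst_le k)
  have hy : ∀ (k : Heis n) i, |k.2.1 i| ≤ ‖k‖ := fun k i =>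
    ((norm_le_pi_norm k.2.1 i).trans (norm_fst_le k.2)).trans (norm_snd_le k)
  have ht : |h.2.2| ≤ ‖h‖ := (norm_snd_le h.2).trans (norm_snd_le h)
  have hb : ‖h‖ ≤ (1 + 4 * n * ‖ζ‖) * ‖h‖ := by
    have : 0 ≤ 4 * n * ‖ζ‖ * ‖h‖ := by positivity
    linarith
  rw [Ml_apply, Prod.norm_def, Prod.norm_def]
  refine max_le ((norm_fst_le h).trans hb) (max_le (((norm_fst_le h.2).trans (norm_snd_le h)).trans hb) ?_)
  have hs : |∑ i, (ζ.2.1 i * h.1 i - ζ.1 i * h.2.1 i)| ≤ ∑ _i : Fin n, 2 * (‖ζ‖ * ‖h‖) := by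
    refine (Finset.abs_sum_le_sum_abs _ _).trans (Finset.sum_le_sum fun i _ => ?_)
    refine (abs_sub _ _).trans ?_
    rw [abs_mul, abs_mul]
    have a1 := mul_le_mul (hy ζ i) (hx h i) (abs_nonneg _) (norm_nonneg _)
    have a2 := mul_le_mul (hx ζ i) (hy h i) (abs_nonneg _) (norm_nonneg _)
    linarith
  simp only [Finset.sum_const, Finset.card_univ, Fintype.card_fin, nsmul_eq_mul] at hs
  rw [Real.norm_eq_abs]
  refine (abs_add_le _ _).trans ?_
  rw [abs_mul, abs_two]
  linarith

theorem Qb_le (h : Heis n) : Qb n h h ≤ ‖Qb n‖ * ‖h‖ ^ 2 := by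
  have := (Qb n).le_opNorm₂ h h
  rw [mul_assoc, ← sq] at this
  exact (le_abs_self _).trans this

theorem envelope {K : Set (Heis n)} (hK : IsCompact K) (hKn : K.Nonempty) {v : Heis n → ℝ}
    (hv : UpperSemicontinuousOn v K) {a : ℝ} (ha : 0 < a) :
    ∃ (u : Heis n → ℝ) (y : Heis n → Heis n) (G : Heis n → Heis n →L[ℝ] ℝ) (Kc : ℝ), 0 ≤ Kc ∧
      (∀ ξ, y ξ ∈ K) ∧
      (∀ ξ, u ξ = v (y ξ) - a * Qb n (hmul (y ξ) (hinv ξ)) (hmul (y ξ) (hinv ξ))) ∧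
      (∀ ξ, ∀ η ∈ K, v η - a * Qb n (hmul η (hinv ξ)) (hmul η (hinv ξ)) ≤ u ξ) ∧
      (∀ x z, u x + G x (z - x) - Kc * ‖z - x‖ ^ 2 ≤ u z) := by
  have hex : ∀ ξ, ∃ η ∈ K, IsMaxOn (fun η => v η - a * Qb n (hmul η (hinv ξ)) (hmul η (hinv ξ))) K η := by
    intro ξ
    refine UpperSemicontinuousOn.exists_isMaxOn hKn hK ?_
    have hc : Continuous fun η : Heis n => -(a * Qb n (hmul η (hinv ξ)) (hmul η (hinv ξ))) := by
      have h1 : Continuous fun η : Heis n => hmul η (hinv ξ) := by unfold hmul; fun_prop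
      fun_prop
    have := hv.add (hc.upperSemicontinuous.upperSemicontinuousOn K)
    simpa only [sub_eq_add_neg] using this
  choose y hyK hy using hex
  obtain ⟨R, hR⟩ := hK.isBounded.exists_norm_le
  have hR0 : 0 ≤ R := (norm_nonneg _).trans (hR _ hKn.some_mem)
  refine ⟨fun ξ => v (y ξ) - a * Qb n (hmul (y ξ) (hinv ξ)) (hmul (y ξ) (hinv ξ)), y,
    fun ξ => (2 * a) • (Qb n (hmul (y ξ) (hinv ξ))).comp (Ml (y ξ)),
    a * (‖Qb n‖ * (1 + 4 * n * R) ^ 2), by positivity, hyK, fun _ => rfl,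
    fun ξ η hη => hy ξ hη, fun x z => ?_⟩
  have h1 := hy z (hyK x)
  simp only [Set.mem_ofPred_eq] at h1
  obtain ⟨h, rfl⟩ : ∃ h, z = x + h := ⟨z - x, by abel⟩
  simp only [add_sub_cancel_left]
  refine le_trans ?_ h1
  simp only [hmul_hinv_add]
  set ζ := hmul (y x) (hinv x)
  set k := Ml (y x) h with hk
  have h2 : Qb n k k ≤ ‖Qb n‖ * (1 + 4 * n * R) ^ 2 * ‖h‖ ^ 2 := by
    refine (Qb_le k).trans ?_
    have h3 : ‖k‖ ≤ (1 + 4 * n * R) * ‖h‖ := by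
      refine (Ml_norm_le _ _).trans ?_
      have := hR _ (hyK x)
      gcongr
    calc ‖Qb n‖ * ‖k‖ ^ 2 ≤ ‖Qb n‖ * ((1 + 4 * n * R) * ‖h‖) ^ 2 := by gcongr
      _ = _ := by ring
  have h4 := mul_le_mul_of_nonneg_left h2 ha.le
  simp only [map_sub, _root_.sub_apply, _root_.smul_apply, ContinuousLinearMap.comp_apply, smul_eq_mul, ← hk]
  rw [Qb_symm k ζ]
  linarith

theorem env_touch {K : Set (Heis n)} {v u : Heis n → ℝ} {a : ℝ} {η ξ : Heis n}
    (hu : u ξ = v η - a * Qb n (hmul η (hinv ξ)) (hmul η (hinv ξ)))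
    (hle : ∀ ξ, ∀ η ∈ K, v η - a * Qb n (hmul η (hinv ξ)) (hmul η (hinv ξ)) ≤ u ξ)
    {ℓ : Heis n →L[ℝ] ℝ} {A : Heis n →L[ℝ] Heis n →L[ℝ] ℝ} {δ : ℝ} (hδ : 0 < δ)
    (hexp : ∀ᶠ z in 𝓝 ξ, u z - u ξ - ℓ (z - ξ) - A (z - ξ) (z - ξ) / 2 ≤ δ * ‖z - ξ‖ ^ 2) :
    ∃ (ℓ' : Heis n →L[ℝ] ℝ) (B : Heis n →L[ℝ] Heis n →L[ℝ] ℝ),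
      (fun j => ℓ' (vecField j η)) = hg ℓ ξ ∧
      (∀ x, B (hvec η x) (hvec η x) = A (hvec ξ x) (hvec ξ x) + 2 * δ * Qb n (hvec ξ x) (hvec ξ x)) ∧
      ∀ᶠ z in 𝓝 η, z ∈ K → v z ≤ qtest (v η) ℓ' B η z := by
  set ζ := hmul η (hinv ξ) with hζ
  set M := Ml (hinv ζ) with hM
  have hη : η = hmul ζ ξ := (hmul_cancel η ξ).symm
  have hξ : hmul (hinv ζ) η = ξ := by rw [hη, hmul_cancel3]
  refine ⟨ℓ.comp M, A.bilinearComp M M + (2 * δ) • (Qb n).bilinearComp M M, ?_, ?_, ?_⟩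
  · ext j
    simp only [ContinuousLinearMap.comp_apply, hM, Ml_vecField, hξ, hg]
  · intro x
    simp [hM, Ml_hvec, hξ]
  · have hc : Tendsto (fun z : Heis n => hmul (hinv ζ) z) (𝓝 η) (𝓝 ξ) := by
      have : Continuous fun z : Heis n => hmul (hinv ζ) z := by unfold hmul; fun_prop
      have := this.tendsto η
      rwa [hξ] at this
    filter_upwards [hc.eventually hexp] with z hz hzK
    have h1 := hle (hmul (hinv ζ) z) z hzK
    rw [hmul_cancel2] at h1
    have e : hmul (hinv ζ) z - ξ = M (z - η) := by
      have := hmul_add (hinv ζ) η (z - η)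
      rw [add_sub_cancel, hξ] at this
      rw [this]; abel
    rw [e] at hz
    have h2 := mul_le_mul_of_nonneg_left (Qb_ge (M (z - η))) hδ.le
    simp only [qtest, ContinuousLinearMap.comp_apply, _root_.add_apply, ContinuousLinearMap.bilinearComp_apply, _root_.smul_apply, smul_eq_mul]
    linarith

theorem sub_test {Ω : Set (Heis n)} (hΩ : IsOpen Ω) {L : Heis n → ℝ → (HIdx n → ℝ) → HMat n}
    {S : Set (HMat n)} {V : Heis n → EReal} (hsub : IsSubsolution Ω L S V) {v u : Heis n → ℝ}
    (hVv : ∀ ξ ∈ Ω, V ξ ≤ (v ξ : EReal)) {a : ℝ} {η ξ : Heis n} (hη : η ∈ Ω) (hVη : V η = (v η : EReal))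
    (hu : u ξ = v η - a * Qb n (hmul η (hinv ξ)) (hmul η (hinv ξ)))
    (hle : ∀ ξ, ∀ η ∈ closure Ω, v η - a * Qb n (hmul η (hinv ξ)) (hmul η (hinv ξ)) ≤ u ξ)
    {ℓ : Heis n →L[ℝ] ℝ} {A : Heis n →L[ℝ] Heis n →L[ℝ] ℝ} {δ : ℝ} (hδ : 0 < δ)
    (hexp : ∀ᶠ z in 𝓝 ξ, u z - u ξ - ℓ (z - ξ) - A (z - ξ) (z - ξ) / 2 ≤ δ * ‖z - ξ‖ ^ 2) :
    ∃ H : HMat n, H.IsSymm ∧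
      (∀ x, qf H x = A (hvec ξ x) (hvec ξ x) + 2 * δ * Qb n (hvec ξ x) (hvec ξ x)) ∧
      H + L η (v η) (hg ℓ ξ) ∈ closure S := by
  obtain ⟨ℓ', B, h1, h2, h3⟩ := env_touch hu hle hδ hexp
  refine ⟨hHessSym (qtest (v η) ℓ' B η) η, hess_symm _ _, fun x => by rw [qf_hess, h2], ?_⟩
  have hq : qtest (v η) ℓ' B η η = v η := by simp [qtest]
  have := hsub η hη (qtest (v η) ℓ' B η) (qtest_contDiff _ _ _ _).contDiffOn (by rw [hVη, hq]) (by
    filter_upwards [h3] with z hz hzΩ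
    exact (hVv z hzΩ).trans (by exact_mod_cast hz (subset_closure hzΩ)))
  rwa [Fop, qtest_hGrad, h1, hq] at this

theorem super_test {Ω : Set (Heis n)} (hΩ : IsOpen Ω) {L : Heis n → ℝ → (HIdx n → ℝ) → HMat n}
    {S : Set (HMat n)} {W : Heis n → EReal} (hsup : IsSupersolution Ω L S W) {w u : Heis n → ℝ}
    (hWw : ∀ ξ ∈ Ω, (w ξ : EReal) ≤ W ξ) {a : ℝ} {η ξ : Heis n} (hη : η ∈ Ω) (hWη : W η = (w η : EReal))
    (hu : u ξ = -w η - a * Qb n (hmul η (hinv ξ)) (hmul η (hinv ξ)))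
    (hle : ∀ ξ, ∀ η ∈ closure Ω, -w η - a * Qb n (hmul η (hinv ξ)) (hmul η (hinv ξ)) ≤ u ξ)
    {ℓ : Heis n →L[ℝ] ℝ} {A : Heis n →L[ℝ] Heis n →L[ℝ] ℝ} {δ : ℝ} (hδ : 0 < δ)
    (hexp : ∀ᶠ z in 𝓝 ξ, u z - u ξ - ℓ (z - ξ) - A (z - ξ) (z - ξ) / 2 ≤ δ * ‖z - ξ‖ ^ 2) :
    ∃ H : HMat n, H.IsSymm ∧
      (∀ x, qf H x = -A (hvec ξ x) (hvec ξ x) - 2 * δ * Qb n (hvec ξ x) (hvec ξ x)) ∧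
      H + L η (w η) (-hg ℓ ξ) ∉ S := by
  obtain ⟨ℓ', B, h1, h2, h3⟩ := env_touch (v := fun z => -w z) hu hle hδ hexp
  have hneg : ∀ z, qtest (w η) (-ℓ') (-B) η z = - qtest (-w η) ℓ' B η z := by
    intro z; simp [qtest]; ring
  refine ⟨hHessSym (qtest (w η) (-ℓ') (-B) η) η, hess_symm _ _, fun x => ?_, ?_⟩
  · rw [qf_hess]; simp only [_root_.neg_apply, h2]; ring
  have hq : qtest (w η) (-ℓ') (-B) η η = w η := by simp [qtest]
  have := hsup η hη (qtest (w η) (-ℓ') (-B) η) (qtest_contDiff _ _ _ _).contDiffOn (by rw [hWη, hq]) (by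
    filter_upwards [h3] with z hz hzΩ
    refine le_trans ?_ (hWw z hzΩ)
    have := hz (subset_closure hzΩ)
    rw [hneg]
    exact_mod_cast (by linarith : -qtest (-w η) ℓ' B η z ≤ w z))
  have e : (fun j => (-ℓ') (vecField j η)) = - hg ℓ ξ := by
    rw [← h1]; ext j; simp
  rwa [Fop, qtest_hGrad, e, hq] at this

end env6

section prep7
variable {n : ℕ}

theorem mem_of_gap {S : Set (HMat n)} (hSsymm : ∀ A ∈ S, A.IsSymm)
    (hSpos : ∀ A ∈ S, ∀ B : HMat n, B.PosDef → A + B ∈ S)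
    (hScone : ∀ A ∈ S, ∀ c : ℝ, 1 < c → c • A ∈ S) {A B : HMat n} (hA : A ∈ closure S)
    (hB : B.IsSymm) {τ c : ℝ} (hτ : 1 < τ) (hc : 0 < c)
    (h : ∀ x, c * nsq x ≤ qf B x - τ * qf A x) : B ∈ S := by
  set N : ℝ := ((Fintype.card (HIdx n) : ℕ) : ℝ) with hN
  have hN0 : 0 ≤ N := by positivity
  set e : ℝ := c / (2 * τ * (N + 1)) with he
  have he0 : 0 < e := by positivity
  have hopen : IsOpen {M : HMat n | ∀ i j, |M i j - A i j| < e} := by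
    simp only [Set.ofPred_forall]
    refine isOpen_iInter_of_finite fun i => isOpen_iInter_of_finite fun j => ?_
    exact isOpen_lt (by fun_prop) continuous_const
  obtain ⟨A', hA', hA'S⟩ := mem_closure_iff.1 hA _ hopen (by intro i j; simpa using he0)
  have hA'1 : ∀ i j, |A' i j - A i j| < e := hA'
  have key : (B - τ • A').PosDef := by
    refine posDef_of_qf ?_ fun x hx => ?_
    · have h1 : Bᵀ = B := hB
      have h2 : A'ᵀ = A' := hSsymm _ hA'S
      rw [Matrix.IsSymm, transpose_sub, transpose_smul, h1, h2]
    · rw [qf_sub, qf_smul]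
      have h1 := qf_abs_le (A := A' - A) (M := e) (fun i j => (hA'1 i j).le) he0.le x
      rw [qf_sub] at h1
      have h2 := (abs_le.1 h1).2
      have h3 := h x
      have h4 := nsq_pos hx
      have h5 : τ * (e * N * nsq x) ≤ c / 2 * nsq x := by
        have : τ * (e * N) ≤ c / 2 := by
          rw [he]
          have : τ * (c / (2 * τ * (N + 1)) * N) = c / 2 * (N / (N + 1)) := by
            field_simp
          rw [this]
          have h6 : N / (N + 1) ≤ 1 := by rw [div_le_one (by positivity)]; linarith
          nlinarith
        calc τ * (e * N * nsq x) = τ * (e * N) * nsq x := by ring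
          _ ≤ _ := mul_le_mul_of_nonneg_right this h4.le
      have h7 : τ * (qf A' x - qf A x) ≤ τ * (e * N * nsq x) :=
        mul_le_mul_of_nonneg_left h2 (by linarith)
      have h8 : 0 < c * nsq x := by positivity
      linarith
  have := hSpos _ (hScone _ hA'S τ hτ) _ key
  simpa using this

theorem usc_bound {K : Set (Heis n)} (hK : IsCompact K) (hKn : K.Nonempty) {V : Heis n → EReal}
    (hV : UpperSemicontinuousOn V K) (hVt : ∀ ξ ∈ K, V ξ ≠ ⊤) :
    ∃ R : ℝ, ∀ ξ ∈ K, V ξ ≤ (R : EReal) := by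
  obtain ⟨x, hx, hm⟩ := UpperSemicontinuousOn.exists_isMaxOn hKn hK hV
  refine ⟨(V x).toReal, fun ξ hξ => (hm hξ).trans ?_⟩
  exact EReal.le_coe_toReal (hVt x hx)

theorem usc_trunc {K : Set (Heis n)} {V : Heis n → EReal}
    (hV : UpperSemicontinuousOn V K) (hVt : ∀ ξ ∈ K, V ξ ≠ ⊤) (R : ℝ) :
    ∃ v : Heis n → ℝ, (∀ ξ ∈ K, (v ξ : EReal) = max (V ξ) (R : EReal)) ∧ UpperSemicontinuousOn v K := by
  have h1 : ∀ ξ ∈ K, (((max (V ξ) (R : EReal)).toReal : ℝ) : EReal) = max (V ξ) (R : EReal) := by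
    intro ξ hξ
    refine EReal.coe_toReal ?_ ?_
    · intro h
      rcases max_choice (V ξ) (R : EReal) with h' | h'
      · exact hVt ξ hξ (by rw [← h', h])
      · rw [h'] at h; exact EReal.coe_ne_top _ h
    · intro h
      have := le_max_right (V ξ) (R : EReal)
      rw [h] at this
      exact EReal.coe_ne_bot _ (le_bot_iff.1 this)
  refine ⟨fun ξ => (max (V ξ) (R : EReal)).toReal, h1, ?_⟩
  intro ξ hξ y hy
  have hy' : max (V ξ) (R : EReal) < (y : EReal) := by
    rw [← h1 ξ hξ]; exact_mod_cast hy
  have h2 := hV ξ hξ y (lt_of_le_of_lt (le_max_left _ _) hy')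
  filter_upwards [h2, self_mem_nhdsWithin] with z hz hzK
  have : max (V z) (R : EReal) < (y : EReal) := max_lt hz (lt_of_le_of_lt (le_max_right _ _) hy')
  rw [← h1 z hzK] at this
  exact_mod_cast this

theorem compact_alt {Z : Type*} [TopologicalSpace Z] {P : Set Z} (hP : IsCompact P) {f D : Z → ℝ} {c : ℝ}
    (hf : UpperSemicontinuousOn f P) (hD : Continuous D) (hD0 : ∀ z, 0 ≤ D z)
    {Q : ℝ → Z → Prop} (hQ : ∀ a b z, a ≤ b → Q b z → Q a z)
    (h : ∀ z ∈ P, D z = 0 → f z < c ∨ ∃ a > 0, ∀ᶠ z' in 𝓝 z, Q a z') :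
    ∃ a > 0, ∀ z ∈ P, D z ≤ a → c - a ≤ f z → Q a z := by
  refine hP.induction_on (p := fun s => ∃ a > 0, ∀ z ∈ s, D z ≤ a → c - a ≤ f z → Q a z) ?_ ?_ ?_ ?_
  · exact ⟨1, one_pos, by simp⟩
  · rintro s t hst ⟨a, ha, h1⟩
    exact ⟨a, ha, fun z hz => h1 z (hst hz)⟩
  · rintro s t ⟨a, ha, h1⟩ ⟨b, hb, h2⟩
    refine ⟨min a b, lt_min ha hb, ?_⟩
    have l1 := min_le_left a b
    have l2 := min_le_right a b
    rintro z (hz | hz) h3 h4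
    · exact hQ _ _ _ l1 (h1 z hz (by linarith) (by linarith))
    · exact hQ _ _ _ l2 (h2 z hz (by linarith) (by linarith))
  · intro z hz
    rcases (hD0 z).lt_or_eq with h0 | h0
    · have : ∀ᶠ z' in 𝓝[P] z, D z / 2 < D z' :=
        (hD.continuousAt.tendsto.mono_left nhdsWithin_le_nhds).eventually (lt_mem_nhds (by linarith))
      refine ⟨_, this, D z / 2, by linarith, fun z' hz' h1 => ?_⟩
      have : D z / 2 < D z' := hz'
      linarith
    · rcases h z hz h0.symm with h1 | ⟨a, ha, h1⟩
      · have := hf z hz ((c + f z) / 2) (by linarith)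
        refine ⟨_, this, (c - f z) / 2, by linarith, fun z' hz' _ h2 => ?_⟩
        have : f z' < (c + f z) / 2 := hz'
        linarith
      · exact ⟨_, mem_nhdsWithin_of_mem_nhds h1, a, ha, fun z' hz' _ _ => hz'⟩

theorem usc_pair {K : Set (Heis n)} {v t : Heis n → ℝ} (hv : UpperSemicontinuousOn v K)
    (ht : UpperSemicontinuousOn t K) :
    UpperSemicontinuousOn (fun z : Heis n × Heis n => v z.1 + t z.2) (K ×ˢ K) := by
  rintro z ⟨h1, h2⟩ y hy
  have e1 := hv z.1 h1 (v z.1 + (y - (v z.1 + t z.2)) / 2) (by simp only at hy; linarith)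
  have e2 := ht z.2 h2 (t z.2 + (y - (v z.1 + t z.2)) / 2) (by simp only at hy; linarith)
  rw [show z = (z.1, z.2) from rfl, nhdsWithin_prod_eq]
  filter_upwards [e1.prod_mk e2] with z' ⟨a, b⟩
  linarith

theorem lemmaD {K : Set (Heis n)} (hK : IsCompact K) {v t : Heis n → ℝ} (hv : UpperSemicontinuousOn v K)
    (ht : UpperSemicontinuousOn t K) (hle : ∀ ξ ∈ K, v ξ + t ξ ≤ 0) {b : ℝ} (hb : 0 < b) :
    ∃ a > 0, ∀ η ∈ K, ∀ η' ∈ K, dist η η' ≤ a → v η + t η' ≤ b := by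
  obtain ⟨a, ha, h⟩ := compact_alt (hK.prod hK) (D := fun z => dist z.1 z.2) (c := b) (usc_pair hv ht) (by fun_prop)
    (fun _ => dist_nonneg) (Q := fun _ _ => False) (fun _ _ _ _ h => h) (by
      rintro ⟨z1, z2⟩ ⟨h1, h2⟩ h3
      have : z1 = z2 := dist_eq_zero.1 h3
      subst this
      left
      have := hle z1 h1
      simp only; linarith)
  refine ⟨a, ha, fun η h1 η' h2 h3 => ?_⟩
  by_contra hcon
  exact h (η, η') ⟨h1, h2⟩ h3 (by simp only; linarith)

theorem lemmaC {Ω : Set (Heis n)} (hΩ : IsOpen Ω) (hK : IsCompact (closure Ω)) {v t : Heis n → ℝ}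
    (hv : UpperSemicontinuousOn v (closure Ω))
    (ht : UpperSemicontinuousOn t (closure Ω)) (hle : ∀ ξ ∈ frontier Ω, v ξ + t ξ < 0) :
    ∃ a > 0, ∀ η ∈ closure Ω, ∀ η' ∈ closure Ω, dist η η' ≤ a → -a ≤ v η + t η' → Metric.ball η (2 * a) ⊆ Ω := by
  obtain ⟨a, ha, h⟩ := compact_alt (hK.prod hK) (D := fun z => dist z.1 z.2) (c := 0) (usc_pair hv ht) (by fun_prop)
    (fun _ => dist_nonneg) (Q := fun a z => Metric.ball z.1 (2 * a) ⊆ Ω)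
    (fun a b z hab h => (Metric.ball_subset_ball (by linarith)).trans h) (by
      rintro ⟨z1, z2⟩ ⟨h1, h2⟩ h3
      have : z1 = z2 := dist_eq_zero.1 h3
      subst this
      by_cases hz : z1 ∈ Ω
      · right
        obtain ⟨ε, hε, hb⟩ := Metric.isOpen_iff.1 hΩ z1 hz
        refine ⟨ε / 4, by positivity, ?_⟩
        have : ∀ᶠ z' : Heis n × Heis n in 𝓝 (z1, z1), dist z'.1 z1 < ε / 2 := by
          have hc : Continuous fun z' : Heis n × Heis n => dist z'.1 z1 := by fun_prop
          exact hc.continuousAt.tendsto.eventually (gt_mem_nhds (by simpa using by positivity))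
        filter_upwards [this] with z' hz'
        refine (Metric.ball_subset_ball' ?_).trans hb
        linarith
      · left
        exact hle z1 (by rw [hΩ.frontier_eq]; exact ⟨h1, hz⟩))
  exact ⟨a, ha, fun η h1 η' h2 h3 h4 => h (η, η') ⟨h1, h2⟩ h3 (by simpa using h4)⟩

theorem exp_ge_quad {s : ℝ} (hs : -2 ≤ s) : 1 + s + s ^ 2 / 4 ≤ Real.exp s := by
  have h1 := Real.add_one_le_exp (s / 2)
  have h2 : Real.exp s = Real.exp (s / 2) ^ 2 := by
    rw [← Real.exp_nat_mul]; congr 1; push_cast; ring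
  rw [h2]
  nlinarith

set_option maxHeartbeats 1000000 in
theorem exp_expand {V : Type*} [NormedAddCommGroup V] [NormedSpace ℝ V] {u : V → ℝ} {x : V} {ℓ : V →L[ℝ] ℝ}
    {A₁ : V →L[ℝ] V →L[ℝ] ℝ} {Kc σ lam κ : ℝ} (hKc : 0 ≤ Kc) (hσ : 0 < σ) (hl : 0 < lam)
    (hκ : κ = σ * lam * Real.exp (lam * u x))
    (hlow : ∀ y, u x + ℓ (y - x) - Kc * ‖y - x‖ ^ 2 ≤ u y)
    (hexp : ∀ ε > 0, ∀ᶠ y in 𝓝 x, |(u y + σ * Real.exp (lam * u y)) - (u x + σ * Real.exp (lam * u x))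
      - ((1 + κ) • ℓ) (y - x) - A₁ (y - x) (y - x) / 2| ≤ ε * ‖y - x‖ ^ 2) :
    ∀ ε > 0, ∀ᶠ y in 𝓝 x, u y - u x - ℓ (y - x)
      - ((1 + κ)⁻¹ • (A₁ - (κ * lam / 2) • ℓ.smulRight ℓ)) (y - x) (y - x) / 2 ≤ ε * ‖y - x‖ ^ 2 := by
  intro ε hε
  have hκ0 : 0 < κ := by rw [hκ]; positivity
  set M : ℝ := Kc + ‖A₁‖ + 1 with hM
  have hM0 : 0 < M := by positivity
  set B : ℝ := κ * lam * M * ‖ℓ‖ with hBdef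
  have hB0 : 0 ≤ B := by positivity
  have hn : Tendsto (fun y : V => ‖y - x‖) (𝓝 x) (𝓝 0) := by
    have : Continuous fun y : V => ‖y - x‖ := by fun_prop
    simpa using this.tendsto x
  have e1 : ∀ᶠ y in 𝓝 x, lam * (‖ℓ‖ * ‖y - x‖ + Kc * ‖y - x‖ ^ 2) ≤ 2 := by
    have : Tendsto (fun y : V => lam * (‖ℓ‖ * ‖y - x‖ + Kc * ‖y - x‖ ^ 2)) (𝓝 x) (𝓝 0) := by
      have := ((hn.const_mul ‖ℓ‖).add ((hn.pow 2).const_mul Kc)).const_mul lam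
      simpa using this
    exact (this.eventually (gt_mem_nhds (show (0:ℝ) < 2 by norm_num))).mono fun _ h => le_of_lt h
  have e2 : ∀ᶠ y in 𝓝 x, B * ‖y - x‖ ≤ ε / 2 := by
    have : Tendsto (fun y : V => B * ‖y - x‖) (𝓝 x) (𝓝 0) := by
      simpa using hn.const_mul B
    exact (this.eventually (gt_mem_nhds (show (0:ℝ) < ε / 2 by positivity))).mono fun _ h => le_of_lt h
  filter_upwards [e1, e2, hexp (ε / 2) (by positivity), hexp 1 one_pos] with y h1 h2 h3 h4
  set h := y - x with hh
  set Δ := u y - u x with hΔ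
  have hN := norm_nonneg h
  have hlh : |ℓ h| ≤ ‖ℓ‖ * ‖h‖ := ℓ.le_opNorm h
  have hAh : |A₁ h h| ≤ ‖A₁‖ * ‖h‖ ^ 2 := by
    have := A₁.le_opNorm₂ h h
    rwa [mul_assoc, ← sq] at this
  have hl1 : ℓ h - Kc * ‖h‖ ^ 2 ≤ Δ := by have := hlow y; rw [← hh] at this; linarith
  have hs : -2 ≤ lam * Δ := by
    have : -(‖ℓ‖ * ‖h‖ + Kc * ‖h‖ ^ 2) ≤ Δ := by linarith [(abs_le.1 hlh).1]
    nlinarith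
  have hq := exp_ge_quad hs
  have hE : Real.exp (lam * u y) = Real.exp (lam * u x) * Real.exp (lam * Δ) := by
    rw [← Real.exp_add]; congr 1; rw [hΔ]; ring
  have hfd : (1 + κ) * Δ + κ * lam / 4 * Δ ^ 2 ≤
      (u y + σ * Real.exp (lam * u y)) - (u x + σ * Real.exp (lam * u x)) := by
    have hp : 0 < σ * Real.exp (lam * u x) := by positivity
    have := mul_le_mul_of_nonneg_left hq hp.le
    rw [hE]
    have e : κ * Δ + κ * lam / 4 * Δ ^ 2 = σ * Real.exp (lam * u x) * (lam * Δ + (lam * Δ) ^ 2 / 4) := by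
      rw [hκ]; ring
    have e' : u y = u x + Δ := by rw [hΔ]; ring
    linarith
  simp only [_root_.smul_apply, smul_eq_mul] at h3 h4
  have h3' := (abs_le.1 h3).2
  have h4' := (abs_le.1 h4).2
  have hup : Δ - ℓ h ≤ M * ‖h‖ ^ 2 := by
    have a1 : 0 ≤ κ * lam / 4 * Δ ^ 2 := by positivity
    have a2 : (1 + κ) * (Δ - ℓ h) ≤ M * ‖h‖ ^ 2 := by
      have := (abs_le.1 hAh).2
      have : 0 ≤ Kc * ‖h‖ ^ 2 := by positivity
      have : 0 ≤ ‖A₁‖ * ‖h‖ ^ 2 := by positivity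
      rw [hM]; linarith
    have a3 : 0 ≤ M * ‖h‖ ^ 2 := by positivity
    by_contra hcon
    push Not at hcon
    nlinarith
  have hdn : -(M * ‖h‖ ^ 2) ≤ Δ - ℓ h := by
    have : 0 ≤ (‖A₁‖ + 1) * ‖h‖ ^ 2 := by positivity
    rw [hM]; linarith
  have hsq : (ℓ h) ^ 2 - 2 * M * ‖ℓ‖ * ‖h‖ * ‖h‖ ^ 2 ≤ Δ ^ 2 := by
    have a1 : |(Δ - ℓ h) * ℓ h| ≤ (M * ‖h‖ ^ 2) * (‖ℓ‖ * ‖h‖) := by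
      rw [abs_mul]
      exact mul_le_mul (abs_le.2 ⟨hdn, hup⟩) hlh (abs_nonneg _) (by positivity)
    have a2 := (abs_le.1 a1).1
    nlinarith [sq_nonneg (Δ - ℓ h)]
  have hfin : (1 + κ) * (Δ - ℓ h) - (A₁ h h - κ * lam / 2 * (ℓ h) ^ 2) / 2 ≤ ε * ‖h‖ ^ 2 := by
    have a1 : κ * lam / 4 * ((ℓ h) ^ 2 - 2 * M * ‖ℓ‖ * ‖h‖ * ‖h‖ ^ 2) ≤ κ * lam / 4 * Δ ^ 2 :=
      mul_le_mul_of_nonneg_left hsq (by positivity)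
    have a2 : B * ‖h‖ * ‖h‖ ^ 2 ≤ ε / 2 * ‖h‖ ^ 2 := mul_le_mul_of_nonneg_right h2 (by positivity)
    have a3 : κ * lam / 4 * (2 * M * ‖ℓ‖ * ‖h‖ * ‖h‖ ^ 2) = B * ‖h‖ * ‖h‖ ^ 2 / 2 := by rw [hBdef]; ring
    have a4 : 0 ≤ B * ‖h‖ * ‖h‖ ^ 2 := by positivity
    rw [mul_sub, a3] at a1
    linarith
  have hval : ((1 + κ)⁻¹ • (A₁ - (κ * lam / 2) • ℓ.smulRight ℓ)) h h =
      (1 + κ)⁻¹ * (A₁ h h - κ * lam / 2 * (ℓ h) ^ 2) := by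
    simp only [_root_.smul_apply, _root_.sub_apply, ContinuousLinearMap.smulRight_apply, smul_eq_mul]
    ring
  rw [hval]
  have hpos : 0 < 1 + κ := by linarith
  have : (1 + κ) * (Δ - ℓ h - (1 + κ)⁻¹ * (A₁ h h - κ * lam / 2 * (ℓ h) ^ 2) / 2) ≤ ε * ‖h‖ ^ 2 := by
    have e : (1 + κ) * (Δ - ℓ h - (1 + κ)⁻¹ * (A₁ h h - κ * lam / 2 * (ℓ h) ^ 2) / 2) =
      (1 + κ) * (Δ - ℓ h) - (A₁ h h - κ * lam / 2 * (ℓ h) ^ 2) / 2 := by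
      field_simp
    rw [e]; exact hfin
  have hr : 0 ≤ ε * ‖h‖ ^ 2 := by positivity
  clear_value h Δ M B
  generalize Δ - ℓ h - (1 + κ)⁻¹ * (A₁ h h - κ * lam / 2 * (ℓ h) ^ 2) / 2 = T at this ⊢
  generalize ε * ‖h‖ ^ 2 = T' at this hr ⊢
  by_contra hcon
  push Not at hcon
  nlinarith

end prep7

section prep8
variable {n : ℕ}

set_option maxHeartbeats 1000000 in
theorem L_est {Ω : Set (Heis n)} {L : Heis n → ℝ → (HIdx n → ℝ) → HMat n}
    (hLlip : ∀ i j : HIdx n, LocallyLipschitzOnSet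
      (Ω ×ˢ (Set.univ : Set (ℝ × (HIdx n → ℝ))))
      (fun q : Heis n × ℝ × (HIdx n → ℝ) => L q.1 q.2.1 q.2.2 i j))
    {m : ℝ} (hm : 1 < m) {R C33 C34 C Λ θ κ g b d : ℝ}
    (h33 : ∀ ξ ∈ Ω, ∀ s : ℝ, |s| ≤ R → ∀ p : HIdx n → ℝ,
      (DiffInXi L ξ s p → xiGradNorm L ξ s p ≤ C33 * pnorm p ^ m))
    (hC34 : 0 < C34)
    (h34 : ∀ ξ ∈ Ω, ∀ s s' : ℝ, -R ≤ s → s ≤ s' → s' ≤ R →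
      ∀ p : HIdx n → ℝ,
      matLE 0 (L ξ s' p - L ξ s p) ∧
      matLE (L ξ s' p - L ξ s p) ((C34 * (s' - s) * pnorm p ^ m) • (1 : HMat n)))
    (hC33 : 0 < C33) (hC : 0 < C) (hΛ : 0 < Λ) (hθ : 0 < θ) (hκ0 : 0 < κ) (hκ : κ ≤ 1 / 4)
    (hg : κ * θ = g) (hb : 0 ≤ b)
    (h37 : ∀ ξ ∈ Ω, ∀ s : ℝ, |s| ≤ R → ∀ p : HIdx n → ℝ,
      DiffInP L ξ s p →
      matLE ((-C) • vecMulVec p p + ((1 / C) * pnorm p ^ m) • (1 : HMat n))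
            (pDotGradL L ξ s p - L ξ s p - (θ * Λ * pGradNorm L ξ s p) • (1 : HMat n)
              + θ • (1 : HMat n)))
    (hg1 : C * g * Λ ^ 2 ≤ 1 / 2) (hg2 : 8 * g * Λ ≤ 1)
    {η η' : Heis n} {s s' : ℝ} (hs : |s| ≤ R) (hs' : |s'| ≤ R) (hss : s - s' ≤ b)
    (hball : Metric.ball η d ⊆ Ω) (hdist : dist η' η < d)
    (herr1 : C34 * b + C33 * Fintype.card (HIdx n) * ‖η' - η‖ ≤ κ / (C * 2 ^ m))
    (herr2 : C34 * b + C33 * Fintype.card (HIdx n) * ‖η' - η‖ ≤ g / 4)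
    {p r q : HIdx n → ℝ} (hr : pnorm r ≤ Λ) (hq : q = (1 + κ) • p + g • r) (x : HIdx n → ℝ) :
    -(8 * C * κ * (∑ i, p i * x i) ^ 2) - 3 / 2 * g * nsq x ≤
      qf (L η' s' q) x - (1 + κ) * qf (L η s p) x := by
  have hηΩ : η ∈ Ω := hball (Metric.mem_ball_self (by linarith [dist_nonneg (x := η') (y := η)]))
  have hg0 : 0 < g := by rw [← hg]; positivity
  have hm0 : 0 < m := by linarith
  set E : ℝ := C34 * b + C33 * Fintype.card (HIdx n) * ‖η' - η‖ with hE
  have hE0 : 0 ≤ E := by positivity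
  have hx0 := nsq_nonneg x
  have hQ := pnorm_nonneg q
  have hQm : 0 ≤ pnorm q ^ m := Real.rpow_nonneg hQ m
  have hP := lemmaP L η s (slice_p hLlip hηΩ s) hm hC hθ hκ0 hκ hΛ (h37 η hηΩ s hs) p r x hr
  rw [cP, hg, ← hq] at hP
  set μ : ℝ := max 0 (pnorm q - κ * (pnorm p + θ * Λ)) with hμ
  have hμ0 : 0 ≤ μ := le_max_left _ _
  have hstep1 : qf (L η s q) x - C34 * b * pnorm q ^ m * nsq x ≤ qf (L η s' q) x := by
    rcases le_total s s' with h | h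
    · have := qf_nonneg (by simpa [matLE] using (h34 η hηΩ s s' (abs_le.1 hs).1 h (abs_le.1 hs').2 q).1) x
      rw [qf_sub] at this
      have : 0 ≤ C34 * b * pnorm q ^ m * nsq x := by positivity
      linarith
    · have := qf_mono (h34 η hηΩ s' s (abs_le.1 hs').1 h (abs_le.1 hs).2 q).2 x
      rw [qf_sub, qf_smul, qf_one] at this
      have h2 : C34 * (s - s') * pnorm q ^ m * nsq x ≤ C34 * b * pnorm q ^ m * nsq x := by
        gcongr
      linarith
  have hstep2 : qf (L η s' q) x - C33 * Fintype.card (HIdx n) * ‖η' - η‖ * pnorm q ^ m * nsq x ≤ qf (L η' s' q) x := by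
    have h1 : ∀ i j, |(L η' s' q - L η s' q) i j| ≤ C33 * pnorm q ^ m * ‖η' - η‖ := by
      intro i j
      exact xi_lip hLlip s' q (fun ξ hξ => h33 ξ hξ s' hs' q) hball hdist i j
    have h2 := qf_abs_le h1 (by positivity) x
    rw [qf_sub] at h2
    have h3 := (abs_le.1 h2).1
    have e : C33 * pnorm q ^ m * ‖η' - η‖ * Fintype.card (HIdx n) * nsq x =
      C33 * Fintype.card (HIdx n) * ‖η' - η‖ * pnorm q ^ m * nsq x := by ring
    linarith
  have hstep : qf (L η s q) x - E * pnorm q ^ m * nsq x ≤ qf (L η' s' q) x := by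
    have e : E * pnorm q ^ m * nsq x = C34 * b * pnorm q ^ m * nsq x +
      C33 * Fintype.card (HIdx n) * ‖η' - η‖ * pnorm q ^ m * nsq x := by rw [hE]; ring
    linarith
  have hpq : pnorm p ≤ pnorm q + g * Λ := by
    have h1 : (1 + κ) * pnorm p ≤ pnorm q + g * Λ := by
      have e : (1 + κ) • p = q + (-g) • r := by rw [hq]; simp
      have h2 := pnorm_add q ((-g) • r)
      rw [← e, pnorm_smul, pnorm_smul, abs_neg, abs_of_pos hg0, abs_of_pos (by linarith)] at h2
      have := mul_le_mul_of_nonneg_left hr hg0.le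
      linarith
    have := mul_nonneg hκ0.le (pnorm_nonneg p)
    linarith
  have hkey : E * pnorm q ^ m ≤ κ / C * μ ^ m + g / 4 := by
    rcases le_total (8 * g * Λ) (pnorm q) with h | h
    · have h1 : pnorm q / 2 ≤ μ := by
        refine le_trans ?_ (le_max_right _ _)
        have h2 : κ * (pnorm p + θ * Λ) = κ * pnorm p + g * Λ := by rw [← hg]; ring
        have h3 : κ * pnorm p ≤ 1 / 4 * (pnorm q + g * Λ) :=
          mul_le_mul hκ hpq (pnorm_nonneg p) (by norm_num)
        have : 0 < g * Λ := by positivity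
        rw [h2]; linarith
      have h2 : (pnorm q / 2) ^ m ≤ μ ^ m := Real.rpow_le_rpow (by positivity) h1 hm0.le
      rw [Real.div_rpow hQ (by norm_num)] at h2
      have h3 : E * pnorm q ^ m ≤ κ / (C * 2 ^ m) * pnorm q ^ m := mul_le_mul_of_nonneg_right herr1 hQm
      have h4 : κ / (C * 2 ^ m) * pnorm q ^ m = κ / C * (pnorm q ^ m / 2 ^ m) := by
        field_simp
      have h5 : κ / C * (pnorm q ^ m / 2 ^ m) ≤ κ / C * μ ^ m := mul_le_mul_of_nonneg_left h2 (by positivity)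
      linarith
    · have h1 : pnorm q ^ m ≤ 1 := Real.rpow_le_one hQ (h.trans hg2) hm0.le
      have h2 : E * pnorm q ^ m ≤ g / 4 * 1 := mul_le_mul herr2 h1 hQm (by positivity)
      have : 0 ≤ κ / C * μ ^ m := mul_nonneg (by positivity) (Real.rpow_nonneg hμ0 m)
      linarith
  have hkx := mul_le_mul_of_nonneg_right hkey hx0
  have hc1 : κ * (2 * C * (g * Λ) ^ 2) ≤ g / 4 := by
    have e : κ * (2 * C * (g * Λ) ^ 2) = κ * (2 * g * (C * g * Λ ^ 2)) := by ring
    rw [e]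
    have h1 : 2 * g * (C * g * Λ ^ 2) ≤ 2 * g * (1 / 2) := mul_le_mul_of_nonneg_left hg1 (by positivity)
    have h2 : κ * (2 * g * (C * g * Λ ^ 2)) ≤ 1 / 4 * (2 * g * (1 / 2)) := mul_le_mul hκ h1 (by positivity) (by norm_num)
    linarith
  have hc1x := mul_le_mul_of_nonneg_right hc1 hx0
  have hexp : κ * (-(8 * C * (∑ i, p i * x i) ^ 2) - 2 * C * (g * Λ) ^ 2 * nsq x
      + 1 / C * μ ^ m * nsq x - θ * nsq x) = -(8 * C * κ * (∑ i, p i * x i) ^ 2)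
      - κ * (2 * C * (g * Λ) ^ 2) * nsq x + κ / C * μ ^ m * nsq x - g * nsq x := by
    rw [← hg]; ring
  rw [hexp] at hP
  have e2 : (κ / C * μ ^ m + g / 4) * nsq x = κ / C * μ ^ m * nsq x + g / 4 * nsq x := by ring
  linarith

theorem hmul_hinv_self (ξ : Heis n) : hmul ξ (hinv ξ) = 0 := by
  refine Prod.ext ?_ (Prod.ext ?_ ?_)
  · simp [hmul, hinv]
  · simp [hmul, hinv]
  · simp [hmul, hinv, mul_comm]

theorem env_dist {η ξ : Heis n} {Rk ρ : ℝ} (hξ : ‖ξ‖ ≤ Rk)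
    (h : Qb n (hmul η (hinv ξ)) (hmul η (hinv ξ)) ≤ ρ ^ 2) (hρ : 0 ≤ ρ) :
    ‖η - ξ‖ ≤ (1 + 4 * n * Rk) * ρ := by
  have h1 : ‖hmul η (hinv ξ)‖ ≤ ρ := by
    have := (Qb_ge (hmul η (hinv ξ))).trans h
    exact abs_le_of_sq_le_sq' this hρ |>.2
  have h2 : η = ξ + Ml (hinv ξ) (hmul η (hinv ξ)) := by
    rw [← hmul_eq_add, hmul_cancel]
  have h3 : η - ξ = Ml (hinv ξ) (hmul η (hinv ξ)) := by
    rw [sub_eq_iff_eq_add, add_comm]; exact h2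
  have hi : ‖hinv ξ‖ = ‖ξ‖ := by
    have : hinv ξ = -ξ := rfl
    rw [this, norm_neg]
  rw [h3]
  refine (Ml_norm_le _ _).trans ?_
  rw [hi]
  have : 0 ≤ Rk := (norm_nonneg _).trans hξ
  gcongr

theorem vecField_norm (j : HIdx n) (ξ : Heis n) : ‖vecField j ξ‖ ≤ 1 + 2 * ‖ξ‖ := by
  have hx : ∀ (k : Heis n) i, |k.1 i| ≤ ‖k‖ := fun k i => (norm_le_pi_norm k.1 i).trans (norm_fst_le k)
  have hy : ∀ (k : Heis n) i, |k.2.1 i| ≤ ‖k‖ := fun k i =>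
    ((norm_le_pi_norm k.2.1 i).trans (norm_fst_le k.2)).trans (norm_snd_le k)
  have h0 := norm_nonneg ξ
  generalize hT : ‖ξ‖ = T at h0 ⊢
  have hx := fun i => (hx ξ i).trans hT.le
  have hy := fun i => (hy ξ i).trans hT.le
  have hs : ∀ j : Fin n, ‖(Pi.single j 1 : Fin n → ℝ)‖ ≤ 1 := by
    intro j
    rw [pi_norm_le_iff_of_nonneg zero_le_one]
    intro i
    rcases eq_or_ne i j with rfl | h
    · simp
    · simp [h]
  rcases j with j | j
  · simp only [vecField, Prod.norm_def]
    refine max_le ((hs j).trans (by linarith)) (max_le (by simp only [norm_zero]; linarith) ?_)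
    rw [norm_mul, Real.norm_eq_abs, Real.norm_eq_abs, abs_two]
    have := hy j
    linarith
  · simp only [vecField, Prod.norm_def]
    refine max_le (by simp only [norm_zero]; linarith) (max_le ((hs j).trans (by linarith)) ?_)
    rw [norm_neg, norm_mul, Real.norm_eq_abs, Real.norm_eq_abs, abs_two]
    have := hx j
    linarith

theorem Qb_hvec_le (Rk : ℝ) : ∃ CQ : ℝ, 0 ≤ CQ ∧ ∀ ξ : Heis n, ‖ξ‖ ≤ Rk → ∀ x,
    Qb n (hvec ξ x) (hvec ξ x) ≤ CQ * nsq x := by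
  refine ⟨‖Qb n‖ * ((1 + 2 * Rk) ^ 2 * Fintype.card (HIdx n)), by positivity, fun ξ hξ x => ?_⟩
  have hR : 0 ≤ Rk := (norm_nonneg _).trans hξ
  have h1 : ‖hvec ξ x‖ ≤ (1 + 2 * Rk) * ∑ j, |x j| := by
    rw [hvec, Finset.mul_sum]
    refine (norm_sum_le _ _).trans (Finset.sum_le_sum fun j _ => ?_)
    rw [norm_smul, Real.norm_eq_abs, mul_comm]
    gcongr
    exact (vecField_norm j ξ).trans (by linarith)
  have h2 : (∑ j, |x j|) ^ 2 ≤ Fintype.card (HIdx n) * nsq x := by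
    have := sq_sum_le_card_mul_sum_sq (s := (Finset.univ : Finset (HIdx n))) (f := fun j => |x j|)
    simpa [nsq] using this
  refine (Qb_le _).trans ?_
  rw [mul_assoc]
  refine mul_le_mul_of_nonneg_left ?_ (ContinuousLinearMap.opNorm_nonneg _)
  calc ‖hvec ξ x‖ ^ 2 ≤ ((1 + 2 * Rk) * ∑ j, |x j|) ^ 2 := by gcongr
    _ = (1 + 2 * Rk) ^ 2 * (∑ j, |x j|) ^ 2 := by ring
    _ ≤ (1 + 2 * Rk) ^ 2 * (Fintype.card (HIdx n) * nsq x) := by gcongr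
    _ = _ := by ring

theorem pnorm_hg_le (Rk : ℝ) (hRk : 0 ≤ Rk) : ∃ CH : ℝ, 0 < CH ∧ ∀ ξ : Heis n, ‖ξ‖ ≤ Rk → ∀ ℓ : Heis n →L[ℝ] ℝ,
    pnorm (hg ℓ ξ) ≤ CH * ‖ℓ‖ := by
  refine ⟨(Fintype.card (HIdx n) + 1) * (1 + 2 * Rk), by positivity, fun ξ hξ ℓ => ?_⟩
  have h1 : ∀ j, |hg ℓ ξ j| ≤ (1 + 2 * Rk) * ‖ℓ‖ := by
    intro j
    have := ℓ.le_opNorm (vecField j ξ)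
    have h2 := vecField_norm j ξ
    calc |hg ℓ ξ j| ≤ ‖ℓ‖ * ‖vecField j ξ‖ := this
      _ ≤ ‖ℓ‖ * (1 + 2 * Rk) := by gcongr; linarith
      _ = _ := mul_comm _ _
  set T := (1 + 2 * Rk) * ‖ℓ‖ with hT
  have hT0 : 0 ≤ T := by positivity
  have hN : (0:ℝ) ≤ Fintype.card (HIdx n) := by positivity
  have h2 : nsq (hg ℓ ξ) ≤ Fintype.card (HIdx n) * T ^ 2 := by
    unfold nsq
    have : ∀ j ∈ (Finset.univ : Finset (HIdx n)), (hg ℓ ξ j) ^ 2 ≤ T ^ 2 := fun j _ => by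
      rw [← sq_abs]; gcongr; exact h1 j
    simpa using Finset.sum_le_card_nsmul _ _ _ this
  rw [mul_assoc, ← hT]
  have : pnorm (hg ℓ ξ) ^ 2 ≤ ((Fintype.card (HIdx n) + 1) * T) ^ 2 := by
    rw [pnorm_sq, mul_pow]
    refine h2.trans ?_
    gcongr
    nlinarith
  exact (abs_le_of_sq_le_sq' this (by positivity)).2

end prep8

section prep9
variable {n : ℕ}

theorem env_pack {K : Set (Heis n)} (hK : IsCompact K) (hKn : K.Nonempty) {v : Heis n → ℝ}
    (hv : UpperSemicontinuousOn v K) {R Rk D : ℝ} (hR : 0 < R) (hvR : ∀ ξ ∈ K, |v ξ| ≤ R)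
    (hRk : ∀ ξ ∈ K, ‖ξ‖ ≤ Rk) (hD : 0 < D) :
    ∃ (a : ℝ) (u : Heis n → ℝ) (y : Heis n → Heis n) (G : Heis n → Heis n →L[ℝ] ℝ) (Kc : ℝ), 0 ≤ Kc ∧
      (∀ ξ, y ξ ∈ K) ∧
      (∀ ξ, u ξ = v (y ξ) - a * Qb n (hmul (y ξ) (hinv ξ)) (hmul (y ξ) (hinv ξ))) ∧
      (∀ ξ, ∀ η ∈ K, v η - a * Qb n (hmul η (hinv ξ)) (hmul η (hinv ξ)) ≤ u ξ) ∧
      (∀ x z, u x + G x (z - x) - Kc * ‖z - x‖ ^ 2 ≤ u z) ∧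
      (∀ ξ ∈ K, ‖y ξ - ξ‖ ≤ D) ∧ (∀ ξ ∈ K, v ξ ≤ u ξ) ∧ (∀ ξ, u ξ ≤ v (y ξ)) ∧ ContinuousOn u K := by
  have hRk0 : 0 ≤ Rk := by obtain ⟨z, hz⟩ := hKn; exact (norm_nonneg z).trans (hRk z hz)
  set M : ℝ := 1 + 4 * n * Rk with hM
  have hM0 : 0 < M := by positivity
  set ρ : ℝ := D / M with hρ
  have hρ0 : 0 < ρ := by positivity
  set a : ℝ := 2 * R / ρ ^ 2 with ha
  have ha0 : 0 < a := by positivity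
  obtain ⟨u, y, G, Kc, h0, h1, h2, h3, h4⟩ := envelope hK hKn hv ha0
  have h5 : ∀ ξ ∈ K, v ξ ≤ u ξ := by
    intro ξ hξ
    have := h3 ξ ξ hξ
    simpa [hmul_hinv_self] using this
  have h6 : ∀ ξ, u ξ ≤ v (y ξ) := by
    intro ξ
    rw [h2 ξ]
    have := mul_nonneg ha0.le (Qb_nonneg (hmul (y ξ) (hinv ξ)))
    linarith
  refine ⟨a, u, y, G, Kc, h0, h1, h2, h3, h4, ?_, h5, h6, ?_⟩
  · intro ξ hξ
    have hq : Qb n (hmul (y ξ) (hinv ξ)) (hmul (y ξ) (hinv ξ)) ≤ ρ ^ 2 := by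
      have e1 := h5 ξ hξ
      rw [h2 ξ] at e1
      have e2 := (abs_le.1 (hvR ξ hξ)).1
      have e3 := (abs_le.1 (hvR _ (h1 ξ))).2
      have e4 : a * Qb n (hmul (y ξ) (hinv ξ)) (hmul (y ξ) (hinv ξ)) ≤ a * ρ ^ 2 := by
        have : a * ρ ^ 2 = 2 * R := by rw [ha]; field_simp
        linarith
      exact le_of_mul_le_mul_left e4 ha0
    have := env_dist (hRk ξ hξ) hq hρ0.le
    have e : M * ρ = D := by rw [hρ]; field_simp
    rw [← hM, e] at this
    exact this
  · have hub : ∀ z, u z ≤ R := fun z => (h6 z).trans (abs_le.1 (hvR _ (h1 z))).2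
    have hlb : ∀ z ∈ K, -R ≤ u z := fun z hz => (abs_le.1 (hvR z hz)).1.trans (h5 z hz)
    have hG : ∀ z ∈ K, ‖G z‖ ≤ 2 * R + Kc := by
      intro z hz
      refine ContinuousLinearMap.opNorm_le_of_unit_norm (by positivity) fun h hh => ?_
      have key : ∀ h : Heis n, ‖h‖ = 1 → G z h ≤ 2 * R + Kc := by
        intro h hh
        have := h4 z (z + h)
        rw [add_sub_cancel_left, hh] at this
        have := hub (z + h)
        have := hlb z hz
        linarith
      rw [Real.norm_eq_abs, abs_le]
      refine ⟨?_, key h hh⟩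
      have := key (-h) (by rw [norm_neg, hh])
      rw [map_neg] at this
      linarith
    have hone : ∀ z ∈ K, ∀ z' ∈ K, u z - u z' ≤ (2 * R + Kc) * ‖z' - z‖ + Kc * ‖z' - z‖ ^ 2 := by
      intro z hz z' hz'
      have e1 := h4 z z'
      have e2 := (G z).le_opNorm (z' - z)
      rw [Real.norm_eq_abs] at e2
      have e3 := (abs_le.1 e2).1
      have e4 := mul_le_mul_of_nonneg_right (hG z hz) (norm_nonneg (z' - z))
      linarith
    intro z hz
    rw [ContinuousWithinAt, tendsto_iff_norm_sub_tendsto_zero]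
    have ht : Tendsto (fun z' : Heis n => (2 * R + Kc) * ‖z' - z‖ + Kc * ‖z' - z‖ ^ 2) (𝓝[K] z) (𝓝 0) := by
      have hc : Continuous (fun z' : Heis n => (2 * R + Kc) * ‖z' - z‖ + Kc * ‖z' - z‖ ^ 2) := by fun_prop
      have := hc.tendsto z
      simp only [sub_self, norm_zero] at this
      have h := this.mono_left (nhdsWithin_le_nhds (s := K))
      simpa using h
    refine squeeze_zero' (Eventually.of_forall fun _ => norm_nonneg _) ?_ ht
    filter_upwards [self_mem_nhdsWithin] with z' hz'
    rw [Real.norm_eq_abs, abs_le]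
    have e1 := hone z hz z' hz'
    have e2 := hone z' hz' z hz
    rw [norm_sub_rev] at e2
    constructor <;> linarith

set_option maxHeartbeats 2000000 in
theorem core_pt {Ω : Set (Heis n)} (hΩ : IsOpen Ω) {L : Heis n → ℝ → (HIdx n → ℝ) → HMat n}
    (hLsymm : ∀ ξ s p, (L ξ s p).IsSymm)
    (hLlip : ∀ i j : HIdx n, LocallyLipschitzOnSet
      (Ω ×ˢ (Set.univ : Set (ℝ × (HIdx n → ℝ))))
      (fun q : Heis n × ℝ × (HIdx n → ℝ) => L q.1 q.2.1 q.2.2 i j))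
    {m : ℝ} (hm : 1 < m) {R C33 C34 C Λ θb θ κ σ lam b d Rk Kc a a' : ℝ}
    (h33 : ∀ ξ ∈ Ω, ∀ s : ℝ, |s| ≤ R → ∀ p : HIdx n → ℝ,
      (DiffInXi L ξ s p → xiGradNorm L ξ s p ≤ C33 * pnorm p ^ m))
    (hC34 : 0 < C34)
    (h34 : ∀ ξ ∈ Ω, ∀ s s' : ℝ, -R ≤ s → s ≤ s' → s' ≤ R →
      ∀ p : HIdx n → ℝ,
      matLE 0 (L ξ s' p - L ξ s p) ∧
      matLE (L ξ s' p - L ξ s p) ((C34 * (s' - s) * pnorm p ^ m) • (1 : HMat n)))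
    (hC33 : 0 < C33) (hC : 0 < C) (hΛ : 0 < Λ)
    (h37 : ∀ θ : ℝ, 0 < θ → θ ≤ θb → ∀ ξ ∈ Ω, ∀ s : ℝ, |s| ≤ R → ∀ p : HIdx n → ℝ,
      DiffInP L ξ s p →
      matLE ((-C) • vecMulVec p p + ((1 / C) * pnorm p ^ m) • (1 : HMat n))
            (pDotGradL L ξ s p - L ξ s p - (θ * Λ * pGradNorm L ξ s p) • (1 : HMat n)
              + θ • (1 : HMat n)))
    (hσ : 0 < σ) (hθ : 0 < θ) (hlam : lam = 16 * C) (hb : 0 ≤ b)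
    (hκ : κ ≤ 1 / 4) (hg1 : C * (σ * θ) * Λ ^ 2 ≤ 1 / 2) (hg2 : 8 * (σ * θ) * Λ ≤ 1)
    {S : Set (HMat n)} (hSsymm : ∀ A ∈ S, A.IsSymm)
    (hSpos : ∀ A ∈ S, ∀ B : HMat n, B.PosDef → A + B ∈ S)
    (hScone : ∀ A ∈ S, ∀ c : ℝ, 1 < c → c • A ∈ S)
    {V W : Heis n → EReal} (hsub : IsSubsolution Ω L S V) (hsup : IsSupersolution Ω L S W)
    {v w u u' : Heis n → ℝ}
    (hVv : ∀ ξ ∈ Ω, V ξ ≤ (v ξ : EReal)) (hWw : ∀ ξ ∈ Ω, (w ξ : EReal) ≤ W ξ)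
    {η η' x : Heis n} (hη : η ∈ Ω) (hη' : η' ∈ Ω) (hVη : V η = (v η : EReal)) (hWη : W η' = (w η' : EReal))
    (hu : u x = v η - a * Qb n (hmul η (hinv x)) (hmul η (hinv x)))
    (hle : ∀ ξ, ∀ η ∈ closure Ω, v η - a * Qb n (hmul η (hinv ξ)) (hmul η (hinv ξ)) ≤ u ξ)
    (hu' : u' x = -w η' - a' * Qb n (hmul η' (hinv x)) (hmul η' (hinv x)))
    (hle' : ∀ ξ, ∀ η ∈ closure Ω, -w η - a' * Qb n (hmul η (hinv ξ)) (hmul η (hinv ξ)) ≤ u' ξ)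
    (hs : |v η| ≤ R) (hs' : |w η'| ≤ R) (hss : v η - w η' ≤ b)
    (hball : Metric.ball η d ⊆ Ω) (hdist : dist η' η < d)
    (herr1 : C34 * b + C33 * Fintype.card (HIdx n) * ‖η' - η‖ ≤ κ / (C * 2 ^ m))
    (herr2 : C34 * b + C33 * Fintype.card (HIdx n) * ‖η' - η‖ ≤ σ * θ / 4)
    (hx : ‖x‖ ≤ Rk) (hKc : 0 ≤ Kc)
    (hκd : κ = σ * lam * Real.exp (lam * u x))
    (hθb : θ ≤ θb * (lam * Real.exp (lam * u x)))
    {ℓ ℓ' p0 : Heis n →L[ℝ] ℝ} {A₁ A₂ : Heis n →L[ℝ] Heis n →L[ℝ] ℝ}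
    (hlow : ∀ y, u x + ℓ (y - x) - Kc * ‖y - x‖ ^ 2 ≤ u y)
    (hexp1 : ∀ ε > 0, ∀ᶠ y in 𝓝 x, |(u y + σ * Real.exp (lam * u y)) - (u x + σ * Real.exp (lam * u x))
      - ((1 + κ) • ℓ) (y - x) - A₁ (y - x) (y - x) / 2| ≤ ε * ‖y - x‖ ^ 2)
    (hexp2 : ∀ ε > 0, ∀ᶠ y in 𝓝 x, |(u' y + σ * θ * zsq y) - (u' x + σ * θ * zsq x)
      - (ℓ' + (2 * (σ * θ)) • Zb n x) (y - x) - A₂ (y - x) (y - x) / 2| ≤ ε * ‖y - x‖ ^ 2)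
    (hsum : (1 + κ) • ℓ + (ℓ' + (2 * (σ * θ)) • Zb n x) = p0)
    (hA : ∀ h, A₁ h h + A₂ h h ≤ 0)
    (hp0 : pnorm (hg p0 x) ≤ σ * θ) (hΛx : 2 * Real.sqrt (zsq x) + 1 ≤ Λ) : False := by
  have hlam0 : 0 < lam := by rw [hlam]; positivity
  have hκ0 : 0 < κ := by rw [hκd]; positivity
  obtain ⟨CQ, hCQ0, hCQ⟩ := Qb_hvec_le (n := n) Rk
  set g : ℝ := σ * θ with hgdef
  have hg0 : 0 < g := by positivity
  set δ : ℝ := g / (32 * (CQ + 1)) with hδ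
  have hδ0 : 0 < δ := by positivity
  have hδQ : ∀ X, δ * Qb n (hvec x X) (hvec x X) ≤ g / 32 * nsq X := by
    intro X
    have h1 := mul_le_mul_of_nonneg_left (hCQ x hx X) hδ0.le
    have h2 : δ * (CQ + 1) = g / 32 := by rw [hδ]; field_simp
    have h3 := mul_nonneg hδ0.le (nsq_nonneg X)
    have h4 : δ * (CQ * nsq X) = g / 32 * nsq X - δ * nsq X := by rw [← h2]; ring
    linarith
  have hexpu := exp_expand hKc hσ hlam0 hκd hlow hexp1 δ hδ0
  obtain ⟨HA, -, hHAq, hHAS⟩ := sub_test hΩ hsub hVv hη hVη hu hle hδ0 hexpu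
  have hexpu' : ∀ᶠ z in 𝓝 x, u' z - u' x - ℓ' (z - x) - (A₂ - (2 * g) • Zb n) (z - x) (z - x) / 2 ≤ δ * ‖z - x‖ ^ 2 := by
    filter_upwards [hexp2 δ hδ0] with z hz
    have h1 := (abs_le.1 hz).2
    have h2 : zsq z = zsq x + 2 * Zb n x (z - x) + Zb n (z - x) (z - x) := by
      rw [← Zb_self, ← Zb_self]
      simp only [map_sub, _root_.sub_apply]
      rw [Zb_symm z x]; ring
    simp only [_root_.add_apply, _root_.sub_apply, _root_.smul_apply, smul_eq_mul] at h1 ⊢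
    rw [h2] at h1
    linarith
  obtain ⟨HB, hHBs, hHBq, hHBS⟩ := super_test hΩ hsup hWw hη' hWη hu' hle' hδ0 hexpu'
  set r : HIdx n → ℝ := (2:ℝ) • hg (Zb n x) x + (-g⁻¹) • hg p0 x with hr
  have hq : -hg ℓ' x = (1 + κ) • hg ℓ x + g • r := by
    ext j
    have h1 : p0 (vecField j x) = (1 + κ) * ℓ (vecField j x) + (ℓ' (vecField j x) + 2 * g * Zb n x (vecField j x)) := by
      rw [← hsum]; simp
    simp only [hr, hg, Pi.neg_apply, Pi.add_apply, Pi.smul_apply, smul_eq_mul, h1]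
    field_simp
    ring
  have hrΛ : pnorm r ≤ Λ := by
    refine (pnorm_add _ _).trans ?_
    rw [pnorm_smul, pnorm_smul, abs_two, abs_neg, abs_of_pos (inv_pos.2 hg0), pnorm_hg_Zb]
    have := mul_le_mul_of_nonneg_left hp0 (inv_pos.2 hg0).le
    rw [inv_mul_cancel₀ hg0.ne'] at this
    linarith
  have hθ2 : g / κ ≤ θb := by
    rw [div_le_iff₀ hκ0, hκd, hgdef]
    have := mul_le_mul_of_nonneg_left hθb hσ.le
    linarith
  have hLe := fun X => L_est hLlip hm (g := g) (θ := g / κ) h33 hC34 h34 hC33 hC hΛ (by positivity) hκ0 hκ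
    (by field_simp) hb (h37 (g / κ) (by positivity) hθ2) hg1 hg2 hs hs' hss hball hdist herr1 herr2 hrΛ hq X
  refine hHBS (mem_of_gap hSsymm hSpos hScone hHAS ?_ (τ := 1 + κ) (c := g / 4) (by linarith) (by positivity) ?_)
  · have h1 : HBᵀ = HB := hHBs
    have h2 : (L η' (w η') (-hg ℓ' x))ᵀ = _ := hLsymm _ _ _
    rw [Matrix.IsSymm, transpose_add, h1, h2]
  · intro X
    rw [qf_add, qf_add, hHAq, hHBq]
    have e1 := hLe X
    have e2 := hA (hvec x X)
    have e3 : ℓ (hvec x X) = ∑ j, hg ℓ x j * X j := apply_hvec ℓ x X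
    have e4 : Zb n (hvec x X) (hvec x X) = nsq X := by rw [Zb_self, zsq_hvec]
    have e5 := hδQ X
    have e6 := nsq_nonneg X
    have e7 : 0 ≤ δ * Qb n (hvec x X) (hvec x X) := mul_nonneg hδ0.le (Qb_nonneg _)
    simp only [_root_.smul_apply, _root_.sub_apply, ContinuousLinearMap.smulRight_apply, smul_eq_mul]
    rw [e4, e3]
    have e8 : κ * lam / 2 = 8 * C * κ := by rw [hlam]; ring
    rw [e8]
    generalize hT : (∑ j, hg ℓ x j * X j) = T at e1 ⊢
    generalize hQ : Qb n (hvec x X) (hvec x X) = Q at e5 e7 ⊢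
    have e9 : (1 + κ) * ((1 + κ)⁻¹ * (A₁ (hvec x X) (hvec x X) - 8 * C * κ * (T * T)) + 2 * δ * Q
        + qf (L η (v η) (hg ℓ x)) X) = (A₁ (hvec x X) (hvec x X) - 8 * C * κ * (T * T)) + (1 + κ) * (2 * (δ * Q))
        + (1 + κ) * qf (L η (v η) (hg ℓ x)) X := by
      field_simp
    rw [e9]
    have e10 : κ * (2 * (δ * Q)) ≤ 1 / 4 * (2 * (δ * Q)) := mul_le_mul_of_nonneg_right hκ (by linarith)
    have e11 : 0 ≤ g * nsq X := by positivity
    linarith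

end prep9

section prep10
variable {n : ℕ}

theorem ev_small (c : ℝ) {d : ℝ} (hd : 0 < d) : ∀ᶠ s in 𝓝[>] (0:ℝ), c * s ≤ d := by
  have : Tendsto (fun s : ℝ => c * s) (𝓝[>] 0) (𝓝 0) := by
    have hc : Continuous fun s : ℝ => c * s := by fun_prop
    have := (hc.tendsto 0).mono_left (nhdsWithin_le_nhds (s := Set.Ioi 0))
    simpa using this
  exact (this.eventually (gt_mem_nhds hd)).mono fun _ h => le_of_lt h

theorem ev_pos : ∀ᶠ s in 𝓝[>] (0:ℝ), 0 < s := self_mem_nhdsWithin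

set_option maxHeartbeats 4000000 in
theorem core {Ω : Set (Heis n)} (hΩ : IsOpen Ω) (hK : IsCompact (closure Ω))
    {L : Heis n → ℝ → (HIdx n → ℝ) → HMat n}
    (hLsymm : ∀ ξ s p, (L ξ s p).IsSymm)
    (hLlip : ∀ i j : HIdx n, LocallyLipschitzOnSet
      (Ω ×ˢ (Set.univ : Set (ℝ × (HIdx n → ℝ))))
      (fun q : Heis n × ℝ × (HIdx n → ℝ) => L q.1 q.2.1 q.2.2 i j))
    {m : ℝ} (hm : 1 < m) (h33 : Cond33 Ω L m) (h34 : Cond34 Ω L m) (h37 : Cond37 Ω L m)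
    {S : Set (HMat n)} (hSsymm : ∀ A ∈ S, A.IsSymm)
    (hSpos : ∀ A ∈ S, ∀ B : HMat n, B.PosDef → A + B ∈ S)
    (hScone : ∀ A ∈ S, ∀ c : ℝ, 1 < c → c • A ∈ S)
    {V W : Heis n → EReal} (hsub : IsSubsolution Ω L S V) (hsup : IsSupersolution Ω L S W)
    {v t : Heis n → ℝ} (hv : UpperSemicontinuousOn v (closure Ω)) (ht : UpperSemicontinuousOn t (closure Ω))
    {R : ℝ} (hR : 2 ≤ R) (hvR : ∀ ξ ∈ closure Ω, -R ≤ v ξ ∧ v ξ ≤ R - 2)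
    (htR : ∀ ξ ∈ closure Ω, -R ≤ t ξ ∧ t ξ ≤ R - 2)
    (hVv : ∀ ξ ∈ Ω, V ξ ≤ (v ξ : EReal)) (hWw : ∀ ξ ∈ Ω, ((-t ξ : ℝ) : EReal) ≤ W ξ)
    (hVeq : ∀ ξ ∈ Ω, -R < v ξ → V ξ = (v ξ : EReal))
    (hWeq : ∀ ξ ∈ Ω, -R < t ξ → W ξ = ((-t ξ : ℝ) : EReal))
    (hle : ∀ ξ ∈ closure Ω, v ξ + t ξ ≤ 0) (hfr : ∀ ξ ∈ frontier Ω, v ξ + t ξ < 0)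
    {ξ₀ : Heis n} (hξ₀ : ξ₀ ∈ Ω) (h0 : v ξ₀ + t ξ₀ = 0) : False := by
  have hξK : ξ₀ ∈ closure Ω := subset_closure hξ₀
  have hKn : (closure Ω).Nonempty := ⟨ξ₀, hξK⟩
  have hR0 : 0 < R := by linarith
  have hvR' : ∀ ξ ∈ closure Ω, |v ξ| ≤ R := fun ξ h => abs_le.2 ⟨(hvR ξ h).1, by linarith [(hvR ξ h).2]⟩
  have htR' : ∀ ξ ∈ closure Ω, |t ξ| ≤ R := fun ξ h => abs_le.2 ⟨(htR ξ h).1, by linarith [(htR ξ h).2]⟩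
  obtain ⟨Rk, hRk⟩ := hK.isBounded.exists_norm_le
  have hRk0 : 0 ≤ Rk := (norm_nonneg ξ₀).trans (hRk _ hξK)
  have hzle : ∀ ξ : Heis n, zsq ξ ≤ ‖Zb n‖ * ‖ξ‖ ^ 2 := by
    intro ξ
    have := (Zb n).le_opNorm₂ ξ ξ
    rw [mul_assoc, ← sq] at this
    rw [← Zb_self]
    exact (le_abs_self _).trans this
  have hZn : 0 ≤ ‖Zb n‖ := ContinuousLinearMap.opNorm_nonneg _
  set ρ : ℝ := ‖Zb n‖ * Rk ^ 2 with hρ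
  have hρ0 : 0 ≤ ρ := by positivity
  have hzρ : ∀ ξ ∈ closure Ω, zsq ξ ≤ ρ := by
    intro ξ hξ
    refine (hzle ξ).trans ?_
    have := hRk ξ hξ
    rw [hρ]; gcongr
  have hz0 : ∀ ξ : Heis n, 0 ≤ zsq ξ := fun ξ => Finset.sum_nonneg fun i _ => by positivity
  set Λ : ℝ := 2 * Real.sqrt ρ + 1 with hΛd
  have hΛ : 0 < Λ := by positivity
  obtain ⟨θb, hθb, C, hC, h37⟩ := h37 R hR0 Λ hΛ
  obtain ⟨C33, hC33, h33⟩ := h33 R hR0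
  obtain ⟨C34, hC34, h34⟩ := h34 R hR0
  obtain ⟨CH, hCH, hCHb⟩ := pnorm_hg_le (n := n) Rk hRk0
  obtain ⟨a₀, ha₀, hCl⟩ := lemmaC hΩ hK hv ht hfr
  set a : ℝ := min a₀ 1 with had
  have ha : 0 < a := lt_min ha₀ one_pos
  have ha1 : a ≤ 1 := min_le_right _ _
  have haa : a ≤ a₀ := min_le_left _ _
  have hCa : ∀ η ∈ closure Ω, ∀ η' ∈ closure Ω, dist η η' ≤ a → -a ≤ v η + t η' → Metric.ball η (2 * a) ⊆ Ω :=
    fun η h1 η' h2 h3 h4 => (Metric.ball_subset_ball (by linarith)).trans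
      (hCl η h1 η' h2 (by linarith) (by linarith))
  set lam : ℝ := 16 * C with hlam
  have hlam0 : 0 < lam := by positivity
  set ER : ℝ := Real.exp (lam * R) with hER
  have hER0 : 0 < ER := Real.exp_pos _
  set er : ℝ := Real.exp (-(lam * R)) with her
  have her0 : 0 < er := Real.exp_pos _
  set θ : ℝ := θb * (lam * er) with hθd
  have hθ : 0 < θ := by positivity
  obtain ⟨σ, hσ, hs1, hs2, hs3, hs4⟩ := (ev_pos.and ((ev_small (lam * ER) (show (0:ℝ) < 1 / 4 by norm_num)).and
    ((ev_small (8 * θ * Λ) one_pos).and ((ev_small (C * θ * Λ ^ 2) (show (0:ℝ) < 1 / 2 by norm_num)).and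
    (ev_small (ER + θ * ρ) (show 0 < a / 2 by positivity)))))).exists
  set g : ℝ := σ * θ with hgd
  have hg : 0 < g := by positivity
  set κm : ℝ := σ * lam * er with hκm
  have hκm0 : 0 < κm := by positivity
  set e0 : ℝ := min (κm / (C * 2 ^ m)) (g / 4) with he0
  have he00 : 0 < e0 := lt_min (by positivity) (by positivity)
  have he01 : e0 ≤ κm / (C * 2 ^ m) := min_le_left _ _
  have he02 : e0 ≤ g / 4 := min_le_right _ _
  set b : ℝ := e0 / (2 * C34) with hbd
  have hb : 0 < b := by positivity
  have hbe : C34 * b = e0 / 2 := by rw [hbd]; field_simp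
  obtain ⟨aD, haD, hDl⟩ := lemmaD hK hv ht hle hb
  set N : ℝ := ((Fintype.card (HIdx n) : ℕ) : ℝ) with hN
  have hN0 : 0 ≤ N := by positivity
  obtain ⟨D, hD, hD1, hD2, hD3⟩ := (ev_pos.and ((ev_small 2 ha).and ((ev_small 2 haD).and
    (ev_small (C33 * N * 2) (show 0 < e0 / 2 by positivity))))).exists
  obtain ⟨r, hr, hr1, hr2⟩ := (ev_pos.and ((ev_small (2 * Rk) (show 0 < a / 2 by positivity)).and
    (ev_small CH hg))).exists
  obtain ⟨α, u, y, G, Kc, hKc, hyK, hu, hul, hsc, hyD, hvu, huv, huc⟩ := env_pack hK hKn hv hR0 hvR' hRk hD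
  obtain ⟨α', u', y', G', Kc', hKc', hyK', hu', hul', hsc', hyD', hvu', huv', huc'⟩ :=
    env_pack hK hKn ht hR0 htR' hRk hD
  have huR : ∀ ξ, u ξ ≤ R := fun ξ => (huv ξ).trans (abs_le.1 (hvR' _ (hyK ξ))).2
  have huR' : ∀ ξ, u' ξ ≤ R := fun ξ => (huv' ξ).trans (abs_le.1 (htR' _ (hyK' ξ))).2
  have hlu : ∀ ξ ∈ closure Ω, -R ≤ u ξ := fun ξ h => (abs_le.1 (hvR' ξ h)).1.trans (hvu ξ h)
  have hlu' : ∀ ξ ∈ closure Ω, -R ≤ u' ξ := fun ξ h => (abs_le.1 (htR' ξ h)).1.trans (hvu' ξ h)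
  have hEu : ∀ ξ, Real.exp (lam * u ξ) ≤ ER := fun ξ =>
    Real.exp_le_exp.2 (mul_le_mul_of_nonneg_left (huR ξ) hlam0.le)
  have hEl : ∀ ξ ∈ closure Ω, er ≤ Real.exp (lam * u ξ) := fun ξ h => by
    refine Real.exp_le_exp.2 ?_
    have := mul_le_mul_of_nonneg_left (hlu ξ h) hlam0.le
    linarith
  set κ : Heis n → ℝ := fun ξ => σ * lam * Real.exp (lam * u ξ) with hκd
  have hκ0 : ∀ ξ, 0 < κ ξ := fun ξ => by simp only [hκd]; positivity
  have hκ4 : ∀ ξ, κ ξ ≤ 1 / 4 := fun ξ => by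
    have := mul_le_mul_of_nonneg_left (hEu ξ) (show 0 ≤ σ * lam by positivity)
    simp only [hκd]; linarith
  set U₁ : Heis n → ℝ := fun ξ => u ξ + σ * Real.exp (lam * u ξ) with hU₁
  set U₂ : Heis n → ℝ := fun ξ => u' ξ + σ * θ * zsq ξ with hU₂
  set G₁ : Heis n → Heis n →L[ℝ] ℝ := fun ξ => (1 + κ ξ) • G ξ with hG₁
  set G₂ : Heis n → Heis n →L[ℝ] ℝ := fun ξ => G' ξ + (2 * (σ * θ)) • Zb n ξ with hG₂
  have hzexp : ∀ x z : Heis n, zsq z = zsq x + 2 * Zb n x (z - x) + zsq (z - x) := by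
    intro x z
    rw [← Zb_self, ← Zb_self, ← Zb_self]
    simp only [map_sub, _root_.sub_apply]
    rw [Zb_symm z x]; ring
  have good : ∀ p : Heis n →L[ℝ] ℝ, ‖p‖ < r → ∀ x ∈ closure Ω,
      (∀ y ∈ closure Ω, U₁ y + U₂ y - p y ≤ U₁ x + U₂ x - p x) →
      -a ≤ v (y x) + t (y' x) ∧ dist (y x) (y' x) ≤ 2 * D ∧ Metric.ball (y x) (2 * a) ⊆ Ω ∧ Metric.ball x a ⊆ Ω := by
    intro p hp x hx hmax
    have e1 := hmax ξ₀ hξK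
    have e2 : |p x| ≤ r * Rk := (p.le_opNorm x).trans (mul_le_mul hp.le (hRk x hx) (norm_nonneg _) hr.le)
    have e3 : |p ξ₀| ≤ r * Rk := (p.le_opNorm ξ₀).trans (mul_le_mul hp.le (hRk _ hξK) (norm_nonneg _) hr.le)
    have e4 := (abs_le.1 e2).1
    have e5 := (abs_le.1 e3).2
    have e6 := hvu ξ₀ hξK
    have e7 := hvu' ξ₀ hξK
    have e8 : 0 ≤ σ * Real.exp (lam * u ξ₀) := by positivity
    have e9 : 0 ≤ σ * θ * zsq ξ₀ := mul_nonneg (by positivity) (hz0 _)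
    have e10 := mul_le_mul_of_nonneg_left (hEu x) hσ.le
    have e11 := mul_le_mul_of_nonneg_left (hzρ x hx) hg.le
    have e12 := huv x
    have e13 := huv' x
    simp only [hU₁, hU₂] at e1
    have e14 : -a ≤ v (y x) + t (y' x) := by
      rw [hgd] at e11
      linarith
    have d1 : dist (y x) x ≤ D := by rw [dist_eq_norm]; exact hyD x hx
    have d2 : dist (y' x) x ≤ D := by rw [dist_eq_norm]; exact hyD' x hx
    have d3 : dist (y x) (y' x) ≤ 2 * D := by
      have := dist_triangle_right (y x) (y' x) x
      linarith
    have d4 := hCa _ (hyK x) _ (hyK' x) (by linarith) e14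
    refine ⟨e14, d3, d4, (Metric.ball_subset_ball' ?_).trans d4⟩
    rw [dist_comm]; linarith
  have hzc : Continuous (zsq : Heis n → ℝ) := by unfold zsq; fun_prop
  obtain ⟨p0, hp0, x, hxK, hmax, hGsum, A₁, A₂, hexp1, hexp2, hA⟩ := jensen_alexandrov (U₁ := U₁) (U₂ := U₂)
    (G₁ := G₁) (G₂ := G₂) (K := 2 * Kc + Kc') (C₀ := 2 * R + σ * ER + 2 * g * ‖Zb n‖ * (Rk ^ 2 + 1)) (d := a) (r := r)
    (by positivity) (by positivity) ha hr (C := closure Ω) (by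
      intro x z
      have e1 := hsc x z
      have e2 := Real.add_one_le_exp (lam * (u z - u x))
      have e3 : Real.exp (lam * u z) = Real.exp (lam * u x) * Real.exp (lam * (u z - u x)) := by
        rw [← Real.exp_add]; congr 1; ring
      have e4 : σ * Real.exp (lam * u x) * (lam * (u z - u x) + 1) ≤ σ * Real.exp (lam * u z) := by
        rw [e3, ← mul_assoc]
        exact mul_le_mul_of_nonneg_left e2 (by positivity)
      have e5 : σ * Real.exp (lam * u x) * (lam * (u z - u x) + 1) = κ x * (u z - u x) + σ * Real.exp (lam * u x) := by
        simp only [hκd]; ring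
      have e6 : (1 + κ x) * (G x (z - x) - Kc * ‖z - x‖ ^ 2) ≤ (1 + κ x) * (u z - u x) :=
        mul_le_mul_of_nonneg_left (by linarith) (by linarith [hκ0 x])
      have e7 : (1 + κ x) * (Kc * ‖z - x‖ ^ 2) ≤ (1 + 1 / 4) * (Kc * ‖z - x‖ ^ 2) :=
        mul_le_mul_of_nonneg_right (by linarith [hκ4 x]) (by positivity)
      have e8 : 0 ≤ Kc * ‖z - x‖ ^ 2 := by positivity
      have e9 : 0 ≤ Kc' * ‖z - x‖ ^ 2 := by positivity
      simp only [hU₁, hG₁, _root_.smul_apply, smul_eq_mul]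
      linarith) (by
      intro x z
      have e1 := hsc' x z
      have e2 := mul_nonneg hg.le (hz0 (z - x))
      have e3 := hzexp x z
      have e8 : 0 ≤ Kc * ‖z - x‖ ^ 2 := by positivity
      simp only [hU₂, hG₂, _root_.smul_apply, _root_.add_apply, smul_eq_mul]
      rw [e3]
      rw [hgd] at e2
      linarith) (by
      intro e he z
      have e1 := huR z
      have e2 := hlu e he
      have e3 := mul_le_mul_of_nonneg_left (hEu z) hσ.le
      have e4 : 0 ≤ σ * Real.exp (lam * u e) := by positivity
      have e5 : 0 ≤ 2 * g * ‖Zb n‖ * (Rk ^ 2 + 1) := by positivity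
      have e6 : 0 ≤ (2 * R + σ * ER + 2 * g * ‖Zb n‖ * (Rk ^ 2 + 1)) * ‖z - e‖ ^ 2 := by positivity
      simp only [hU₁]
      linarith) (by
      intro e he z
      have e1 := huR' z
      have e2 := hlu' e he
      have e3 : 0 ≤ σ * θ * zsq e := mul_nonneg (by positivity) (hz0 _)
      have e4 : ‖z‖ ^ 2 ≤ 2 * (Rk ^ 2 + ‖z - e‖ ^ 2) := by
        have h1 : ‖z‖ ≤ Rk + ‖z - e‖ := by
          have := norm_add_le e (z - e)
          rw [add_sub_cancel] at this
          linarith [hRk e he]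
        have h2 := norm_nonneg z
        nlinarith [sq_nonneg (Rk - ‖z - e‖)]
      have e5 : σ * θ * zsq z ≤ g * (‖Zb n‖ * (2 * (Rk ^ 2 + ‖z - e‖ ^ 2))) :=
        mul_le_mul_of_nonneg_left ((hzle z).trans (mul_le_mul_of_nonneg_left e4 hZn)) hg.le
      have e6 : 0 ≤ (2 * R + σ * ER) * ‖z - e‖ ^ 2 := by positivity
      have e7 : 0 ≤ g * ‖Zb n‖ * Rk ^ 2 * ‖z - e‖ ^ 2 := by positivity
      have e8 : 0 ≤ g * ‖Zb n‖ := by positivity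
      have e9 : 0 ≤ σ * ER := by positivity
      simp only [hU₂]
      linarith) (by
      intro p hp
      have hcont : ContinuousOn (fun z => U₁ z + U₂ z - p z) (closure Ω) := by
        simp only [hU₁, hU₂]
        have hcp : ContinuousOn (fun z => p z) (closure Ω) := p.continuous.continuousOn
        have hcz : ContinuousOn (fun z : Heis n => zsq z) (closure Ω) := hzc.continuousOn
        have hce : ContinuousOn (fun z => Real.exp (lam * u z)) (closure Ω) :=
          Real.continuous_exp.comp_continuousOn (continuousOn_const.mul huc)
        exact ((huc.add (continuousOn_const.mul hce)).add (huc'.add (continuousOn_const.mul hcz))).sub hcp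
      obtain ⟨x, hx, hm⟩ := hK.exists_isMaxOn hKn hcont
      have hm' : ∀ y ∈ closure Ω, U₁ y + U₂ y - p y ≤ U₁ x + U₂ x - p x := fun y hy => hm hy
      exact ⟨x, hx, (good p hp x hx hm').2.2.2.trans subset_closure, hm'⟩)
  obtain ⟨g1, g2, g3, g4⟩ := good p0 hp0 x hxK hmax
  have hηΩ : y x ∈ Ω := g3 (Metric.mem_ball_self (by positivity))
  have hdist : dist (y' x) (y x) < 2 * a := by rw [dist_comm]; linarith
  have hηΩ' : y' x ∈ Ω := g3 hdist
  have hnrm : ‖y' x - y x‖ ≤ 2 * D := by rw [← dist_eq_norm, dist_comm]; exact g2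
  have herr : C34 * b + C33 * N * ‖y' x - y x‖ ≤ e0 := by
    have : C33 * N * ‖y' x - y x‖ ≤ C33 * N * (2 * D) := mul_le_mul_of_nonneg_left hnrm (by positivity)
    linarith
  have hκx : κm ≤ κ x := by
    simp only [hκm, hκd]
    exact mul_le_mul_of_nonneg_left (hEl x hxK) (by positivity)
  have hbv := hDl _ (hyK x) _ (hyK' x) (by linarith)
  have hvx := hvR _ (hyK x)
  have htx := htR _ (hyK' x)
  refine core_pt hΩ hLsymm hLlip hm (fun ξ h1 s h2 p => (h33 ξ h1 s h2 p).1) hC34 h34 hC33 hC hΛ h37 hσ hθ hlam hb.le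
    (hκ4 x) (by linarith) (by linarith) hSsymm hSpos hScone hsub hsup (w := fun z => -t z) hVv hWw hηΩ hηΩ'
    (hVeq _ hηΩ (by linarith)) (hWeq _ hηΩ' (by linarith)) (hu x) hul (u' := u')
    (by rw [neg_neg]; exact hu' x) (by simpa only [neg_neg] using hul') (hvR' _ (hyK x))
    (by rw [abs_neg]; exact htR' _ (hyK' x)) (by rw [sub_neg_eq_add]; exact hbv) g3 hdist
    (herr.trans (he01.trans ?_)) (herr.trans he02) (hRk x hxK) hKc rfl ?_ (hsc x) hexp1 hexp2 hGsum hA ?_ ?_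
  · gcongr
  · rw [hθd]
    exact mul_le_mul_of_nonneg_left (mul_le_mul_of_nonneg_left (hEl x hxK) hlam0.le) hθb.le
  · refine (hCHb x (hRk x hxK) p0).trans ((mul_le_mul_of_nonneg_left hp0.le hCH.le).trans hr2)
  · have := Real.sqrt_le_sqrt (hzρ x hxK)
    linarith

end prep10

theorem trunc_facts {A : EReal} {a R R₀ : ℝ} (h : (a : EReal) = max A ((-R : ℝ) : EReal))
    (hA : A ≤ (R₀ : EReal)) (hR : -R ≤ R₀) :
    -R ≤ a ∧ a ≤ R₀ ∧ A ≤ (a : EReal) ∧ (-R < a → A = (a : EReal)) := by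
  refine ⟨?_, ?_, ?_, ?_⟩
  · have : ((-R : ℝ) : EReal) ≤ (a : EReal) := by rw [h]; exact le_max_right _ _
    exact EReal.coe_le_coe_iff.1 this
  · have : (a : EReal) ≤ (R₀ : EReal) := by
      rw [h]; exact max_le hA (EReal.coe_le_coe_iff.2 hR)
    exact EReal.coe_le_coe_iff.1 this
  · rw [h]; exact le_max_left _ _
  · intro hlt
    rcases max_choice A ((-R : ℝ) : EReal) with h1 | h1
    · rw [h, h1]
    · rw [h1] at h
      have := EReal.coe_eq_coe_iff.1 h
      linarith

/-- Principle of propagation of touching points for general operators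
satisfying the structural conditions (3.3), (3.4) and (3.7). -/
theorem propagation_of_touching_points_general_cat
    {n : ℕ} (hn : 1 ≤ n)
    (Ω : Set (Heis n)) (hΩopen : IsOpen Ω) (hΩne : Ω.Nonempty)
    (hΩbdd : Bornology.IsBounded Ω)
    (L : Heis n → ℝ → (HIdx n → ℝ) → HMat n)
    (hLsymm : ∀ ξ s p, (L ξ s p).IsSymm)
    (hLlip : ∀ i j : HIdx n, LocallyLipschitzOnSet
      (Ω ×ˢ (Set.univ : Set (ℝ × (HIdx n → ℝ))))
      (fun q : Heis n × ℝ × (HIdx n → ℝ) => L q.1 q.2.1 q.2.2 i j))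
    (m : ℝ) (hm : 1 < m)
    (h33 : Cond33 Ω L m) (h34 : Cond34 Ω L m) (h37 : Cond37 Ω L m)
    (S : Set (HMat n)) (hSne : S.Nonempty) (hSsymm : ∀ A ∈ S, A.IsSymm)
    (hSopen : RelOpen S)
    (hSpos : ∀ A ∈ S, ∀ B : HMat n, B.PosDef → A + B ∈ S)
    (hScone : ∀ A ∈ S, ∀ c : ℝ, 1 < c → c • A ∈ S)
    (w v : Heis n → EReal)
    (hw : LSCFun (closure Ω) w) (hv : USCFun (closure Ω) v)
    (hwsuper : IsSupersolution Ω L S w)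
    (hvsub : IsSubsolution Ω L S v)
    (hge : ∀ ξ ∈ Ω, v ξ ≤ w ξ)
    (hbdry : ∀ ξ ∈ frontier Ω, v ξ < w ξ) :
    ∀ ξ ∈ Ω, v ξ < w ξ := by
  by_contra hcon
  push Not at hcon
  obtain ⟨ξ₀, hξ₀, hge0⟩ := hcon
  have heq : v ξ₀ = w ξ₀ := le_antisymm (hge ξ₀ hξ₀) hge0
  have hK : IsCompact (closure Ω) := hΩbdd.isCompact_closure
  have hKn : (closure Ω).Nonempty := hΩne.closure
  obtain ⟨hwl, hwb, -⟩ := hw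
  obtain ⟨hvu, hvt, -⟩ := hv
  have hnu : UpperSemicontinuousOn (fun ξ => -w ξ) (closure Ω) := by
    intro ξ hξ y hy
    have h1 : -y < w ξ := EReal.neg_lt_comm.1 hy
    filter_upwards [hwl ξ hξ (-y) h1] with η hη
    exact EReal.neg_lt_comm.1 hη
  have hnt : ∀ ξ ∈ closure Ω, -w ξ ≠ ⊤ := by
    intro ξ hξ h
    exact hwb ξ hξ (EReal.neg_eq_top_iff.1 h)
  obtain ⟨R₁, hR₁⟩ := usc_bound hK hKn hvu hvt
  obtain ⟨R₂, hR₂⟩ := usc_bound hK hKn hnu hnt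
  obtain ⟨R₀, h00, h01, h02⟩ : ∃ R₀ : ℝ, 0 ≤ R₀ ∧ R₁ ≤ R₀ ∧ R₂ ≤ R₀ :=
    ⟨max 0 (max R₁ R₂), le_max_left _ _, (le_max_left _ _).trans (le_max_right _ _),
      (le_max_right _ _).trans (le_max_right _ _)⟩
  obtain ⟨a, ha, hau⟩ := usc_trunc hvu hvt (-(R₀ + 2))
  obtain ⟨t, ht, htu⟩ := usc_trunc hnu hnt (-(R₀ + 2))
  have fa : ∀ ξ ∈ closure Ω, _ := fun ξ hξ => trunc_facts (ha ξ hξ)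
    ((hR₁ ξ hξ).trans (EReal.coe_le_coe_iff.2 h01)) (by linarith)
  have ft : ∀ ξ ∈ closure Ω, _ := fun ξ hξ => trunc_facts (ht ξ hξ)
    ((hR₂ ξ hξ).trans (EReal.coe_le_coe_iff.2 h02)) (by linarith)
  have weq : ∀ ξ ∈ closure Ω, -(R₀ + 2) < t ξ → w ξ = ((-t ξ : ℝ) : EReal) := by
    intro ξ hξ h
    have h1 := (ft ξ hξ).2.2.2 h
    rw [EReal.coe_neg, ← h1, neg_neg]
  have hfr : ∀ ξ ∈ frontier Ω, a ξ + t ξ < 0 := by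
    intro ξ hξ
    have hc := frontier_subset_closure hξ
    obtain ⟨a1, a2, a3, a4⟩ := fa ξ hc
    obtain ⟨t1, t2, t3, t4⟩ := ft ξ hc
    rcases a1.eq_or_lt with h | h
    · linarith
    rcases t1.eq_or_lt with h' | h'
    · linarith
    have := hbdry ξ hξ
    rw [a4 h, weq ξ hc h', EReal.coe_lt_coe_iff] at this
    linarith
  have hin : ∀ ξ ∈ Ω, a ξ + t ξ ≤ 0 := by
    intro ξ hξ
    have hc := subset_closure hξ
    obtain ⟨a1, a2, a3, a4⟩ := fa ξ hc
    obtain ⟨t1, t2, t3, t4⟩ := ft ξ hc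
    rcases a1.eq_or_lt with h | h
    · linarith
    rcases t1.eq_or_lt with h' | h'
    · linarith
    have := hge ξ hξ
    rw [a4 h, weq ξ hc h', EReal.coe_le_coe_iff] at this
    linarith
  have hle : ∀ ξ ∈ closure Ω, a ξ + t ξ ≤ 0 := by
    intro ξ hξ
    by_cases h : ξ ∈ Ω
    · exact hin ξ h
    · exact (hfr ξ (by rw [hΩopen.frontier_eq]; exact ⟨hξ, h⟩)).le
  have hWw : ∀ ξ ∈ Ω, ((-t ξ : ℝ) : EReal) ≤ w ξ := by
    intro ξ hξ
    have := (ft ξ (subset_closure hξ)).2.2.1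
    rw [EReal.coe_neg]
    exact EReal.neg_le.1 this
  have h0 : a ξ₀ + t ξ₀ = 0 := by
    have hc := subset_closure hξ₀
    refine le_antisymm (hin ξ₀ hξ₀) ?_
    have h1 : ((-t ξ₀ : ℝ) : EReal) ≤ (a ξ₀ : EReal) :=
      (hWw ξ₀ hξ₀).trans (heq ▸ (fa ξ₀ hc).2.2.1)
    have := EReal.coe_le_coe_iff.1 h1
    linarith
  exact core hΩopen hK hLsymm hLlip hm h33 h34 h37 hSsymm hSpos hScone hvsub hwsuper hau htu
    (R := R₀ + 2) (by linarith)
    (fun ξ hξ => ⟨(fa ξ hξ).1, by linarith [(fa ξ hξ).2.1]⟩)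
    (fun ξ hξ => ⟨(ft ξ hξ).1, by linarith [(ft ξ hξ).2.1]⟩)
    (fun ξ hξ => (fa ξ (subset_closure hξ)).2.2.1) hWw
    (fun ξ hξ => (fa ξ (subset_closure hξ)).2.2.2)
    (fun ξ hξ => weq ξ (subset_closure hξ)) hle hfr hξ₀ h0
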